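/- Let G be a 3-connected maximal 1-plane graph on n ≥ 5 vertices that is immovable. Then the number of edges of G satisfies |E(G)| ≥ (10/3)(n−2). -/

import Mathlib

open Set

/-- A drawing of a simple graph in the plane: each vertex is assigned a distinct point,
and each edge a continuous arc (an injective continuous curve) joining its endpoints. -/
structure Drawing {V : Type} (G : SimpleGraph V) where
  pos : V → ℝ × ℝ
  pos_inj : Function.Injective pos
  arc : ∀ ⦃u v : V⦄, G.Adj u v → Set (ℝ × ℝ)
  arc_symm : ∀ ⦃u v : V⦄ (h : G.Adj u v), arc h.symm = arc h
  arc_isArc : ∀ ⦃u v : V⦄ (h : G.Adj u v), ∃ γ : ℝ → ℝ × ℝ,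
    ContinuousOn γ (Set.Icc 0 1) ∧ Set.InjOn γ (Set.Icc 0 1) ∧
    γ 0 = pos u ∧ γ 1 = pos v ∧ arc h = γ '' Set.Icc (0 : ℝ) 1

namespace Drawing

variable {V : Type} {G : SimpleGraph V} (D : Drawing G)

/-- The interior of the arc of an edge (the arc minus its endpoints). -/
def arcInt ⦃u v : V⦄ (h : G.Adj u v) : Set (ℝ × ℝ) :=
  D.arc h \ {D.pos u, D.pos v}

/-- The interior of the drawing of an abstract edge `e : Sym2 V`. -/
def edgeInt (e : Sym2 V) : Set (ℝ × ℝ) :=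
  {p | ∃ (u v : V) (h : G.Adj u v), e = s(u, v) ∧ p ∈ D.arcInt h}

/-- Two edges cross if they are distinct and their interiors meet. -/
def Cross (e f : Sym2 V) : Prop :=
  e ≠ f ∧ (D.edgeInt e ∩ D.edgeInt f).Nonempty

/-- The set of crossing points of the drawing. -/
def crossingSet : Set (ℝ × ℝ) :=
  {p | ∃ e f : Sym2 V, e ≠ f ∧ p ∈ D.edgeInt e ∧ p ∈ D.edgeInt f}

/-- A good drawing: no vertex lies on the arc of a non-incident edge, any two distinct
edges meet in at most one interior point, and edges sharing an endpoint do not cross. -/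
def IsGood : Prop :=
  (∀ (w : V) ⦃u v : V⦄ (h : G.Adj u v), D.pos w ∈ D.arc h → w = u ∨ w = v) ∧
  (∀ e f : Sym2 V, e ≠ f → (D.edgeInt e ∩ D.edgeInt f).Subsingleton) ∧
  (∀ ⦃u v w : V⦄ (h₁ : G.Adj u v) (h₂ : G.Adj u w), v ≠ w →
    D.arcInt h₁ ∩ D.arcInt h₂ = ∅)

/-- A drawing is 1-planar if every edge is crossed at most once. -/
def IsOnePlanar : Prop :=
  ∀ e : Sym2 V, {f : Sym2 V | D.Cross e f}.Subsingleton

/-- The number of crossings of the drawing (each unordered pair of crossing edges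
contributes one crossing). -/
noncomputable def crNum : ℕ :=
  Set.ncard {p : Sym2 V × Sym2 V | D.Cross p.1 p.2} / 2

/-- The subset of the plane covered by the drawing. -/
def drawingSet : Set (ℝ × ℝ) :=
  Set.range D.pos ∪ ⋃ (u : V) (v : V) (h : G.Adj u v), D.arc h

/-- A face of the drawing: a connected component of the complement of the drawing. -/
def IsFace (F : Set (ℝ × ℝ)) : Prop :=
  ∃ p ∉ D.drawingSet, F = connectedComponentIn D.drawingSetᶜ p

/-- The set `∂(F)` of vertices on the boundary of a face `F`. -/
def faceVerts (F : Set (ℝ × ℝ)) : Set V :=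
  {v | D.pos v ∈ frontier F}

/-- A true face of the planarization `G^×`: a face of the drawing whose boundary
contains no crossing point (i.e. it is incident with no fake vertex). -/
def IsTrueFace (F : Set (ℝ × ℝ)) : Prop :=
  D.IsFace F ∧ ∀ p ∈ D.crossingSet, p ∉ frontier F

/-- Two faces are adjacent if their boundaries share a common edge of the planarization,
i.e. they share a boundary point that is neither a vertex nor a crossing point. -/
def FaceAdj (F₁ F₂ : Set (ℝ × ℝ)) : Prop :=
  F₁ ≠ F₂ ∧ ∃ p, p ∈ frontier F₁ ∧ p ∈ frontier F₂ ∧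
    p ∉ Set.range D.pos ∧ p ∉ D.crossingSet

/-- The planarization `G^×` (crossings made into vertices of degree `4`) is a
triangulation: every face of the drawing has exactly three vertices of `G^×`
(true vertices or crossing points) on its boundary. -/
def PlanarizationIsTriangulation : Prop :=
  ∀ F : Set (ℝ × ℝ), D.IsFace F →
    ((Set.range D.pos ∪ D.crossingSet) ∩ frontier F).ncard = 3

/-- A maximal 1-plane graph: the drawing is good and 1-planar, and no edge between two
distinct non-adjacent vertices can be added to the drawing so that the result is still
a good 1-planar drawing. -/
def IsMaximalOnePlane : Prop :=
  D.IsGood ∧ D.IsOnePlanar ∧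
  ∀ u v : V, u ≠ v → ¬G.Adj u v →
    ∀ D' : Drawing (G ⊔ SimpleGraph.fromEdgeSet {s(u, v)}),
      D'.pos = D.pos →
      (∀ ⦃x y : V⦄ (h : G.Adj x y),
        D'.arc ((SimpleGraph.sup_adj _ _ _ _).mpr (Or.inl h)) = D.arc h) →
      ¬(D'.IsGood ∧ D'.IsOnePlanar)

/-- A maximal 1-plane graph is immovable if its number of crossings does not exceed that
of any good 1-planar drawing obtained from it by redrawing exactly one edge. -/
def Immovable : Prop :=
  ∀ D' : Drawing G, D'.IsGood → D'.IsOnePlanar → D'.pos = D.pos →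
    (∃ (u v : V) (_ : G.Adj u v), ∀ ⦃x y : V⦄ (h' : G.Adj x y),
      s(x, y) ≠ s(u, v) → D'.arc h' = D.arc h') →
    D.crNum ≤ D'.crNum

/-- The drawing induced on a subgraph. -/
def restrict {H : SimpleGraph V} (hle : H ≤ G) : Drawing H where
  pos := D.pos
  pos_inj := D.pos_inj
  arc := fun _ _ h => D.arc (hle h)
  arc_symm := fun _ _ h => D.arc_symm (hle h)
  arc_isArc := fun _ _ h => D.arc_isArc (hle h)

/-- `H` is a planar skeleton `G_P` of the 1-plane graph `(G, D)`: it is obtained from `G`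
by removing exactly one edge from each pair of crossing edges. -/
def IsPlanarSkeleton {H : SimpleGraph V} (_ : H ≤ G) : Prop :=
  (∀ e f : Sym2 V, D.Cross e f → (e ∈ H.edgeSet ↔ f ∉ H.edgeSet)) ∧
  ∀ e ∈ G.edgeSet, (¬∃ f, D.Cross e f) → e ∈ H.edgeSet

/-- `c_G(v)`: the number of crossing edges of the drawing incident with `v`. -/
noncomputable def cDeg (v : V) : ℕ :=
  Set.ncard {w : V | G.Adj v w ∧ ∃ f, D.Cross s(v, w) f}

end Drawing

/-- The crossing number of a graph: the least number of crossings in a good drawing. -/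
noncomputable def crossingNumber {V : Type} (G : SimpleGraph V) : ℕ :=
  sInf {n | ∃ D : Drawing G, D.IsGood ∧ D.crNum = n}

/-- A graph is `k`-connected if it stays connected after deleting any set of fewer than
`k` vertices. -/
def KConnected {V : Type} (G : SimpleGraph V) (k : ℕ) : Prop :=
  ∀ S : Set V, S.ncard < k → (G.induce Sᶜ).Connected

/-- A graph is 1-planar if it admits a good 1-planar drawing. -/
def Is1Planar {V : Type} (G : SimpleGraph V) : Prop :=
  ∃ D : Drawing G, D.IsGood ∧ D.IsOnePlanar

/-- A maximal 1-planar graph: 1-planar, and adding any edge between distinct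
non-adjacent vertices destroys 1-planarity. -/
def IsMaximal1Planar {V : Type} (G : SimpleGraph V) : Prop :=
  Is1Planar G ∧ ∀ u v : V, u ≠ v → ¬G.Adj u v →
    ¬Is1Planar (G ⊔ SimpleGraph.fromEdgeSet {s(u, v)})

namespace OP

/-- `f` has a continuous logarithm on `K`. -/
def HasLog (K : Set ℂ) (f : ℂ → ℂ) : Prop :=
  ∃ g : ℂ → ℂ, ContinuousOn g K ∧ ∀ z ∈ K, f z = Complex.exp (g z)

lemma HasLog.mono {K L : Set ℂ} {f : ℂ → ℂ} (h : HasLog K f) (hLK : L ⊆ K) : HasLog L f := by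
  obtain ⟨g, hg, hfg⟩ := h
  exact ⟨g, hg.mono hLK, fun z hz => hfg z (hLK hz)⟩

lemma HasLog.congr {K : Set ℂ} {f f' : ℂ → ℂ} (h : HasLog K f) (hff : ∀ z ∈ K, f' z = f z) :
    HasLog K f' := by
  obtain ⟨g, hg, hfg⟩ := h
  exact ⟨g, hg, fun z hz => (hff z hz).trans (hfg z hz)⟩

lemma HasLog.mul {K : Set ℂ} {f f' : ℂ → ℂ} (h : HasLog K f) (h' : HasLog K f') :
    HasLog K (fun z => f z * f' z) := by
  obtain ⟨g, hg, hfg⟩ := h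
  obtain ⟨g', hg', hfg'⟩ := h'
  refine ⟨fun z => g z + g' z, hg.add hg', fun z hz => ?_⟩
  simp only [Complex.exp_add, hfg z hz, hfg' z hz]

lemma HasLog.inv {K : Set ℂ} {f : ℂ → ℂ} (h : HasLog K f) :
    HasLog K (fun z => (f z)⁻¹) := by
  obtain ⟨g, hg, hfg⟩ := h
  refine ⟨fun z => - g z, hg.neg, fun z hz => ?_⟩
  simp only [Complex.exp_neg, hfg z hz]

/-- Two continuous functions with the same exponential on a preconnected set differ by a constant
in `2πiℤ`. -/
lemma exp_eq_const {α : Type*} [TopologicalSpace α] {S : Set α} (hS : IsPreconnected S)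
    {g h : α → ℂ} (hg : ContinuousOn g S)
    (hh : ContinuousOn h S) (he : ∀ z ∈ S, Complex.exp (g z) = Complex.exp (h z)) :
    ∃ n : ℤ, ∀ z ∈ S, g z = h z + n * (2 * Real.pi * Complex.I) := by
  rcases S.eq_empty_or_nonempty with rfl | ⟨x, hx⟩
  · exact ⟨0, by simp⟩
  have key : ∀ z ∈ S, ∃ n : ℤ, g z = h z + n * (2 * Real.pi * Complex.I) := fun z hz =>
    Complex.exp_eq_exp_iff_exists_int.1 (he z hz)
  obtain ⟨n, hn⟩ := key x hx
  refine ⟨n, fun z hz => ?_⟩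
  obtain ⟨m, hm⟩ := key z hz
  -- the function `(g - h)/(2πi)` has real part continuous and integer
  let φ : α → ℝ := fun z => ((g z - h z) / (2 * Real.pi * Complex.I)).re
  have hpi : (2 * (Real.pi : ℂ) * Complex.I) ≠ 0 := Complex.two_pi_I_ne_zero
  have hφ : ContinuousOn φ S :=
    Complex.continuous_re.comp_continuousOn ((hg.sub hh).div_const _)
  have hφv : ∀ z ∈ S, ∀ k : ℤ, g z = h z + k * (2 * Real.pi * Complex.I) → φ z = k := by
    intro z hz k hk
    have : (g z - h z) / (2 * Real.pi * Complex.I) = (k : ℂ) := by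
      rw [hk]; field_simp; ring
    simp only [φ, this]; simp
  have hmaps : MapsTo φ S (range ((↑) : ℤ → ℝ)) := by
    intro z hz
    obtain ⟨k, hk⟩ := key z hz
    exact ⟨k, (hφv z hz k hk).symm⟩
  have hd : IsDiscrete (range ((↑) : ℤ → ℝ)) := by
    have := Int.isClosedEmbedding_coe_real.isEmbedding.toHomeomorph.symm.isEmbedding.discreteTopology
    exact ⟨this⟩
  have := hS.constant_of_mapsTo hd hφ hmaps hx hz
  rw [hφv x hx n hn, hφv z hz m hm] at this
  have : n = m := by exact_mod_cast this
  rw [this]; exact hm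

lemma exists_log_of_simply {A : Type*} [TopologicalSpace A] [SimplyConnectedSpace A]
    [LocallyPathConnectedSpace A] (f : A → ℂ) (hf : Continuous f) (h0 : ∀ a, f a ≠ 0) :
    ∃ g : A → ℂ, Continuous g ∧ ∀ a, f a = Complex.exp (g a) := by
  obtain ⟨a₀⟩ : Nonempty A := inferInstance
  obtain ⟨F, ⟨-, hF⟩, -⟩ := Complex.isCoveringMapOn_exp.existsUnique_continuousMap_lifts
    (⟨f, hf⟩ : C(A, ℂ)) (a₀ := a₀) (e₀ := Complex.log (f a₀)) (Complex.exp_log (h0 a₀))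
    (fun a => by simpa using h0 a)
  exact ⟨F, F.continuous, fun a => (congrFun hF a).symm⟩

lemma exists_log_complex (f : ℂ → ℂ) (hf : Continuous f) (h0 : ∀ a, f a ≠ 0) :
    ∃ g : ℂ → ℂ, Continuous g ∧ ∀ a, f a = Complex.exp (g a) :=
  exists_log_of_simply f hf h0

lemma exists_log_real (f : ℝ → ℂ) (hf : Continuous f) (h0 : ∀ a, f a ≠ 0) :
    ∃ g : ℝ → ℂ, Continuous g ∧ ∀ a, f a = Complex.exp (g a) :=
  exists_log_of_simply f hf h0

/-- `(z-p)^n` has no logarithm on a circle around `p` unless `n = 0`. -/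
lemma no_log_circle {p : ℂ} {r : ℝ} (hr : 0 < r) {n : ℤ}
    (h : HasLog (Metric.sphere p r) (fun z => (z - p) ^ n)) : n = 0 := by
  obtain ⟨g, hg, hfg⟩ := h
  let c : ℝ → ℂ := fun t => p + r * Complex.exp (t * Complex.I)
  have hc : Continuous c := by fun_prop
  have hcm : ∀ t, c t ∈ Metric.sphere p r := by
    intro t
    simp [c, Complex.norm_exp_ofReal_mul_I, abs_of_pos hr]
  have h1 : ContinuousOn (fun t : ℝ => g (c t)) univ :=
    hg.comp hc.continuousOn (fun t _ => hcm t)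
  have h2 : ContinuousOn (fun t : ℝ => (n : ℂ) * ((Real.log r : ℂ) + t * Complex.I)) univ := by
    fun_prop
  obtain ⟨k, hk⟩ := exp_eq_const isPreconnected_univ h1 h2 (by
    intro t _
    rw [← hfg _ (hcm t)]
    have : Complex.exp ((Real.log r : ℂ) + t * Complex.I) = r * Complex.exp (t * Complex.I) := by
      rw [Complex.exp_add, ← Complex.ofReal_exp, Real.exp_log hr]
    simp only [c, add_sub_cancel_left]
    rw [Complex.exp_int_mul, this])
  have e0 := hk 0 trivial
  have e1 := hk (2 * Real.pi) trivial
  have hcc : c (2 * Real.pi) = c 0 := by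
    simp [c, Complex.exp_two_pi_mul_I]
  rw [hcc, e0] at e1
  simp only [Complex.ofReal_zero, zero_mul, add_zero, add_left_inj, Complex.ofReal_mul,
    Complex.ofReal_ofNat] at e1
  have hpi : (2 * (Real.pi : ℂ) * Complex.I) ≠ 0 := Complex.two_pi_I_ne_zero
  have : (n : ℂ) * (2 * (Real.pi : ℂ) * Complex.I) = 0 := by linear_combination -e1
  rcases mul_eq_zero.1 this with h | h
  · exact_mod_cast h
  · exact absurd h hpi

/-- Gluing logarithms. -/
lemma HasLog.glue {K L : Set ℂ} {f : ℂ → ℂ} (hK : IsClosed K) (hL : IsClosed L)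
    (hKL : IsPreconnected (K ∩ L)) (h1 : HasLog K f) (h2 : HasLog L f) : HasLog (K ∪ L) f := by
  obtain ⟨g, hg, hfg⟩ := h1
  obtain ⟨h, hh, hfh⟩ := h2
  obtain ⟨n, hn⟩ := exp_eq_const hKL (hg.mono inter_subset_left) (hh.mono inter_subset_right)
    (fun z hz => by rw [← hfg z hz.1, ← hfh z hz.2])
  classical
  let h' : ℂ → ℂ := fun z => h z + n * (2 * Real.pi * Complex.I)
  have hh' : ContinuousOn h' L := hh.add continuousOn_const
  refine ⟨fun z => if z ∈ K then g z else h' z, ?_, ?_⟩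
  · have e1 : ContinuousOn (fun z => if z ∈ K then g z else h' z) K :=
      hg.congr (fun z hz => by simp [hz])
    have e2 : ContinuousOn (fun z => if z ∈ K then g z else h' z) L :=
      hh'.congr (fun z hz => by
        by_cases hzK : z ∈ K
        · simp only [hzK, if_true]; exact hn z ⟨hzK, hz⟩
        · simp [hzK])
    exact e1.union_of_isClosed e2 hK hL
  · rintro z hz
    by_cases hzK : z ∈ K
    · simp only [hzK, if_true]; exact hfg z hzK
    · simp only [hzK, if_false]
      have hzL : z ∈ L := hz.resolve_left hzK
      have := Complex.exp_int_mul_two_pi_mul_I n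
      simp only [h', Complex.exp_add, this, mul_one]
      exact hfh z hzL

/-- Gluing two logarithms that agree on the intersection. -/
lemma HasLog.glue_eq {K L : Set ℂ} {f g h : ℂ → ℂ} (hK : IsClosed K) (hL : IsClosed L)
    (hg : ContinuousOn g K) (hfg : ∀ z ∈ K, f z = Complex.exp (g z))
    (hh : ContinuousOn h L) (hfh : ∀ z ∈ L, f z = Complex.exp (h z))
    (heq : ∀ z ∈ K ∩ L, g z = h z) : HasLog (K ∪ L) f := by
  classical
  refine ⟨fun z => if z ∈ K then g z else h z, ?_, ?_⟩
  · have e1 : ContinuousOn (fun z => if z ∈ K then g z else h z) K :=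
      hg.congr (fun z hz => by simp [hz])
    have e2 : ContinuousOn (fun z => if z ∈ K then g z else h z) L :=
      hh.congr (fun z hz => by
        by_cases hzK : z ∈ K
        · simp only [hzK, if_true]; exact heq z ⟨hzK, hz⟩
        · simp [hzK])
    exact e1.union_of_isClosed e2 hK hL
  · rintro z hz
    by_cases hzK : z ∈ K
    · simp only [hzK, if_true]; exact hfg z hzK
    · simp only [hzK, if_false]
      exact hfh z (hz.resolve_left hzK)

lemma hasLog_of_slit {K : Set ℂ} {f : ℂ → ℂ} (hf : ContinuousOn f K)
    (hs : ∀ z ∈ K, f z ∈ Complex.slitPlane) : HasLog K f :=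
  ⟨fun z => Complex.log (f z), fun z hz => (hf z hz).clog (hs z hz), fun z hz =>
    (Complex.exp_log (Complex.slitPlane_ne_zero (hs z hz))).symm⟩

lemma hasLog_near {K : Set ℂ} {p q : ℂ} {r : ℝ} (hK : ∀ z ∈ K, r ≤ ‖z - p‖)
    (hr : ‖p - q‖ < r) : HasLog K (fun z => (z - q) / (z - p)) := by
  have hr0 : 0 < r := lt_of_le_of_lt (norm_nonneg _) hr
  have hne : ∀ z ∈ K, z - p ≠ 0 := fun z hz => by
    have := hK z hz
    intro h0; rw [h0, norm_zero] at this; linarith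
  refine hasLog_of_slit ?_ ?_
  · exact ContinuousOn.div (by fun_prop) (by fun_prop) hne
  · intro z hz
    have : (z - q) / (z - p) = 1 + (p - q) / (z - p) := by
      field_simp [hne z hz]; ring
    rw [this]
    apply Complex.mem_slitPlane_of_norm_lt_one
    rw [norm_div, div_lt_one (by linarith [hK z hz])]
    linarith [hK z hz]

/-- If `p, q` lie in a preconnected set missing the compact `K` then `(z-p)/(z-q)` has a logarithm
on `K`. -/
lemma hasLog_of_joined {K C : Set ℂ} (hK : IsCompact K) (hC : IsPreconnected C)
    (hd : Disjoint C K) {p q : ℂ} (hp : p ∈ C) (hq : q ∈ C) :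
    HasLog K (fun z => (z - p) / (z - q)) := by
  rcases K.eq_empty_or_nonempty with rfl | hne
  · exact ⟨0, continuousOn_empty _, by simp⟩
  have hpos : ∀ x ∈ C, 0 < Metric.infDist x K := fun x hx =>
    (hK.isClosed.notMem_iff_infDist_pos hne).1 (fun h => hd.le_bot ⟨hx, h⟩)
  have hnorm : ∀ x, ∀ z ∈ K, Metric.infDist x K ≤ ‖z - x‖ := fun x z hz => by
    rw [← dist_eq_norm, dist_comm]; exact Metric.infDist_le_dist_of_mem hz
  have hne' : ∀ x ∈ C, ∀ z ∈ K, z - x ≠ 0 := fun x hx z hz h0 => by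
    have := hnorm x z hz
    rw [h0, norm_zero] at this; linarith [hpos x hx]
  -- the relation is locally constant
  have htrans : ∀ x y w, y ∈ C → HasLog K (fun z => (z - x) / (z - y)) →
      HasLog K (fun z => (z - y) / (z - w)) → HasLog K (fun z => (z - x) / (z - w)) := by
    intro x y w hy h1 h2
    refine (h1.mul h2).congr (fun z hz => ?_)
    rw [div_mul_div_cancel₀ (hne' y hy z hz)]
  have hsymm : ∀ x y, HasLog K (fun z => (z - x) / (z - y)) →
      HasLog K (fun z => (z - y) / (z - x)) := by
    intro x y h1
    refine h1.inv.congr (fun z hz => ?_)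
    rw [inv_div]
  refine hC.induction₂ (fun x y => HasLog K (fun z => (z - x) / (z - y))) ?_ ?_ ?_ hp hq
  · intro x hx
    have : Metric.ball x (Metric.infDist x K) ∈ nhdsWithin x C :=
      mem_nhdsWithin_of_mem_nhds (Metric.ball_mem_nhds x (hpos x hx))
    filter_upwards [this] with y hy
    have h1 : HasLog K (fun z => (z - y) / (z - x)) :=
      hasLog_near (hnorm x) (by rw [← dist_eq_norm, dist_comm]; exact hy)
    exact hsymm _ _ h1
  · intro x y w hx hy hw h1 h2
    exact htrans x y w hy h1 h2
  · intro x y hx hy h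
    exact hsymm _ _ h

end OP

namespace OP

/-- `F` is a face of `K`: a connected component of the complement of `K`. -/
def Face (K F : Set ℂ) : Prop := ∃ p, p ∉ K ∧ F = connectedComponentIn Kᶜ p

lemma face_of_notMem {K : Set ℂ} {p : ℂ} (hp : p ∉ K) : ∃ F, Face K F ∧ p ∈ F :=
  ⟨_, ⟨p, hp, rfl⟩, mem_connectedComponentIn hp⟩

lemma Face.preconn {K F : Set ℂ} (h : Face K F) : IsPreconnected F := by
  obtain ⟨p, hp, rfl⟩ := h
  exact isPreconnected_connectedComponentIn

lemma Face.nonempty {K F : Set ℂ} (h : Face K F) : F.Nonempty := by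
  obtain ⟨p, hp, rfl⟩ := h
  exact ⟨p, mem_connectedComponentIn hp⟩

lemma Face.subset_compl {K F : Set ℂ} (h : Face K F) : F ⊆ Kᶜ := by
  obtain ⟨p, hp, rfl⟩ := h
  exact connectedComponentIn_subset _ _

lemma Face.disj {K F : Set ℂ} (h : Face K F) : Disjoint F K :=
  disjoint_left.2 h.subset_compl

lemma Face.isOpen {K F : Set ℂ} (h : Face K F) (hK : IsClosed K) : IsOpen F := by
  obtain ⟨p, hp, rfl⟩ := h
  exact hK.isOpen_compl.connectedComponentIn

lemma Face.subset_of {K F S : Set ℂ} (h : Face K F) (hS : IsPreconnected S) (hd : Disjoint S K)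
    (hne : (S ∩ F).Nonempty) : S ⊆ F := by
  obtain ⟨p, hp, rfl⟩ := h
  obtain ⟨x, hx, hxF⟩ := hne
  rw [connectedComponentIn_eq hxF]
  exact hS.subset_connectedComponentIn hx (disjoint_left.1 hd)

lemma Face.eq_of {K F F' : Set ℂ} (h : Face K F) (h' : Face K F') (hne : (F ∩ F').Nonempty) :
    F = F' :=
  Subset.antisymm (h'.subset_of h.preconn h.disj hne)
    (h.subset_of h'.preconn h'.disj (by rwa [inter_comm]))

lemma Face.eq_of_mem {K F F' : Set ℂ} (h : Face K F) (h' : Face K F') {x : ℂ} (hx : x ∈ F)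
    (hx' : x ∈ F') : F = F' := h.eq_of h' ⟨x, hx, hx'⟩

lemma Face.closure_subset {K F : Set ℂ} (h : Face K F) (hK : IsClosed K) : closure F ⊆ F ∪ K := by
  intro z hz
  by_cases hzK : z ∈ K
  · exact Or.inr hzK
  · obtain ⟨F', h', hzF'⟩ := face_of_notMem hzK
    obtain ⟨w, hw, hw'⟩ := mem_closure_iff.1 hz F' (h'.isOpen hK) hzF'
    rw [h.eq_of h' ⟨w, hw', hw⟩]
    exact Or.inl hzF'

lemma Face.frontier_subset {K F : Set ℂ} (h : Face K F) (hK : IsClosed K) : frontier F ⊆ K := by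
  intro z hz
  rw [frontier, (h.isOpen hK).interior_eq] at hz
  exact (h.closure_subset hK hz.1).resolve_left hz.2

/-- A nonempty open preconnected set disjoint from `K` whose closure adds only points of `K` is a
face. -/
lemma face_of {K F : Set ℂ} (ho : IsOpen F) (hc : IsPreconnected F) (hne : F.Nonempty)
    (hd : Disjoint F K) (hcl : closure F ⊆ F ∪ K) : Face K F := by
  obtain ⟨p, hp⟩ := hne
  have hpK : p ∉ K := disjoint_left.1 hd hp
  refine ⟨p, hpK, Subset.antisymm (hc.subset_connectedComponentIn hp (disjoint_left.1 hd)) ?_⟩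
  have h1 : IsPreconnected (connectedComponentIn Kᶜ p) := isPreconnected_connectedComponentIn
  by_contra hcon
  obtain ⟨q, hq, hqF⟩ := not_subset.1 hcon
  have hqK : q ∉ K := connectedComponentIn_subset _ _ hq
  have hqcl : q ∉ closure F := fun h => (hcl h).elim hqF hqK
  obtain ⟨z, hz, hz1, hz2⟩ := h1 F (closure F)ᶜ ho isClosed_closure.isOpen_compl (by
    intro z hz
    by_cases hzF : z ∈ closure F
    · exact Or.inl ((hcl hzF).resolve_right (connectedComponentIn_subset _ _ hz))
    · exact Or.inr hzF) ⟨p, mem_connectedComponentIn hpK, hp⟩ ⟨q, hq, hqcl⟩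
  exact hz2 (subset_closure hz1)

lemma Face.subset_of_subset {K L F G : Set ℂ} (hKL : K ⊆ L) (hF : Face L F) (hG : Face K G)
    (hne : (F ∩ G).Nonempty) : F ⊆ G :=
  hG.subset_of hF.preconn (hF.disj.mono_right hKL) hne

/-- The index argument. -/
lemma ind_zero {K U : Set ℂ} (hK : IsCompact K) (hU : IsOpen U) (hUb : Bornology.IsBounded U)
    (hfr : frontier U ⊆ K) {p : ℂ} (hp : p ∈ U) {φ : ℂ → ℂ}
    (hφ : ContinuousOn φ (closure U)) (hφ0 : ∀ z ∈ closure U, φ z ≠ 0) {n : ℤ}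
    (h : HasLog K (fun z => (z - p) ^ n * φ z)) : n = 0 := by
  classical
  obtain ⟨g, hg, hfg⟩ := h
  obtain ⟨G, hG⟩ := ContinuousMap.exists_restrict_eq hK.isClosed ⟨K.domRestrict g, hg.domRestrict⟩
  have hGg : ∀ z ∈ K, G z = g z := fun z hz => by
    have := congrArg (fun f : C(K, ℂ) => f ⟨z, hz⟩) hG
    exact this
  let H : ℂ → ℂ := fun z => if z ∈ closure U then Complex.exp (G z) / φ z else (z - p) ^ n
  have hzp : ∀ z ∈ Uᶜ, z - p ≠ 0 := fun z hz h0 => hz (by rwa [sub_eq_zero.1 h0])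
  have hout : ∀ z ∈ Uᶜ, H z = (z - p) ^ n := by
    intro z hz
    by_cases hzc : z ∈ closure U
    · have hzK : z ∈ K := hfr (by rw [frontier, hU.interior_eq]; exact ⟨hzc, hz⟩)
      simp only [H, hzc, if_true]
      rw [hGg z hzK, ← hfg z hzK, mul_div_assoc, div_self (hφ0 z hzc), mul_one]
    · simp only [H, hzc, if_false]
  have hcont : Continuous H := by
    rw [← continuousOn_univ]
    have e1 : ContinuousOn H (closure U) := by
      have : ContinuousOn (fun z => Complex.exp (G z) / φ z) (closure U) :=
        ContinuousOn.div (Complex.continuous_exp.comp G.continuous).continuousOn hφ hφ0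
      exact this.congr (fun z hz => by simp only [H, hz, if_true])
    have e2 : ContinuousOn H Uᶜ := by
      have : ContinuousOn (fun z : ℂ => (z - p) ^ n) Uᶜ :=
        ContinuousOn.zpow₀ (by fun_prop) n (fun z hz => Or.inl (hzp z hz))
      exact this.congr hout
    have := e1.union_of_isClosed e2 isClosed_closure hU.isClosed_compl
    rwa [show closure U ∪ Uᶜ = univ from by
      rw [eq_univ_iff_forall]; intro z
      by_cases hz : z ∈ U
      · exact Or.inl (subset_closure hz)
      · exact Or.inr hz] at this
  have h0 : ∀ z, H z ≠ 0 := by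
    intro z
    by_cases hz : z ∈ U
    · have hz' := subset_closure hz
      simp only [H, hz', if_true]
      exact div_ne_zero (Complex.exp_ne_zero _) (hφ0 z hz')
    · rw [hout z hz]; exact zpow_ne_zero _ (hzp z hz)
  obtain ⟨l, hl, hHl⟩ := exists_log_complex H hcont h0
  obtain ⟨r, hr0, hr⟩ := hUb.subset_ball_lt 0 p
  refine no_log_circle hr0 (p := p) ⟨l, hl.continuousOn, fun z hz => ?_⟩
  have hzU : z ∈ Uᶜ := fun hzU => by
    have := hr hzU
    rw [Metric.mem_ball] at this
    rw [Metric.mem_sphere] at hz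
    linarith
  rw [← hHl, hout z hzU]

lemma preconn_ext {R : ℝ} (hR : 0 < R) : IsPreconnected {z : ℂ | R < ‖z‖} := by
  have : {z : ℂ | R < ‖z‖} = Complex.exp '' {w : ℂ | Real.log R < w.re} := by
    ext z
    simp only [mem_ofPred_eq, mem_image]
    constructor
    · intro hz
      have hz0 : z ≠ 0 := by rintro rfl; rw [norm_zero] at hz; linarith
      refine ⟨Complex.log z, ?_, Complex.exp_log hz0⟩
      rw [Complex.log_re]
      exact Real.log_lt_log hR hz
    · rintro ⟨w, hw, rfl⟩
      rw [Complex.norm_exp]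
      rwa [← Real.log_lt_iff_lt_exp hR]
  rw [this]
  refine IsPreconnected.image ?_ _ Complex.continuous_exp.continuousOn
  exact (convex_halfSpace_re_gt _).isPreconnected

/-- Of two distinct faces of a compact set, one is bounded. -/
lemma bounded_or {K F F' : Set ℂ} (hK : IsCompact K) (hF : Face K F) (hF' : Face K F')
    (hne : F ≠ F') : Bornology.IsBounded F ∨ Bornology.IsBounded F' := by
  obtain ⟨R, hR0, hR⟩ := hK.isBounded.subset_ball_lt 0 0
  have key : ∀ F, Face K F → ¬ Bornology.IsBounded F → {z : ℂ | R < ‖z‖} ⊆ F := by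
    intro F hF hb
    refine hF.subset_of (preconn_ext hR0) ?_ ?_
    · rw [disjoint_left]
      intro z hz hzK
      have := hR hzK
      rw [mem_ball_zero_iff] at this
      exact absurd this (not_lt.2 (le_of_lt hz))
    · by_contra hcon
      apply hb
      refine (Metric.isBounded_closedBall (x := (0:ℂ)) (r := R)).subset ?_
      intro z hz
      rw [mem_closedBall_zero_iff]
      by_contra h
      exact hcon ⟨z, not_le.1 h, hz⟩
  by_contra hcon
  push Not at hcon
  have hz : ((R + 1 : ℝ) : ℂ) ∈ {z : ℂ | R < ‖z‖} := by
    simp only [mem_ofPred_eq, Complex.norm_real, Real.norm_eq_abs]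
    rw [abs_of_pos (by linarith)]; linarith
  exact hne (hF.eq_of hF' ⟨_, key F hF hcon.1 hz, key F' hF' hcon.2 hz⟩)

lemma face_ind_zero {K U : Set ℂ} (hK : IsCompact K) (hU : Face K U)
    (hUb : Bornology.IsBounded U) {p : ℂ} (hp : p ∈ U) {φ : ℂ → ℂ}
    (hφ : ContinuousOn φ (closure U)) (hφ0 : ∀ z ∈ closure U, φ z ≠ 0) {n : ℤ}
    (h : HasLog K (fun z => (z - p) ^ n * φ z)) : n = 0 :=
  ind_zero hK (hU.isOpen hK.isClosed) hUb (hU.frontier_subset hK.isClosed) hp hφ hφ0 h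

lemma Face.sub_ne_zero {K F F' : Set ℂ} (hK : IsClosed K) (hF : Face K F) (hF' : Face K F')
    (hne : F ≠ F') {q : ℂ} (hq : q ∈ F') : ∀ z ∈ closure F, z - q ≠ 0 := by
  intro z hz h0
  rw [sub_eq_zero.1 h0] at hz
  rcases hF.closure_subset hK hz with h | h
  · exact hne (hF.eq_of_mem hF' h hq)
  · exact disjoint_left.1 hF'.disj hq h

/-- Three points in three different faces. -/
lemma three_faces {K F₁ F₂ F₃ : Set ℂ} (hK : IsCompact K) (h1 : Face K F₁) (h2 : Face K F₂)
    (h3 : Face K F₃) (h12 : F₁ ≠ F₂) (h13 : F₁ ≠ F₃) (h23 : F₂ ≠ F₃) {p q r : ℂ} (hp : p ∈ F₁)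
    (hq : q ∈ F₂) (hr : r ∈ F₃) {i j k : ℤ} (hs : i + j + k = 0)
    (h : HasLog K (fun z => (z - p) ^ i * (z - q) ^ j * (z - r) ^ k)) : i = 0 ∧ j = 0 ∧ k = 0 := by
  have key : ∀ {F₁ F₂ F₃ : Set ℂ} (_ : Face K F₁) (_ : Face K F₂)
    (_ : Face K F₃) (_ : F₁ ≠ F₂) (_ : F₁ ≠ F₃) {p q r : ℂ} (_ : p ∈ F₁)
    (_ : q ∈ F₂) (_ : r ∈ F₃) {i j k : ℤ}
    (_ : HasLog K (fun z => (z - p) ^ i * ((z - q) ^ j * (z - r) ^ k))),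
    Bornology.IsBounded F₁ → i = 0 := by
    intro F₁ F₂ F₃ h1 h2 h3 h12 h13 p q r hp hq hr i j k h hb
    have hq0 := Face.sub_ne_zero hK.isClosed h1 h2 h12 hq
    have hr0 := Face.sub_ne_zero hK.isClosed h1 h3 h13 hr
    refine face_ind_zero hK h1 hb hp (φ := fun z => (z - q) ^ j * (z - r) ^ k) ?_ ?_ h
    · exact (ContinuousOn.zpow₀ (by fun_prop) j (fun z hz => Or.inl (hq0 z hz))).mul
        (ContinuousOn.zpow₀ (by fun_prop) k (fun z hz => Or.inl (hr0 z hz)))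
    · intro z hz
      exact mul_ne_zero (zpow_ne_zero _ (hq0 z hz)) (zpow_ne_zero _ (hr0 z hz))
  have b1 := key h1 h2 h3 h12 h13 hp hq hr (h.congr (fun z _ => by ring))
  have b2 := key h2 h1 h3 h12.symm h23 hq hp hr (i := j) (j := i) (k := k)
    (h.congr (fun z _ => by ring))
  have b3 := key h3 h1 h2 h13.symm h23.symm hr hp hq (i := k) (j := i) (k := j)
    (h.congr (fun z _ => by ring))
  rcases bounded_or hK h1 h2 h12 with hb | hb
  · have := b1 hb
    rcases bounded_or hK h2 h3 h23 with hb' | hb'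
    · have := b2 hb'; omega
    · have := b3 hb'; omega
  · have := b2 hb
    rcases bounded_or hK h1 h3 h13 with hb' | hb'
    · have := b1 hb'; omega
    · have := b3 hb'; omega

/-- Eilenberg's criterion. -/
lemma eilenberg {K F₁ F₂ : Set ℂ} (hK : IsCompact K) (h1 : Face K F₁) (h2 : Face K F₂)
    {p q : ℂ} (hp : p ∈ F₁) (hq : q ∈ F₂) (h : HasLog K (fun z => (z - p) / (z - q))) :
    F₁ = F₂ := by
  by_contra hne
  rcases bounded_or hK h1 h2 hne with hb | hb
  · have hq0 := Face.sub_ne_zero hK.isClosed h1 h2 hne hq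
    have := face_ind_zero hK h1 hb hp (φ := fun z => (z - q)⁻¹) (n := 1)
      (ContinuousOn.inv₀ (by fun_prop) hq0) (fun z hz => inv_ne_zero (hq0 z hz))
      (h.congr (fun z _ => by rw [zpow_one, div_eq_mul_inv]))
    omega
  · have hq0 := Face.sub_ne_zero hK.isClosed h2 h1 (Ne.symm hne) hp
    have := face_ind_zero hK h2 hb hq (φ := fun z => (z - p)) (n := -1)
      (by fun_prop) hq0
      (h.congr (fun z _ => by rw [zpow_neg_one, div_eq_mul_inv, mul_comm]))
    omega

/-- Compact subsets of open connected sets are contained in compact connected subsets. -/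
lemma exists_compact_conn {U C : Set ℂ} (hU : IsOpen U) (hUc : IsPreconnected U) (hC : IsCompact C)
    (hCU : C ⊆ U) (hCne : C.Nonempty) : ∃ T, IsCompact T ∧ IsPreconnected T ∧ C ⊆ T ∧ T ⊆ U := by
  obtain ⟨x₀, hx₀⟩ := hCne
  have hconn : IsConnected U := ⟨⟨x₀, hCU hx₀⟩, hUc⟩
  have hpc := hU.isConnected_iff_isPathConnected.1 hconn
  have hb : ∀ x ∈ C, ∃ r > 0, Metric.closedBall x r ⊆ U := fun x hx =>
    Metric.nhds_basis_closedBall.mem_iff.1 (hU.mem_nhds (hCU hx))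
  choose! r hr0 hr using hb
  obtain ⟨t, htC, ht⟩ := hC.elim_nhds_subcover (fun x => Metric.closedBall x (r x))
    (fun x hx => Metric.closedBall_mem_nhds x (hr0 x hx))
  have hj : ∀ x ∈ C, JoinedIn U x₀ x := fun x hx => hpc.joinedIn _ (hCU hx₀) _ (hCU hx)
  have hP : ∀ x ∈ C, ∃ P : Set ℂ, IsCompact P ∧ IsPreconnected P ∧ x₀ ∈ P ∧ x ∈ P ∧ P ⊆ U := by
    intro x hx
    obtain ⟨γ, hγ⟩ := hj x hx
    exact ⟨range γ, isCompact_range γ.continuous, isPreconnected_range γ.continuous,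
      ⟨0, γ.source⟩, ⟨1, γ.target⟩, range_subset_iff.2 hγ⟩
  choose! P hPc hPp hP0 hPx hPU using hP
  refine ⟨⋃ x ∈ insert x₀ t, (P x ∪ Metric.closedBall x (r x)), ?_, ?_, ?_, ?_⟩
  · refine Finset.isCompact_biUnion _ ?_
    intro x hx
    have hxC : x ∈ C := by
      rcases Finset.mem_insert.1 hx with rfl | h
      · exact hx₀
      · exact htC x h
    exact (hPc x hxC).union (isCompact_closedBall x _)
  · have hmem : ∀ x ∈ insert x₀ t, x ∈ C := by
      intro x hx
      rcases Finset.mem_insert.1 hx with rfl | h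
      · exact hx₀
      · exact htC x h
    have he : (⋃ x ∈ insert x₀ t, (P x ∪ Metric.closedBall x (r x))) =
        ⋃ x : {x // x ∈ insert x₀ t}, (P x ∪ Metric.closedBall (x : ℂ) (r x)) := by
      ext z; simp
    rw [he]
    refine isPreconnected_iUnion ⟨x₀, ?_⟩ ?_
    · rw [mem_iInter]
      rintro ⟨x, hx⟩
      exact Or.inl (hP0 x (hmem x hx))
    · rintro ⟨x, hx⟩
      exact IsPreconnected.union x (hPx x (hmem x hx))
        (Metric.mem_closedBall_self (hr0 x (hmem x hx)).le) (hPp x (hmem x hx))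
        (convex_closedBall x _).isPreconnected
  · intro z hz
    obtain ⟨x, hx, hzx⟩ := mem_iUnion₂.1 (ht hz)
    exact mem_iUnion₂.2 ⟨x, Finset.mem_insert_of_mem hx, Or.inr hzx⟩
  · intro z hz
    obtain ⟨x, hx, hzx⟩ := mem_iUnion₂.1 hz
    have hxC : x ∈ C := by
      rcases Finset.mem_insert.1 hx with rfl | h
      · exact hx₀
      · exact htC x h
    rcases hzx with h | h
    · exact hPU x hxC h
    · exact hr x hxC h

end OP

namespace OP

/-- `A` is an arc from `a` to `b`. -/
def IsArc (A : Set ℂ) (a b : ℂ) : Prop :=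
  ∃ γ : ℝ → ℂ, ContinuousOn γ (Icc 0 1) ∧ InjOn γ (Icc 0 1) ∧ γ 0 = a ∧ γ 1 = b ∧
    A = γ '' Icc (0 : ℝ) 1

lemma isArc_of_Icc {γ : ℝ → ℂ} {s t : ℝ} (hst : s < t) (hc : ContinuousOn γ (Icc s t))
    (hi : InjOn γ (Icc s t)) : IsArc (γ '' Icc s t) (γ s) (γ t) := by
  have hm : ∀ u ∈ Icc (0:ℝ) 1, s + u * (t - s) ∈ Icc s t := by
    rintro u ⟨h0, h1⟩
    have : 0 ≤ t - s := by linarith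
    exact ⟨by nlinarith, by nlinarith⟩
  refine ⟨fun u => γ (s + u * (t - s)), ?_, ?_, by simp, by simp, ?_⟩
  · exact hc.comp (by fun_prop) hm
  · intro u hu v hv huv
    have := hi (hm u hu) (hm v hv) huv
    have h2 : (u - v) * (t - s) = 0 := by linarith
    rcases mul_eq_zero.1 h2 with h | h <;> linarith
  · ext z
    constructor
    · rintro ⟨w, hw, rfl⟩
      have hts : 0 < t - s := by linarith
      refine ⟨(w - s) / (t - s), ⟨div_nonneg (by linarith [hw.1]) hts.le, ?_⟩, ?_⟩
      · rw [div_le_one hts]; linarith [hw.2]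
      · simp only; congr 1; field_simp; ring
    · rintro ⟨u, hu, rfl⟩
      exact ⟨_, hm u hu, rfl⟩

lemma IsArc.exists_param {A : Set ℂ} {a b : ℂ} (h : IsArc A a b) : ∃ (γ : ℝ → ℂ) (τ : ℂ → ℝ),
    ContinuousOn γ (Icc 0 1) ∧ ContinuousOn τ A ∧ γ 0 = a ∧ γ 1 = b ∧ A = γ '' Icc (0:ℝ) 1 ∧
    InjOn γ (Icc 0 1) ∧
    (∀ t ∈ Icc (0:ℝ) 1, τ (γ t) = t) ∧ (∀ z ∈ A, τ z ∈ Icc (0:ℝ) 1 ∧ γ (τ z) = z) := by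
  classical
  obtain ⟨γ, hc, hi, h0, h1, rfl⟩ := h
  have hc' : Continuous (fun t : Icc (0:ℝ) 1 => γ t) := continuousOn_iff_continuous_domRestrict.1 hc
  have hi' : Function.Injective (fun t : Icc (0:ℝ) 1 => γ t) := fun s t hst =>
    Subtype.ext (hi s.2 t.2 hst)
  have he := hc'.isClosedEmbedding hi'
  let e := he.isEmbedding.toHomeomorph
  have hr : ∀ z ∈ γ '' Icc (0:ℝ) 1, z ∈ range (fun t : Icc (0:ℝ) 1 => γ t) := by
    rintro z ⟨t, ht, rfl⟩; exact ⟨⟨t, ht⟩, rfl⟩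
  let τ : ℂ → ℝ := fun z => if h : z ∈ range (fun t : Icc (0:ℝ) 1 => γ t)
    then (e.symm ⟨z, h⟩ : ℝ) else 0
  have hτ : ∀ t ∈ Icc (0:ℝ) 1, τ (γ t) = t := by
    intro t ht
    have hm : γ t ∈ range (fun t : Icc (0:ℝ) 1 => γ t) := ⟨⟨t, ht⟩, rfl⟩
    simp only [τ, hm, dif_pos]
    have : e.symm ⟨γ t, hm⟩ = ⟨t, ht⟩ := by
      rw [Homeomorph.symm_apply_eq]; rfl
    rw [this]
  refine ⟨γ, τ, hc, ?_, h0, h1, rfl, hi, hτ, ?_⟩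
  · rw [continuousOn_iff_continuous_domRestrict]
    have : (γ '' Icc (0:ℝ) 1).domRestrict τ = fun z => (e.symm ⟨z.1, hr z.1 z.2⟩ : ℝ) := by
      ext ⟨z, hz⟩
      have := hr z hz
      simp only [domRestrict, τ, this, dif_pos]
    rw [this]
    exact continuous_subtype_val.comp (e.symm.continuous.comp
      (Continuous.subtype_mk continuous_subtype_val _))
  · rintro z ⟨t, ht, rfl⟩
    rw [hτ t ht]; exact ⟨ht, rfl⟩

section
variable {A B : Set ℂ} {a b c : ℂ}

lemma IsArc.symm (h : IsArc A a b) : IsArc A b a := by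
  obtain ⟨γ, hc, hi, h0, h1, rfl⟩ := h
  have hm : ∀ t ∈ Icc (0:ℝ) 1, 1 - t ∈ Icc (0:ℝ) 1 := fun t ht =>
    ⟨by linarith [ht.2], by linarith [ht.1]⟩
  refine ⟨fun t => γ (1 - t), hc.comp (by fun_prop) hm, ?_, by simpa using h1, by simpa using h0, ?_⟩
  · intro s hs t ht hst
    have := hi (hm s hs) (hm t ht) hst
    linarith
  · ext z; constructor
    · rintro ⟨t, ht, rfl⟩; exact ⟨1 - t, hm t ht, by simp⟩
    · rintro ⟨t, ht, rfl⟩; exact ⟨1 - t, hm t ht, rfl⟩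

lemma IsArc.left_mem (h : IsArc A a b) : a ∈ A := by
  obtain ⟨γ, hc, hi, rfl, h1, rfl⟩ := h
  exact ⟨0, by simp, rfl⟩

lemma IsArc.right_mem (h : IsArc A a b) : b ∈ A := h.symm.left_mem

lemma IsArc.ne (h : IsArc A a b) : a ≠ b := by
  obtain ⟨γ, hc, hi, rfl, rfl, rfl⟩ := h
  intro h
  have := hi (by simp) (by simp) h
  linarith

lemma IsArc.isCompact (h : IsArc A a b) : IsCompact A := by
  obtain ⟨γ, hc, hi, rfl, rfl, rfl⟩ := h
  exact isCompact_Icc.image_of_continuousOn hc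

lemma IsArc.isClosed (h : IsArc A a b) : IsClosed A := h.isCompact.isClosed

lemma IsArc.preconn (h : IsArc A a b) : IsPreconnected A := by
  obtain ⟨γ, hc, hi, rfl, rfl, rfl⟩ := h
  exact isPreconnected_Icc.image _ hc

lemma IsArc.nonempty (h : IsArc A a b) : A.Nonempty := ⟨a, h.left_mem⟩

lemma IsArc.hasLog (h : IsArc A a b) {f : ℂ → ℂ} (hf : ContinuousOn f A)
    (h0 : ∀ z ∈ A, f z ≠ 0) : HasLog A f := by
  obtain ⟨γ, τ, hγ, hτ, -, -, rfl, hi, hτγ, hγτ⟩ := h.exists_param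
  have hm : ∀ t : ℝ, (projIcc (0:ℝ) 1 zero_le_one t : ℝ) ∈ Icc (0:ℝ) 1 := fun t => Subtype.coe_prop _
  have hcont : Continuous (fun t : ℝ => f (γ (projIcc (0:ℝ) 1 zero_le_one t))) := by
    have h1 : ContinuousOn (fun t => f (γ t)) (Icc 0 1) :=
      hf.comp hγ (fun t ht => mem_image_of_mem _ ht)
    have := h1.comp (s := univ) (f := fun t : ℝ => (projIcc (0:ℝ) 1 zero_le_one t : ℝ))
      (continuous_subtype_val.comp continuous_projIcc).continuousOn (fun t _ => hm t)
    exact continuousOn_univ.1 this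
  obtain ⟨l, hl, hfl⟩ := exists_log_real _ hcont (fun t => h0 _ (mem_image_of_mem _ (hm t)))
  refine ⟨fun z => l (τ z), hl.comp_continuousOn hτ, fun z hz => ?_⟩
  rw [← hfl, projIcc_of_mem _ (hγτ z hz).1, (hγτ z hz).2]

lemma IsArc.split (h : IsArc A a b) {x : ℂ} (hx : x ∈ A) (hxa : x ≠ a) (hxb : x ≠ b) :
    ∃ A₁ A₂, IsArc A₁ a x ∧ IsArc A₂ x b ∧ A₁ ∪ A₂ = A ∧ A₁ ∩ A₂ = {x} := by
  obtain ⟨γ, hc, hi, rfl, rfl, rfl⟩ := h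
  obtain ⟨t, ht, rfl⟩ := hx
  have ht0 : 0 < t := lt_of_le_of_ne ht.1 (fun h => hxa (by rw [h]))
  have ht1 : t < 1 := lt_of_le_of_ne ht.2 (fun h => hxb (by rw [h]))
  have s1 : Icc 0 t ⊆ Icc (0:ℝ) 1 := Icc_subset_Icc_right ht.2
  have s2 : Icc t 1 ⊆ Icc (0:ℝ) 1 := Icc_subset_Icc_left ht.1
  refine ⟨γ '' Icc 0 t, γ '' Icc t 1, isArc_of_Icc ht0 (hc.mono s1) (hi.mono s1),
    isArc_of_Icc ht1 (hc.mono s2) (hi.mono s2), ?_, ?_⟩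
  · rw [← image_union, Icc_union_Icc_eq_Icc ht.1 ht.2]
  · rw [← hi.image_inter s1 s2, Icc_inter_Icc_eq_singleton ht.1 ht.2, image_singleton]

lemma IsArc.concat (h : IsArc A a b) (h' : IsArc B b c) (hd : A ∩ B ⊆ {b}) :
    IsArc (A ∪ B) a c := by
  classical
  obtain ⟨γ, hc, hi, rfl, rfl, rfl⟩ := h
  obtain ⟨δ, hc', hi', h0, rfl, rfl⟩ := h'
  let η : ℝ → ℂ := fun t => if t ≤ 1 then γ t else δ (t - 1)
  have e1 : ∀ t ∈ Icc (0:ℝ) 1, η t = γ t := fun t ht => by simp [η, ht.2]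
  have e2 : ∀ t ∈ Icc (1:ℝ) 2, η t = δ (t - 1) := by
    intro t ht
    by_cases h : t ≤ 1
    · have : t = 1 := le_antisymm h ht.1
      subst this
      simp [η, h0]
    · simp [η, h]
  have hm : ∀ t ∈ Icc (1:ℝ) 2, t - 1 ∈ Icc (0:ℝ) 1 := fun t ht =>
    ⟨by linarith [ht.1], by linarith [ht.2]⟩
  have hηc : ContinuousOn η (Icc 0 2) := by
    rw [← Icc_union_Icc_eq_Icc (zero_le_one' ℝ) (one_le_two)]
    refine ContinuousOn.union_of_isClosed (hc.congr e1) ?_ isClosed_Icc isClosed_Icc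
    exact ContinuousOn.congr (hc'.comp (by fun_prop) hm) e2
  have key : ∀ s ∈ Icc (0:ℝ) 1, ∀ t ∈ Icc (1:ℝ) 2, η s = η t → s = t := by
    intro s hs t ht hst
    rw [e1 s hs, e2 t ht] at hst
    have hmem : γ s ∈ γ '' Icc 0 1 ∩ δ '' Icc 0 1 :=
      ⟨⟨s, hs, rfl⟩, by rw [hst]; exact ⟨_, hm t ht, rfl⟩⟩
    have h1 := hd hmem
    have h2 : s = 1 := hi hs (by simp) h1
    have h3 : δ (t - 1) = δ 0 := by rw [← hst, h0]; exact h1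
    have h4 := hi' (hm t ht) (by simp) h3
    linarith
  have hηi : InjOn η (Icc 0 2) := by
    intro s hs t ht hst
    rcases le_total s 1 with h | h <;> rcases le_total t 1 with h' | h'
    · rw [e1 s ⟨hs.1, h⟩, e1 t ⟨ht.1, h'⟩] at hst
      exact hi ⟨hs.1, h⟩ ⟨ht.1, h'⟩ hst
    · exact key s ⟨hs.1, h⟩ t ⟨h', ht.2⟩ hst
    · exact (key t ⟨ht.1, h'⟩ s ⟨h, hs.2⟩ hst.symm).symm
    · rw [e2 s ⟨h, hs.2⟩, e2 t ⟨h', ht.2⟩] at hst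
      have := hi' (hm s ⟨h, hs.2⟩) (hm t ⟨h', ht.2⟩) hst
      linarith
  have := isArc_of_Icc (two_pos) hηc hηi
  have hI : η '' Icc 0 2 = γ '' Icc 0 1 ∪ δ '' Icc 0 1 := by
    rw [← Icc_union_Icc_eq_Icc (zero_le_one' ℝ) (one_le_two), image_union]
    congr 1
    · exact image_congr e1
    · ext z; constructor
      · rintro ⟨t, ht, rfl⟩; exact ⟨_, hm t ht, (e2 t ht).symm⟩
      · rintro ⟨t, ht, rfl⟩
        have ht' : t + 1 ∈ Icc (1:ℝ) 2 := ⟨by linarith [ht.1], by linarith [ht.2]⟩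
        exact ⟨t + 1, ht', by rw [e2 _ ht']; simp⟩
  rw [hI, e1 0 (by simp), e2 2 (by simp)] at this
  convert this using 2
  norm_num

lemma IsArc.int_eq (h : IsArc A a b) : ∃ γ : ℝ → ℂ, ContinuousOn γ (Icc 0 1) ∧
    A = γ '' Icc 0 1 ∧ γ 0 = a ∧ γ 1 = b ∧ A \ {a, b} = γ '' Ioo 0 1 ∧ A \ {a} = γ '' Ioc 0 1 := by
  obtain ⟨γ, hc, hi, rfl, rfl, rfl⟩ := h
  refine ⟨γ, hc, rfl, rfl, rfl, ?_, ?_⟩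
  · ext z; constructor
    · rintro ⟨⟨t, ht, rfl⟩, hz⟩
      refine ⟨t, ⟨lt_of_le_of_ne ht.1 ?_, lt_of_le_of_ne ht.2 ?_⟩, rfl⟩
      · rintro rfl; simp at hz
      · rintro rfl; simp at hz
    · rintro ⟨t, ht, rfl⟩
      refine ⟨⟨t, Ioo_subset_Icc_self ht, rfl⟩, ?_⟩
      rintro (h | h)
      · exact ht.1.ne' (hi (Ioo_subset_Icc_self ht) (by simp) h)
      · exact ht.2.ne (hi (Ioo_subset_Icc_self ht) (by simp) h)
  · ext z; constructor
    · rintro ⟨⟨t, ht, rfl⟩, hz⟩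
      refine ⟨t, ⟨lt_of_le_of_ne ht.1 ?_, ht.2⟩, rfl⟩
      rintro rfl; simp at hz
    · rintro ⟨t, ht, rfl⟩
      refine ⟨⟨t, Ioc_subset_Icc_self ht, rfl⟩, ?_⟩
      intro h
      exact ht.1.ne' (hi (Ioc_subset_Icc_self ht) (by simp) h)

lemma IsArc.int_preconn (h : IsArc A a b) : IsPreconnected (A \ {a, b}) := by
  obtain ⟨γ, hc, hA, -, -, he, -⟩ := h.int_eq
  rw [he]; exact isPreconnected_Ioo.image _ (hc.mono Ioo_subset_Icc_self)

lemma IsArc.diff_left_preconn (h : IsArc A a b) : IsPreconnected (A \ {a}) := by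
  obtain ⟨γ, hc, hA, -, -, -, he⟩ := h.int_eq
  rw [he]; exact isPreconnected_Ioc.image _ (hc.mono Ioc_subset_Icc_self)

lemma IsArc.diff_right_preconn (h : IsArc A a b) : IsPreconnected (A \ {b}) :=
  h.symm.diff_left_preconn

lemma IsArc.int_nonempty (h : IsArc A a b) : (A \ {a, b}).Nonempty := by
  obtain ⟨γ, hc, hA, -, -, he, -⟩ := h.int_eq
  rw [he]; exact ⟨_, ⟨1/2, ⟨by norm_num, by norm_num⟩, rfl⟩⟩

lemma IsArc.subset_closure_int (h : IsArc A a b) : A ⊆ closure (A \ {a, b}) := by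
  obtain ⟨γ, hc, hA, -, -, he, -⟩ := h.int_eq
  rw [he, hA]
  have h1 : closure (Ioo (0:ℝ) 1) = Icc 0 1 := closure_Ioo (by norm_num)
  rw [← h1] at hc ⊢
  exact hc.image_closure

/-- First hit of a closed set. -/
lemma IsArc.first_hit (h : IsArc A a b) {K : Set ℂ} (hK : IsClosed K) (ha : a ∉ K)
    (hne : (A ∩ K).Nonempty) : ∃ k A', k ∈ K ∧ IsArc A' a k ∧ A' ⊆ A ∧ A' ∩ K = {k} := by
  obtain ⟨γ, hc, hi, rfl, rfl, rfl⟩ := h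
  have hcl : IsClosed (Icc (0:ℝ) 1 ∩ γ ⁻¹' K) := hc.preimage_isClosed_of_isClosed isClosed_Icc hK
  have hcp : IsCompact (Icc (0:ℝ) 1 ∩ γ ⁻¹' K) := isCompact_Icc.of_isClosed_subset hcl inter_subset_left
  obtain ⟨z, ⟨t, ht, rfl⟩, hz⟩ := hne
  obtain ⟨s, hs, hmin⟩ := hcp.exists_isLeast ⟨t, ht, hz⟩
  have hs0 : 0 < s := lt_of_le_of_ne hs.1.1 (fun h => ha (by rw [h]; exact hs.2))
  have s1 : Icc 0 s ⊆ Icc (0:ℝ) 1 := Icc_subset_Icc_right hs.1.2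
  refine ⟨γ s, γ '' Icc 0 s, hs.2, isArc_of_Icc hs0 (hc.mono s1) (hi.mono s1), image_mono s1, ?_⟩
  ext z; constructor
  · rintro ⟨⟨u, hu, rfl⟩, hzK⟩
    have := hmin ⟨s1 hu, hzK⟩
    rw [le_antisymm hu.2 this]; rfl
  · rintro rfl
    exact ⟨⟨s, ⟨hs0.le, le_rfl⟩, rfl⟩, hs.2⟩

/-- A small middle subarc around an interior point. -/
lemma IsArc.middle (h : IsArc A a b) {z : ℂ} (hz : z ∈ A \ {a, b}) {U : Set ℂ} (hU : IsOpen U)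
    (hzU : z ∈ U) : ∃ A₁ A₂ A₃ a' b', IsArc A₁ a a' ∧ IsArc A₂ a' b' ∧ IsArc A₃ b' b ∧
      A₁ ∪ A₂ ∪ A₃ = A ∧ A₁ ∩ A₂ = {a'} ∧ A₂ ∩ A₃ = {b'} ∧ Disjoint A₁ A₃ ∧ A₂ ⊆ U ∧ z ∈ A₂ \ {a', b'} := by
  obtain ⟨γ, hc, hi, rfl, rfl, rfl⟩ := h
  obtain ⟨⟨t, ht, rfl⟩, hz⟩ := hz
  have ht0 : 0 < t := lt_of_le_of_ne ht.1 (fun h => hz (by rw [← h]; simp))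
  have ht1 : t < 1 := lt_of_le_of_ne ht.2 (fun h => hz (by rw [h]; simp))
  have hct : ContinuousAt γ t := hc.continuousAt (Icc_mem_nhds ht0 ht1)
  obtain ⟨ε, hε, hεU⟩ := Metric.mem_nhds_iff.1 (hct.preimage_mem_nhds (hU.mem_nhds hzU))
  let d := min (ε / 2) (min (t / 2) ((1 - t) / 2))
  have hd1 : d ≤ ε / 2 := min_le_left _ _
  have hd2 : d ≤ t / 2 := (min_le_right _ _).trans (min_le_left _ _)
  have hd3 : d ≤ (1 - t) / 2 := (min_le_right _ _).trans (min_le_right _ _)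
  have hd0 : 0 < d := lt_min (by linarith) (lt_min (by linarith) (by linarith))
  have s1 : Icc 0 (t - d) ⊆ Icc (0:ℝ) 1 := Icc_subset_Icc_right (by linarith)
  have s2 : Icc (t - d) (t + d) ⊆ Icc (0:ℝ) 1 := Icc_subset_Icc (by linarith) (by linarith)
  have s3 : Icc (t + d) 1 ⊆ Icc (0:ℝ) 1 := Icc_subset_Icc_left (by linarith)
  refine ⟨γ '' Icc 0 (t - d), γ '' Icc (t - d) (t + d), γ '' Icc (t + d) 1, γ (t - d), γ (t + d),
    isArc_of_Icc (by linarith) (hc.mono s1) (hi.mono s1),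
    isArc_of_Icc (by linarith) (hc.mono s2) (hi.mono s2),
    isArc_of_Icc (by linarith) (hc.mono s3) (hi.mono s3), ?_, ?_, ?_, ?_, ?_, ?_⟩
  · rw [← image_union, Icc_union_Icc_eq_Icc (by linarith) (by linarith), ← image_union,
      Icc_union_Icc_eq_Icc (by linarith) (by linarith)]
  · rw [← hi.image_inter s1 s2, Icc_inter_Icc_eq_singleton (by linarith) (by linarith), image_singleton]
  · rw [← hi.image_inter s2 s3, Icc_inter_Icc_eq_singleton (by linarith) (by linarith), image_singleton]
  · rw [disjoint_left]
    rintro _ ⟨u, hu, rfl⟩ ⟨v, hv, huv⟩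
    have := hi (s3 hv) (s1 hu) huv
    linarith [hu.2, hv.1]
  · rintro _ ⟨u, hu, rfl⟩
    apply hεU
    rw [Metric.mem_ball, Real.dist_eq, abs_lt]
    constructor <;> linarith [hu.1, hu.2]
  · refine ⟨⟨t, ⟨by linarith, by linarith⟩, rfl⟩, ?_⟩
    rintro (h | h)
    · have := hi ht (s1 ⟨by linarith, le_rfl⟩) h; linarith
    · have := hi ht (s3 ⟨le_rfl, by linarith⟩) h; linarith

end

end OP

namespace OP

lemma face_extend {K L F : Set ℂ} (hK : IsClosed K) (hF : Face K F)
    (hd : Disjoint F L) : Face (K ∪ L) F := by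
  refine face_of (hF.isOpen hK) hF.preconn hF.nonempty
    (disjoint_union_right.2 ⟨hF.disj, hd⟩) ?_
  exact (hF.closure_subset hK).trans (union_subset_union_right _ subset_union_left)

lemma exists_bigger {K L F : Set ℂ} (hKL : K ⊆ L) (hF : Face L F) : ∃ G, Face K G ∧ F ⊆ G := by
  obtain ⟨p, hp⟩ := hF.nonempty
  obtain ⟨G, hG, hpG⟩ := face_of_notMem (fun h => disjoint_left.1 hF.disj hp (hKL h) : p ∉ K)
  exact ⟨G, hG, hF.subset_of_subset hKL hG ⟨p, hp, hpG⟩⟩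

lemma janiszewski {K L G H F F' : Set ℂ} (hK : IsCompact K) (hL : IsCompact L)
    (hKL : IsPreconnected (K ∩ L)) (hG : Face K G) (hH : Face L H) (hF : Face (K ∪ L) F)
    (hF' : Face (K ∪ L) F') (h1 : F ⊆ G) (h2 : F' ⊆ G) (h3 : F ⊆ H) (h4 : F' ⊆ H) : F = F' := by
  obtain ⟨p, hp⟩ := hF.nonempty
  obtain ⟨q, hq⟩ := hF'.nonempty
  refine eilenberg (hK.union hL) hF hF' hp hq ?_
  exact HasLog.glue hK.isClosed hL.isClosed hKL
    (hasLog_of_joined hK hG.preconn hG.disj (h1 hp) (h2 hq))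
    (hasLog_of_joined hL hH.preconn hH.disj (h3 hp) (h4 hq))

lemma hasLog_div_arc {A : Set ℂ} {a b p q : ℂ} (hA : IsArc A a b) (hp : p ∉ A) (hq : q ∉ A) :
    HasLog A (fun z => (z - p) / (z - q)) := by
  have hp0 : ∀ z ∈ A, z - p ≠ 0 := fun z hz h => hp (by rwa [← sub_eq_zero.1 h])
  have hq0 : ∀ z ∈ A, z - q ≠ 0 := fun z hz h => hq (by rwa [← sub_eq_zero.1 h])
  exact hA.hasLog (ContinuousOn.div (by fun_prop) (by fun_prop) hq0)
    (fun z hz => div_ne_zero (hp0 z hz) (hq0 z hz))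

lemma arc_face_unique {A F F' : Set ℂ} {a b : ℂ} (hA : IsArc A a b) (hF : Face A F)
    (hF' : Face A F') : F = F' := by
  obtain ⟨p, hp⟩ := hF.nonempty
  obtain ⟨q, hq⟩ := hF'.nonempty
  exact eilenberg hA.isCompact hF hF' hp hq
    (hasLog_div_arc hA (disjoint_left.1 hF.disj hp) (disjoint_left.1 hF'.disj hq))

/-- Adding an arc which meets `K` in at most one point does not split faces. -/
lemma pendant {K A G F F' : Set ℂ} {a b : ℂ} (hK : IsCompact K) (hA : IsArc A a b)
    (hAK : (K ∩ A).Subsingleton) (hG : Face K G) (hF : Face (K ∪ A) F) (hF' : Face (K ∪ A) F')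
    (h1 : F ⊆ G) (h2 : F' ⊆ G) : F = F' := by
  obtain ⟨H, hH, h3⟩ := exists_bigger subset_union_right hF
  obtain ⟨H', hH', h4⟩ := exists_bigger subset_union_right hF'
  obtain rfl := arc_face_unique hA hH hH'
  exact janiszewski hK hA.isCompact hAK.isPreconnected hG hH hF hF' h1 h2 h3 h4

lemma HasLog.normalize {A : Set ℂ} {f : ℂ → ℂ} (h : HasLog A f) {a w : ℂ} (ha : a ∈ A)
    (hw : f a = Complex.exp w) :
    ∃ l : ℂ → ℂ, ContinuousOn l A ∧ (∀ z ∈ A, f z = Complex.exp (l z)) ∧ l a = w := by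
  obtain ⟨g, hg, hfg⟩ := h
  refine ⟨fun z => g z + (w - g a), hg.add continuousOn_const, fun z hz => ?_, by ring⟩
  rw [Complex.exp_add, Complex.exp_sub, ← hw, ← hfg a ha, ← hfg z hz, div_self, mul_one]
  rw [hfg a ha]; exact Complex.exp_ne_zero _

/-- Two logs on `K` and `A`, normalized at `a`, with integer mismatch at `b`. -/
lemma chord_mismatch {K A : Set ℂ} {a b p q : ℂ} (hA : IsArc A a b) (hAK : K ∩ A = {a, b})
    {f : ℂ → ℂ} (hf : f = fun z => (z - p) / (z - q))
    (h1 : HasLog K f) (h2 : HasLog A f) :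
    ∃ (g l : ℂ → ℂ) (k : ℤ), ContinuousOn g K ∧ ContinuousOn l A ∧
      (∀ z ∈ K, f z = Complex.exp (g z)) ∧ (∀ z ∈ A, f z = Complex.exp (l z)) ∧ g a = l a ∧
      g b = l b + k * (2 * Real.pi * Complex.I) := by
  have haK : a ∈ K ∩ A := by rw [hAK]; simp
  have hbK : b ∈ K ∩ A := by rw [hAK]; simp
  obtain ⟨g, hg, hfg⟩ := h1
  obtain ⟨l, hl, hfl, hla⟩ := h2.normalize haK.2 (hfg a haK.1)
  obtain ⟨k, hk⟩ := Complex.exp_eq_exp_iff_exists_int.1 ((hfg b hbK.1).symm.trans (hfl b hbK.2))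
  exact ⟨g, l, k, hg, hl, hfg, hfl, hla.symm, hk⟩

lemma chord_three {K A G F₁ F₂ F₃ : Set ℂ} {a b : ℂ} (hK : IsCompact K) (hA : IsArc A a b)
    (hAK : K ∩ A = {a, b}) (hG : Face K G) (h1 : Face (K ∪ A) F₁) (h2 : Face (K ∪ A) F₂)
    (h3 : Face (K ∪ A) F₃) (s1 : F₁ ⊆ G) (s2 : F₂ ⊆ G) (s3 : F₃ ⊆ G) (h12 : F₁ ≠ F₂)
    (h13 : F₁ ≠ F₃) (h23 : F₂ ≠ F₃) : False := by
  obtain ⟨p, hp⟩ := h1.nonempty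
  obtain ⟨q, hq⟩ := h2.nonempty
  obtain ⟨r, hr⟩ := h3.nonempty
  have nA : ∀ {F : Set ℂ} {x : ℂ}, Face (K ∪ A) F → x ∈ F → x ∉ A := fun hF hx hxA =>
    disjoint_left.1 hF.disj hx (Or.inr hxA)
  have n0 : ∀ {F : Set ℂ} {x : ℂ}, Face (K ∪ A) F → x ∈ F → ∀ z ∈ K ∪ A, z - x ≠ 0 :=
    fun hF hx z hz h0 => disjoint_left.1 hF.disj hx (by rwa [← sub_eq_zero.1 h0])
  obtain ⟨g₁, l₁, k₁, hg₁, hl₁, hfg₁, hfl₁, ha₁, hb₁⟩ := chord_mismatch (p := p) (q := q) hA hAK rfl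
    (hasLog_of_joined hK hG.preconn hG.disj (s1 hp) (s2 hq))
    (hasLog_div_arc hA (nA h1 hp) (nA h2 hq))
  obtain ⟨g₂, l₂, k₂, hg₂, hl₂, hfg₂, hfl₂, ha₂, hb₂⟩ := chord_mismatch (p := q) (q := r) hA hAK rfl
    (hasLog_of_joined hK hG.preconn hG.disj (s2 hq) (s3 hr))
    (hasLog_div_arc hA (nA h2 hq) (nA h3 hr))
  have hlog : HasLog (K ∪ A) (fun z => ((z - p) / (z - q)) ^ k₂ * ((z - q) / (z - r)) ^ (-k₁)) := by
    refine HasLog.glue_eq (g := fun z => k₂ * g₁ z + (-k₁ : ℤ) * g₂ z)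
      (h := fun z => k₂ * l₁ z + (-k₁ : ℤ) * l₂ z) hK.isClosed hA.isClosed ?_ ?_ ?_ ?_ ?_
    · exact (continuousOn_const.mul hg₁).add (continuousOn_const.mul hg₂)
    · intro z hz
      have e1 := hfg₁ z hz
      have e2 := hfg₂ z hz
      beta_reduce
      rw [Complex.exp_add, Complex.exp_int_mul, Complex.exp_int_mul, ← e1, ← e2]
    · exact (continuousOn_const.mul hl₁).add (continuousOn_const.mul hl₂)
    · intro z hz
      have e1 := hfl₁ z hz
      have e2 := hfl₂ z hz
      beta_reduce
      rw [Complex.exp_add, Complex.exp_int_mul, Complex.exp_int_mul, ← e1, ← e2]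
    · intro z hz
      rw [hAK] at hz
      rcases hz with rfl | rfl
      · simp only [ha₁, ha₂]
      · simp only [hb₁, hb₂]; push_cast; ring
  have hlog' : HasLog (K ∪ A) (fun z => (z - p) ^ k₂ * (z - q) ^ (-k₁ - k₂) * (z - r) ^ k₁) := by
    refine hlog.congr (fun z hz => ?_)
    have hp0 := n0 h1 hp z hz
    have hq0 := n0 h2 hq z hz
    have hr0 := n0 h3 hr z hz
    rw [div_zpow, div_zpow, zpow_sub₀ hq0, zpow_neg (z - r), zpow_neg (z - q)]
    field_simp
  obtain ⟨-, -, hk₁⟩ := three_faces (hK.union hA.isCompact) h1 h2 h3 h12 h13 h23 hp hq hr (by ring)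
    hlog'
  refine h12 (eilenberg (hK.union hA.isCompact) h1 h2 hp hq ?_)
  refine HasLog.glue_eq hK.isClosed hA.isClosed hg₁ hfg₁ hl₁ hfl₁ ?_
  intro z hz
  rw [hAK] at hz
  rcases hz with rfl | rfl
  · exact ha₁
  · rw [hb₁, hk₁]; simp

lemma chord_disconn {K A G : Set ℂ} {a b : ℂ} (hK : IsCompact K) (hKc : IsPreconnected K)
    (hA : IsArc A a b) (hAK : K ∩ A = {a, b}) (hG : Face K G) (hAG : A \ {a, b} ⊆ G) :
    ¬ IsPreconnected (G \ A) := by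
  intro hpre
  have haK : a ∈ K := (by rw [hAK]; simp : a ∈ K ∩ A).1
  have hbK : b ∈ K := (by rw [hAK]; simp : b ∈ K ∩ A).1
  have hab := hA.ne
  have hd : 0 < ‖a - b‖ := norm_pos_iff.2 (sub_ne_zero.2 hab)
  set r := ‖a - b‖ / 2 with hr
  have hr0 : 0 < r := by positivity
  set σ := Metric.sphere a r with hσ
  have hσc : IsCompact σ := isCompact_sphere a r
  have hab' : a - b ≠ 0 := sub_ne_zero.2 hab
  have hcov : σ ⊆ Aᶜ ∪ G := by
    intro z hz
    by_cases hzA : z ∈ A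
    · right
      apply hAG
      refine ⟨hzA, ?_⟩
      rw [hσ, mem_sphere_iff_norm] at hz
      rintro (h | h)
      · rw [h, sub_self, norm_zero] at hz; linarith
      · rw [mem_singleton_iff] at h
        rw [h, norm_sub_rev] at hz; linarith
    · exact Or.inl hzA
  obtain ⟨S₁, S₂, hS₁, hS₂, hS₁A, hS₂G, hS⟩ :=
    hσc.binary_compact_cover hA.isClosed.isOpen_compl (hG.isOpen hK.isClosed) hcov
  obtain ⟨T, hTc, hTp, hST, hTG⟩ : ∃ T, IsCompact T ∧ IsPreconnected T ∧ S₁ ∩ S₂ ⊆ T ∧ T ⊆ G \ A := by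
    rcases (S₁ ∩ S₂).eq_empty_or_nonempty with h | h
    · exact ⟨∅, isCompact_empty, isPreconnected_empty, by rw [h], empty_subset _⟩
    · exact exists_compact_conn ((hG.isOpen hK.isClosed).sdiff hA.isClosed) hpre
        (hS₁.inter hS₂) (fun z hz => ⟨hS₂G hz.2, hS₁A hz.1⟩) h
  have l1 : HasLog (S₁ ∪ T) (fun z => (z - a) / (z - b)) := by
    refine hasLog_of_joined (hS₁.union hTc) hA.preconn ?_ hA.left_mem hA.right_mem
    rw [disjoint_left]
    rintro z hz (h | h)
    · exact hS₁A h hz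
    · exact (hTG h).2 hz
  have l2 : HasLog (S₂ ∪ T) (fun z => (z - a) / (z - b)) := by
    refine hasLog_of_joined (hS₂.union hTc) hKc ?_ haK hbK
    rw [disjoint_left]
    rintro z hz (h | h)
    · exact disjoint_left.1 hG.disj (hS₂G h) hz
    · exact disjoint_left.1 hG.disj (hTG h).1 hz
  have l3 : HasLog σ (fun z => (z - a) / (z - b)) := by
    refine (HasLog.glue (hS₁.union hTc).isClosed (hS₂.union hTc).isClosed ?_ l1 l2).mono ?_
    · rw [← inter_union_distrib_right, union_eq_right.2 hST]
      exact hTp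
    · rw [hS]
      rintro z (h | h)
      · exact Or.inl (Or.inl h)
      · exact Or.inr (Or.inl h)
  have l4 : HasLog σ (fun z => z - b) := by
    have h1 : HasLog σ (fun z => (z - b) / (a - b)) := by
      refine hasLog_of_slit (by fun_prop) ?_
      intro z hz
      have : (z - b) / (a - b) = 1 + (z - a) / (a - b) := by
        field_simp; ring
      rw [this]
      apply Complex.mem_slitPlane_of_norm_lt_one
      rw [hσ, mem_sphere_iff_norm] at hz
      rw [norm_div, hz, div_lt_one hd]
      linarith
    have h2 : HasLog σ (fun _ => a - b) :=
      ⟨fun _ => Complex.log (a - b), continuousOn_const, fun z _ => (Complex.exp_log hab').symm⟩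
    exact (h1.mul h2).congr (fun z _ => by field_simp)
  have l5 : HasLog σ (fun z => (z - a) ^ (1 : ℤ)) := by
    refine (l3.mul l4).congr (fun z hz => ?_)
    have : z - b ≠ 0 := by
      intro h0
      rw [hσ, mem_sphere_iff_norm, sub_eq_zero.1 h0, norm_sub_rev] at hz
      linarith
    rw [zpow_one]; field_simp
  have := no_log_circle hr0 l5
  omega

lemma chord_core {K A : Set ℂ} {a b : ℂ} (hK : IsCompact K) (hKc : IsPreconnected K)
    (hA : IsArc A a b) (hAK : K ∩ A = {a, b}) :
    ∃ G R₁ R₂, Face K G ∧ A \ {a, b} ⊆ G ∧ Face (K ∪ A) R₁ ∧ Face (K ∪ A) R₂ ∧ R₁ ≠ R₂ ∧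
      G \ A = R₁ ∪ R₂ := by
  obtain ⟨x, hx⟩ := hA.int_nonempty
  have hdis : Disjoint (A \ {a, b}) K := by
    rw [disjoint_left]
    intro z hz hzK
    exact hz.2 (by rw [← hAK]; exact ⟨hzK, hz.1⟩)
  obtain ⟨G, hG, hxG⟩ := face_of_notMem (disjoint_left.1 hdis hx)
  have hAG : A \ {a, b} ⊆ G := hG.subset_of hA.int_preconn hdis ⟨x, hx, hxG⟩
  have hnp := chord_disconn hK hKc hA hAK hG hAG
  have hmem : ∀ p ∈ G \ A, ∃ R, Face (K ∪ A) R ∧ p ∈ R ∧ R ⊆ G := by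
    intro p hp
    obtain ⟨R, hR, hpR⟩ := face_of_notMem (K := K ∪ A) (p := p) (by
      rintro (h | h)
      · exact disjoint_left.1 hG.disj hp.1 h
      · exact hp.2 h)
    exact ⟨R, hR, hpR, hR.subset_of_subset subset_union_left hG ⟨p, hpR, hp.1⟩⟩
  have hRd : ∀ R, Face (K ∪ A) R → R ⊆ G → R ⊆ G \ A := fun R hR h z hz =>
    ⟨h hz, fun hzA => disjoint_left.1 hR.disj hz (Or.inr hzA)⟩
  have hne : (G \ A).Nonempty := by
    by_contra h
    rw [not_nonempty_iff_eq_empty] at h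
    rw [h] at hnp; exact hnp isPreconnected_empty
  obtain ⟨p, hp⟩ := hne
  obtain ⟨R₁, hR₁, hpR, hR₁G⟩ := hmem p hp
  have hne2 : ¬ (G \ A ⊆ R₁) := fun h => hnp (by
    rw [Subset.antisymm h (hRd R₁ hR₁ hR₁G)]; exact hR₁.preconn)
  obtain ⟨q, hq, hqR⟩ := not_subset.1 hne2
  obtain ⟨R₂, hR₂, hqR₂, hR₂G⟩ := hmem q hq
  have h12 : R₁ ≠ R₂ := by rintro rfl; exact hqR hqR₂
  refine ⟨G, R₁, R₂, hG, hAG, hR₁, hR₂, h12, Subset.antisymm ?_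
    (union_subset (hRd _ hR₁ hR₁G) (hRd _ hR₂ hR₂G))⟩
  intro r hr
  obtain ⟨R₃, hR₃, hrR₃, hR₃G⟩ := hmem r hr
  by_contra hcon
  refine chord_three hK hA hAK hG hR₁ hR₂ hR₃ hR₁G hR₂G hR₃G h12 ?_ ?_
  · rintro rfl; exact hcon (Or.inl hrR₃)
  · rintro rfl; exact hcon (Or.inr hrR₃)

/-- Adding an arc meeting the connected compact set `K` in exactly its end points splits exactly one
face in two. -/
theorem chord {K A : Set ℂ} {a b : ℂ} (hK : IsCompact K) (hKc : IsPreconnected K)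
    (hA : IsArc A a b) (hAK : K ∩ A = {a, b}) :
    ∃ G R₁ R₂, Face K G ∧ A \ {a, b} ⊆ G ∧ Face (K ∪ A) R₁ ∧ Face (K ∪ A) R₂ ∧ R₁ ≠ R₂ ∧
      G \ A = R₁ ∪ R₂ ∧ A ⊆ closure R₁ ∧ A ⊆ closure R₂ ∧
      (∀ F, Face (K ∪ A) F → F = R₁ ∨ F = R₂ ∨ (Face K F ∧ F ≠ G)) ∧
      (∀ F, Face K F → F ≠ G → Face (K ∪ A) F ∧ F ≠ R₁ ∧ F ≠ R₂) := by
  obtain ⟨G, R₁, R₂, hG, hAG, hR₁, hR₂, h12, hGA⟩ := chord_core hK hKc hA hAK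
  have haK : a ∈ K := (by rw [hAK]; simp : a ∈ K ∩ A).1
  have hbK : b ∈ K := (by rw [hAK]; simp : b ∈ K ∩ A).1
  have hG₁ : R₁ ⊆ G := fun z hz => (by rw [hGA]; exact Or.inl hz : z ∈ G \ A).1
  have hG₂ : R₂ ⊆ G := fun z hz => (by rw [hGA]; exact Or.inr hz : z ∈ G \ A).1
  -- closures
  have hcl : ∀ z ∈ A \ {a, b}, z ∈ closure R₁ ∧ z ∈ closure R₂ := by
    intro z hz
    have main : ∀ U, IsOpen U → z ∈ U → (∃ y ∈ U, y ∈ closure R₁) ∧ (∃ y ∈ U, y ∈ closure R₂) := by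
      intro U hU hzU
      obtain ⟨A₁, A₂, A₃, a', b', h1, h2, h3, hA123, hA12, hA23, hA13, hA2U, hzA2⟩ :=
        hA.middle hz hU hzU
      have sA1 : A₁ ⊆ A := by rw [← hA123]; exact fun z h => Or.inl (Or.inl h)
      have sA2 : A₂ ⊆ A := by rw [← hA123]; exact fun z h => Or.inl (Or.inr h)
      have sA3 : A₃ ⊆ A := by rw [← hA123]; exact fun z h => Or.inr h
      have ha1 : a ∈ A₁ := h1.left_mem
      have hb3 : b ∈ A₃ := h3.right_mem
      have ha2 : a ∉ A₂ := by
        intro h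
        have : a = a' := by have : a ∈ A₁ ∩ A₂ := ⟨ha1, h⟩; rwa [hA12] at this
        exact h1.ne this
      have hb2 : b ∉ A₂ := by
        intro h
        have : b = b' := by have : b ∈ A₂ ∩ A₃ := ⟨h, hb3⟩; rwa [hA23] at this
        exact h3.ne this.symm
      have hKA2 : Disjoint K A₂ := by
        rw [disjoint_left]
        intro w hw hw2
        have : w ∈ K ∩ A := ⟨hw, sA2 hw2⟩
        rw [hAK] at this
        rcases this with rfl | rfl
        · exact ha2 hw2
        · exact hb2 hw2
      set K' := K ∪ A₁ ∪ A₃ with hK'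
      have hK'c : IsCompact K' := (hK.union h1.isCompact).union h3.isCompact
      have hK'p : IsPreconnected K' :=
        IsPreconnected.union b (Or.inl hbK) hb3 (IsPreconnected.union a haK ha1 hKc h1.preconn)
          h3.preconn
      have hK'A : K' ∩ A₂ = {a', b'} := by
        rw [hK', union_inter_distrib_right, union_inter_distrib_right, hA12, hKA2.inter_eq,
          inter_comm A₃, hA23, empty_union]; rfl
      have hU' : K' ∪ A₂ = K ∪ A := by
        rw [hK', ← hA123]; ext w; simp only [mem_union]; tauto
      obtain ⟨G', S₁, S₂, hG', hAG', hS₁, hS₂, hS12, hG'A⟩ := chord_core hK'c hK'p h2 hK'A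
      rw [hU'] at hS₁ hS₂
      have hzG' : z ∈ G' := hAG' hzA2
      have hG'G : G' ⊆ G := hG.subset_of hG'.preconn
        (hG'.disj.mono_right (fun w hw => Or.inl (Or.inl hw))) ⟨z, hzG', hAG hz⟩
      have hSR : ∀ S, Face (K ∪ A) S → S ⊆ G' \ A₂ → S = R₁ ∨ S = R₂ := by
        intro S hS hSG
        obtain ⟨y, hy⟩ := hS.nonempty
        have : y ∈ G \ A := ⟨hG'G (hSG hy).1, fun h => disjoint_left.1 hS.disj hy (Or.inr h)⟩
        rw [hGA] at this
        rcases this with h | h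
        · exact Or.inl (hS.eq_of_mem hR₁ hy h)
        · exact Or.inr (hS.eq_of_mem hR₂ hy h)
      have e1 := hSR S₁ hS₁ (by rw [hG'A]; exact subset_union_left)
      have e2 := hSR S₂ hS₂ (by rw [hG'A]; exact subset_union_right)
      have hRR : G' \ A₂ = R₁ ∪ R₂ := by
        rcases e1 with rfl | rfl <;> rcases e2 with rfl | rfl
        · exact absurd rfl hS12
        · exact hG'A
        · rw [hG'A, union_comm]
        · exact absurd rfl hS12
      -- generic
      have gen : ∀ R R', Face (K ∪ A) R → Face (K ∪ A) R' → R ≠ R' → G' \ A₂ = R ∪ R' →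
          ∃ y ∈ U, y ∈ closure R := by
        intro R R' hR hR' hne hU2
        by_contra hcon
        push Not at hcon
        have ho : IsOpen R := hR.isOpen (hK.union hA.isCompact).isClosed
        obtain ⟨x, hx⟩ := hR.nonempty
        obtain ⟨x', hx'⟩ := hR'.nonempty
        have hxG : x ∈ G' \ A₂ := by rw [hU2]; exact Or.inl hx
        have hxG' : x' ∈ G' \ A₂ := by rw [hU2]; exact Or.inr hx'
        have hcc : ∀ w ∈ G', w ∈ closure R → w ∈ R := by
          intro w hw hwc
          by_cases hwA : w ∈ A₂
          · exact absurd hwc (hcon w (hA2U hwA))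
          · have : w ∈ G' \ A₂ := ⟨hw, hwA⟩
            rw [hU2] at this
            rcases this with h | h
            · exact h
            · exfalso
              obtain ⟨y, hy1, hy2⟩ := mem_closure_iff.1 hwc R'
                (hR'.isOpen (hK.union hA.isCompact).isClosed) h
              exact hne (hR.eq_of_mem hR' hy2 hy1)
        obtain ⟨y, hy, hy1, hy2⟩ := hG'.preconn R (closure R)ᶜ ho isClosed_closure.isOpen_compl
          (fun w hw => by
            by_cases h : w ∈ closure R
            · exact Or.inl (hcc w hw h)
            · exact Or.inr h) ⟨x, hxG.1, hx⟩ ⟨x', hxG'.1, fun h => hne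
              (hR.eq_of_mem hR' (hcc x' hxG'.1 h) hx')⟩
        exact hy2 (subset_closure hy1)
      exact ⟨gen R₁ R₂ hR₁ hR₂ h12 hRR, gen R₂ R₁ hR₂ hR₁ h12.symm (by rw [hRR, union_comm])⟩
    constructor
    · rw [← closure_closure, mem_closure_iff]
      intro U hU hzU
      obtain ⟨⟨y, hy, hy'⟩, -⟩ := main U hU hzU
      exact ⟨y, hy, hy'⟩
    · rw [← closure_closure, mem_closure_iff]
      intro U hU hzU
      obtain ⟨-, ⟨y, hy, hy'⟩⟩ := main U hU hzU
      exact ⟨y, hy, hy'⟩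
  have hext : ∀ F, Face K F → F ≠ G → Face (K ∪ A) F := by
    intro F hF hne
    refine face_extend hK.isClosed hF ?_
    rw [disjoint_left]
    intro w hw hwA
    have hwab : w ∉ ({a, b} : Set ℂ) := by
      rw [← hAK]; exact fun h => disjoint_left.1 hF.disj hw h.1
    exact hne (hF.eq_of_mem hG hw (hAG ⟨hwA, hwab⟩))
  refine ⟨G, R₁, R₂, hG, hAG, hR₁, hR₂, h12, hGA, ?_, ?_, ?_, ?_⟩
  · exact hA.subset_closure_int.trans (closure_minimal (fun z hz => (hcl z hz).1) isClosed_closure)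
  · exact hA.subset_closure_int.trans (closure_minimal (fun z hz => (hcl z hz).2) isClosed_closure)
  · intro F hF
    obtain ⟨H, hH, hFH⟩ := exists_bigger subset_union_left hF
    obtain ⟨y, hy⟩ := hF.nonempty
    by_cases h : H = G
    · subst h
      have : y ∈ H \ A := ⟨hFH hy, fun h => disjoint_left.1 hF.disj hy (Or.inr h)⟩
      rw [hGA] at this
      rcases this with h | h
      · exact Or.inl (hF.eq_of_mem hR₁ hy h)
      · exact Or.inr (Or.inl (hF.eq_of_mem hR₂ hy h))
    · have := hext H hH h
      rw [hF.eq_of_mem this hy (hFH hy)]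
      exact Or.inr (Or.inr ⟨hH, h⟩)
  · intro F hF hne
    refine ⟨hext F hF hne, ?_, ?_⟩
    · rintro rfl
      obtain ⟨y, hy⟩ := hF.nonempty
      exact hne (hF.eq_of_mem hG hy (hG₁ hy))
    · rintro rfl
      obtain ⟨y, hy⟩ := hF.nonempty
      exact hne (hF.eq_of_mem hG hy (hG₂ hy))

end OP

namespace OP

/-- Running maximum of the distance from `g q`. -/
noncomputable def runMax (g : ℝ → ℂ) (q t : ℝ) : ℝ :=
  sSup ((fun s => dist (g (q + s * (max t q - q))) (g q)) '' Icc (0:ℝ) 1)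

section
variable {g : ℝ → ℂ}

lemma runMax_cont (hg : Continuous g) (q : ℝ) : Continuous (runMax g q) := by
  unfold runMax
  refine IsCompact.continuous_sSup (f := fun t s => dist (g (q + s * (max t q - q))) (g q))
    isCompact_Icc ?_
  show Continuous (fun p : ℝ × ℝ => dist (g (q + p.2 * (max p.1 q - q))) (g q))
  fun_prop

lemma runMax_bdd (hg : Continuous g) (q t : ℝ) :
    BddAbove ((fun s => dist (g (q + s * (max t q - q))) (g q)) '' Icc (0:ℝ) 1) := by
  refine (isCompact_Icc.image_of_continuousOn ?_).bddAbove
  exact Continuous.continuousOn (by fun_prop)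

lemma le_runMax (hg : Continuous g) {q t s : ℝ} (h1 : q ≤ s) (h2 : s ≤ max t q) :
    dist (g s) (g q) ≤ runMax g q t := by
  rcases h1.eq_or_lt with rfl | h1
  · have := le_csSup (runMax_bdd hg q t) ⟨0, by simp, rfl⟩
    unfold runMax
    simpa using this
  · have hpos : 0 < max t q - q := by linarith
    refine le_csSup (runMax_bdd hg q t) ⟨(s - q) / (max t q - q),
      ⟨div_nonneg (by linarith) hpos.le, ?_⟩, ?_⟩
    · rw [div_le_one hpos]; linarith
    · simp only; congr 2; field_simp; ring

lemma runMax_nonneg (hg : Continuous g) (q t : ℝ) : 0 ≤ runMax g q t := by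
  have := le_runMax hg (le_refl q) (le_max_right t q)
  simpa using this

lemma runMax_le {q t M : ℝ} (h : ∀ s, q ≤ s → s ≤ max t q → dist (g s) (g q) ≤ M) :
    runMax g q t ≤ M := by
  refine csSup_le ⟨_, ⟨0, by simp, rfl⟩⟩ ?_
  rintro _ ⟨s, hs, rfl⟩
  have hm := le_max_right t q
  exact h _ (by nlinarith [hs.1]) (by nlinarith [hs.2])

lemma runMax_mono (hg : Continuous g) (q : ℝ) {t t' : ℝ} (h : t ≤ t') :
    runMax g q t ≤ runMax g q t' :=
  runMax_le (fun _ h1 h2 => le_runMax hg h1 (h2.trans (max_le_max_right q h)))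

lemma runMax_zero {q t : ℝ} (h : t ≤ q) : runMax g q t ≤ 0 :=
  runMax_le (fun s h1 h2 => by
    rw [max_eq_right h] at h2
    rw [le_antisymm h2 h1, dist_self])

lemma runMax_const (hg : Continuous g) (q : ℝ) {t t' : ℝ} (h : t ≤ t')
    (hc : ∀ u ∈ Icc t t', g u = g t) : runMax g q t' = runMax g q t := by
  refine le_antisymm (runMax_le fun s h1 h2 => ?_) (runMax_mono hg q h)
  rcases le_or_gt s (max t q) with h3 | h3
  · exact le_runMax hg h1 h3
  · have hst : t < s := lt_of_le_of_lt (le_max_left _ _) h3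
    have hsq : q < s := lt_of_le_of_lt (le_max_right _ _) h3
    have hst' : s ≤ t' := by
      rcases le_max_iff.1 h2 with h | h
      · exact h
      · linarith
    rw [hc s ⟨hst.le, hst'⟩]
    rcases le_total q t with h4 | h4
    · exact le_runMax hg h4 (le_max_left _ _)
    · rw [hc q ⟨h4, by linarith⟩, dist_self]; exact runMax_nonneg hg _ _

/-- A path with connected fibres traces an arc. -/
lemma isArc_of_monotone (hg : Continuous g) (h01 : g 0 ≠ g 1)
    (hm : ∀ s ∈ Icc (0:ℝ) 1, ∀ t ∈ Icc (0:ℝ) 1, s ≤ t → g s = g t → ∀ u ∈ Icc s t, g u = g s) :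
    IsArc (g '' Icc 0 1) (g 0) (g 1) := by
  classical
  let a := TopologicalSpace.denseSeq ℝ
  let F : ℕ → ℝ → ℝ := fun n t => (1/2 : ℝ) ^ n * min 1 (runMax g (a n) t)
  have hF0 : ∀ n t, 0 ≤ F n t := fun n t =>
    mul_nonneg (by positivity) (le_min zero_le_one (runMax_nonneg hg _ _))
  have hF1 : ∀ n t, ‖F n t‖ ≤ (1/2 : ℝ) ^ n := fun n t => by
    rw [Real.norm_of_nonneg (hF0 n t)]
    exact mul_le_of_le_one_right (by positivity) (min_le_left _ _)
  have hsum : Summable (fun n : ℕ => (1/2 : ℝ) ^ n) := summable_geometric_two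
  have hFs : ∀ t, Summable (fun n => F n t) := fun t => hsum.of_norm_bounded (fun n => hF1 n t)
  let h : ℝ → ℝ := fun t => ∑' n, F n t
  have hcont : Continuous h := continuous_tsum (fun n => by
    have := runMax_cont hg (a n)
    simp only [F]; fun_prop) hsum hF1
  have hmono : ∀ t t', t ≤ t' → h t ≤ h t' := by
    intro t t' htt
    refine (hFs t).tsum_le_tsum (fun n => ?_) (hFs t')
    exact mul_le_mul_of_nonneg_left (min_le_min_left _ (runMax_mono hg _ htt)) (by positivity)
  have hconst : ∀ t ∈ Icc (0:ℝ) 1, ∀ t' ∈ Icc (0:ℝ) 1, t ≤ t' → g t = g t' → h t = h t' := by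
    intro t ht t' ht' htt hgt
    simp only [h, F]
    congr 1; ext n
    rw [runMax_const hg (a n) htt (hm t ht t' ht' htt hgt)]
  have hstrict : ∀ t t', t < t' → g t ≠ g t' → h t < h t' := by
    intro t t' htt hgt
    have hO : IsOpen (Ioo t t' ∩ {q | g q ≠ g t'}) := isOpen_Ioo.inter
      (isOpen_ne_fun hg continuous_const)
    have hN : (Ioo t t' ∩ {q | g q ≠ g t'}).Nonempty := by
      have h1 : {q | g q ≠ g t'} ∈ nhds t := (isOpen_ne_fun hg continuous_const).mem_nhds hgt
      obtain ⟨ε, hε, hεs⟩ := Metric.mem_nhds_iff.1 h1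
      refine ⟨t + min (ε/2) ((t'-t)/2), ⟨?_, ?_⟩, hεs ?_⟩
      · have : 0 < min (ε/2) ((t'-t)/2) := lt_min (by linarith) (by linarith)
        linarith
      · have := min_le_right (ε/2) ((t'-t)/2)
        linarith
      · have h3 : 0 < min (ε/2) ((t'-t)/2) := lt_min (by linarith) (by linarith)
        have := min_le_left (ε/2) ((t'-t)/2)
        rw [Metric.mem_ball, Real.dist_eq, add_sub_cancel_left, abs_of_pos h3]; linarith
    obtain ⟨q, hq, ⟨n, rfl⟩⟩ := (TopologicalSpace.denseRange_denseSeq ℝ).exists_mem_open hO hN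
      |> fun ⟨n, hn⟩ => (⟨a n, hn, n, rfl⟩ : ∃ q, q ∈ Ioo t t' ∩ {q | g q ≠ g t'} ∧ ∃ n, a n = q)
    refine Summable.tsum_lt_tsum (i := n) (fun m => ?_) ?_ (hFs t) (hFs t')
    · exact mul_le_mul_of_nonneg_left (min_le_min_left _ (runMax_mono hg _ htt.le)) (by positivity)
    · have e1 : runMax g (a n) t = 0 :=
        le_antisymm (runMax_zero hq.1.1.le) (runMax_nonneg hg _ _)
      have e2 : 0 < runMax g (a n) t' :=
        lt_of_lt_of_le (dist_pos.2 (Ne.symm hq.2)) (le_runMax hg hq.1.2.le (le_max_left _ _))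
      simp only [F, e1]
      refine mul_lt_mul_of_pos_left ?_ (by positivity)
      rw [min_eq_right zero_le_one]
      exact lt_min one_pos e2
  have hiff : ∀ t ∈ Icc (0:ℝ) 1, ∀ t' ∈ Icc (0:ℝ) 1, (h t = h t' ↔ g t = g t') := by
    intro t ht t' ht'
    constructor
    · intro hh
      by_contra hne
      rcases lt_trichotomy t t' with h1 | h1 | h1
      · exact (hstrict t t' h1 hne).ne hh
      · exact hne (by rw [h1])
      · exact (hstrict t' t h1 (Ne.symm hne)).ne hh.symm
    · intro hgg
      rcases le_total t t' with h1 | h1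
      · exact hconst t ht t' ht' h1 hgg
      · exact (hconst t' ht' t ht h1 hgg.symm).symm
  have hlt : h 0 < h 1 := hstrict 0 1 zero_lt_one h01
  have hsurj : ∀ s ∈ Icc (h 0) (h 1), ∃ t ∈ Icc (0:ℝ) 1, h t = s := fun s hs =>
    intermediate_value_Icc zero_le_one hcont.continuousOn hs
  choose! k hk hhk using hsurj
  let δ : ℝ → ℂ := fun s => g (k s)
  have hmaps : ∀ t ∈ Icc (0:ℝ) 1, h t ∈ Icc (h 0) (h 1) := fun t ht =>
    ⟨hmono _ _ ht.1, hmono _ _ ht.2⟩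
  have hδh : ∀ t ∈ Icc (0:ℝ) 1, δ (h t) = g t := by
    intro t ht
    exact (hiff _ (hk _ (hmaps t ht)) t ht).1 (hhk _ (hmaps t ht))
  have hδc : ContinuousOn δ (Icc (h 0) (h 1)) := by
    rw [continuousOn_iff_isClosed]
    intro t ht
    refine ⟨h '' (Icc 0 1 ∩ g ⁻¹' t), ?_, ?_⟩
    · exact ((isCompact_Icc.inter_right (ht.preimage hg)).image hcont).isClosed
    · ext s; constructor
      · rintro ⟨h1, h2⟩
        exact ⟨⟨k s, ⟨hk s h2, h1⟩, hhk s h2⟩, h2⟩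
      · rintro ⟨⟨u, ⟨hu, hut⟩, rfl⟩, h2⟩
        refine ⟨?_, h2⟩
        show δ (h u) ∈ t
        rw [hδh u hu]; exact hut
  have hδi : InjOn δ (Icc (h 0) (h 1)) := by
    intro s hs t ht hst
    rw [← hhk s hs, ← hhk t ht]
    exact (hiff _ (hk s hs) _ (hk t ht)).2 hst
  have := isArc_of_Icc hlt hδc hδi
  rw [hδh 0 (by simp), hδh 1 (by simp)] at this
  convert this using 1
  ext z; constructor
  · rintro ⟨t, ht, rfl⟩; exact ⟨h t, hmaps t ht, hδh t ht⟩
  · rintro ⟨s, hs, rfl⟩; exact ⟨k s, hk s hs, rfl⟩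

end

/-- Closed sets of parameters whose gaps have equal images at both ends. -/
def GapSet (γ : ℝ → ℂ) (C : Set ℝ) : Prop :=
  IsClosed C ∧ C ⊆ Icc 0 1 ∧ (0:ℝ) ∈ C ∧ (1:ℝ) ∈ C ∧
    ∀ s ∈ C, ∀ t ∈ C, s < t → (∀ u ∈ C, ¬ (s < u ∧ u < t)) → γ s = γ t

lemma gapSet_chain {γ : ℝ → ℂ} (hγ : Continuous γ) (c : Set (Set ℝ)) (hc : ∀ C ∈ c, GapSet γ C)
    (hch : IsChain (· ⊆ ·) c) (hne : c.Nonempty) : GapSet γ (⋂₀ c) := by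
  obtain ⟨C₀, hC₀⟩ := hne
  refine ⟨isClosed_sInter (fun C hC => (hc C hC).1), fun x hx => (hc C₀ hC₀).2.1 (hx C₀ hC₀),
    fun C hC => (hc C hC).2.2.1, fun C hC => (hc C hC).2.2.2.1, ?_⟩
  intro s hs t ht hst hgap
  rw [← dist_le_zero]
  refine le_of_forall_pos_le_add (fun ε hε => ?_)
  obtain ⟨δ₁, hδ₁, h1⟩ := Metric.continuousAt_iff.1 (hγ.continuousAt (x := s)) (ε/2) (by linarith)
  obtain ⟨δ₂, hδ₂, h2⟩ := Metric.continuousAt_iff.1 (hγ.continuousAt (x := t)) (ε/2) (by linarith)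
  let δ := min (min (δ₁/2) (δ₂/2)) ((t - s)/3)
  have hδ0 : 0 < δ := lt_min (lt_min (by linarith) (by linarith)) (by linarith)
  have d1 : δ ≤ δ₁/2 := (min_le_left _ _).trans (min_le_left _ _)
  have d2 : δ ≤ δ₂/2 := (min_le_left _ _).trans (min_le_right _ _)
  have d3 : δ ≤ (t - s)/3 := min_le_right _ _
  obtain ⟨C, hC, hCe⟩ : ∃ C ∈ c, C ∩ Icc (s + δ) (t - δ) = ∅ := by
    by_contra hcon
    push Not at hcon
    have : Nonempty ((fun C => C ∩ Icc (s + δ) (t - δ)) '' c) := ⟨⟨_, C₀, hC₀, rfl⟩⟩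
    obtain ⟨x, hx⟩ := IsCompact.nonempty_sInter_of_directed_nonempty_isCompact_isClosed
      (S := (fun C => C ∩ Icc (s + δ) (t - δ)) '' c) (by
        rintro _ ⟨C, hC, rfl⟩ _ ⟨C', hC', rfl⟩
        rcases hch.total hC hC' with h | h
        · exact ⟨_, ⟨C, hC, rfl⟩, subset_rfl, inter_subset_inter_left _ h⟩
        · exact ⟨_, ⟨C', hC', rfl⟩, inter_subset_inter_left _ h, subset_rfl⟩)
      (by rintro _ ⟨C, hC, rfl⟩; exact hcon C hC)
      (by rintro _ ⟨C, hC, rfl⟩; exact isCompact_Icc.inter_left (hc C hC).1)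
      (by rintro _ ⟨C, hC, rfl⟩; exact (hc C hC).1.inter isClosed_Icc)
    have hx0 := hx _ ⟨C₀, hC₀, rfl⟩
    refine hgap x (fun C hC => (hx _ ⟨C, hC, rfl⟩).1) ⟨?_, ?_⟩
    · linarith [hx0.2.1]
    · linarith [hx0.2.2]
  have hsC := hs C hC
  have htC := ht C hC
  have hCc := (hc C hC).1
  obtain ⟨s', hs', hs'm⟩ := (isCompact_Icc.inter_left hCc : IsCompact (C ∩ Icc s (s + δ))).exists_isGreatest
    ⟨s, hsC, by constructor <;> linarith⟩
  obtain ⟨t', ht', ht'm⟩ := (isCompact_Icc.inter_left hCc : IsCompact (C ∩ Icc (t - δ) t)).exists_isLeast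
    ⟨t, htC, by constructor <;> linarith⟩
  have heq : γ s' = γ t' := by
    refine (hc C hC).2.2.2.2 s' hs'.1 t' ht'.1 (by linarith [hs'.2.2, ht'.2.1]) ?_
    rintro u hu ⟨hu1, hu2⟩
    rcases le_or_gt u (s + δ) with h | h
    · have := hs'm ⟨hu, ⟨by linarith [hs'.2.1], h⟩⟩; linarith
    · rcases le_or_gt (t - δ) u with h' | h'
      · have := ht'm ⟨hu, ⟨h', by linarith [ht'.2.2]⟩⟩; linarith
      · have : u ∈ C ∩ Icc (s + δ) (t - δ) := ⟨hu, h.le, h'.le⟩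
        rw [hCe] at this; exact this
  have e1 : dist (γ s') (γ s) < ε/2 := h1 (by
    rw [Real.dist_eq, abs_lt]; constructor <;> linarith [hs'.2.1, hs'.2.2])
  have e2 : dist (γ t') (γ t) < ε/2 := h2 (by
    rw [Real.dist_eq, abs_lt]; constructor <;> linarith [ht'.2.1, ht'.2.2])
  have := dist_triangle (γ s) (γ s') (γ t)
  rw [dist_comm] at e1
  rw [heq] at this e1
  linarith

/-- A path contains an arc. -/
lemma exists_arc_of_path {γ : ℝ → ℂ} (hγ : Continuous γ) (h01 : γ 0 ≠ γ 1) :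
    ∃ A ⊆ γ '' Icc 0 1, IsArc A (γ 0) (γ 1) := by
  classical
  obtain ⟨C, -, hCmin⟩ := zorn_superset_nonempty {C | GapSet γ C}
    (fun c hc hch hne => ⟨⋂₀ c, gapSet_chain hγ c hc hch hne, fun s hs => sInter_subset_of_mem hs⟩)
    (Icc 0 1) ⟨isClosed_Icc, subset_rfl, by simp, by simp, by
      intro s hs t ht hst hgap
      exfalso
      exact hgap ((s+t)/2) ⟨by linarith [hs.1, ht.1], by linarith [hs.2, ht.2]⟩
        ⟨by linarith, by linarith⟩⟩
  obtain ⟨hCc, hC01, hC0, hC1, hCgap⟩ := hCmin.prop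
  have hinj : ∀ s ∈ C, ∀ t ∈ C, s < t → γ s = γ t → ∀ u ∈ C, ¬ (s < u ∧ u < t) := by
    intro s hs t ht hst hγst u hu ⟨hu1, hu2⟩
    have hG : GapSet γ (C ∩ (Iic s ∪ Ici t)) := by
      refine ⟨hCc.inter (isClosed_Iic.union isClosed_Ici), fun x hx => hC01 hx.1,
        ⟨hC0, Or.inl (hC01 hs).1⟩, ⟨hC1, Or.inr (hC01 ht).2⟩, ?_⟩
      rintro x ⟨hx, hx'⟩ y ⟨hy, hy'⟩ hxy hg
      rcases hx' with hx' | hx' <;> rcases hy' with hy' | hy'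
      · refine hCgap x hx y hy hxy (fun w hw ⟨h1, h2⟩ => hg w ⟨hw, Or.inl ?_⟩ ⟨h1, h2⟩)
        exact h2.le.trans hy'
      · have hxs : x = s := by
          by_contra hne
          exact hg s ⟨hs, Or.inl self_mem_Iic⟩ ⟨lt_of_le_of_ne hx' hne, lt_of_lt_of_le hst hy'⟩
        have hyt : y = t := by
          by_contra hne
          exact hg t ⟨ht, Or.inr self_mem_Ici⟩ ⟨lt_of_le_of_lt hx' hst, lt_of_le_of_ne hy' (Ne.symm hne)⟩
        rw [hxs, hyt, hγst]
      · exact absurd (hx'.trans hxy.le |>.trans hy') (not_le.2 hst)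
      · refine hCgap x hx y hy hxy (fun w hw ⟨h1, h2⟩ => hg w ⟨hw, Or.inr ?_⟩ ⟨h1, h2⟩)
        exact hx'.trans h1.le
    have hle := hCmin.le_of_le hG inter_subset_left hu
    rcases hle.2 with h | h
    · exact absurd h (not_le.2 hu1)
    · exact absurd h (not_le.2 hu2)
  have hρ : ∀ t ∈ Icc (0:ℝ) 1, ∃ r ∈ C, r ≤ t ∧ ∀ u ∈ C, u ≤ t → u ≤ r := by
    intro t ht
    obtain ⟨r, hr, hrm⟩ := (isCompact_Icc.inter_left hCc : IsCompact (C ∩ Icc 0 t)).exists_isGreatest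
      ⟨0, hC0, ⟨le_rfl, ht.1⟩⟩
    exact ⟨r, hr.1, hr.2.2, fun u hu hut => hrm ⟨hu, (hC01 hu).1, hut⟩⟩
  choose! ρ hρC hρle hρmax using hρ
  have hρmono : ∀ s ∈ Icc (0:ℝ) 1, ∀ t ∈ Icc (0:ℝ) 1, s ≤ t → ρ s ≤ ρ t := fun s hs t ht hst =>
    hρmax t ht _ (hρC s hs) ((hρle s hs).trans hst)
  -- modulus of continuity
  have hmod : ∀ s ∈ Icc (0:ℝ) 1, ∀ t ∈ Icc (0:ℝ) 1, s ≤ t → γ (ρ s) = γ (ρ t) ∨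
      ∃ u ∈ Icc s t, ∃ v ∈ Icc s t, γ (ρ s) = γ u ∧ γ (ρ t) = γ v := by
    intro s hs t ht hst
    by_cases hcase : ∃ w ∈ C, s ≤ w ∧ w ≤ t
    · right
      obtain ⟨w, hw, hsw, hwt⟩ := hcase
      obtain ⟨u, hu, hum⟩ := (isCompact_Icc.inter_left hCc : IsCompact (C ∩ Icc s t)).exists_isLeast
        ⟨w, hw, hsw, hwt⟩
      refine ⟨u, hu.2, ρ t, ⟨hsw.trans (hρmax t ht w hw hwt), hρle t ht⟩, ?_, rfl⟩
      have hle : ρ s ≤ u := (hρle s hs).trans hu.2.1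
      rcases hle.eq_or_lt with h | h
      · rw [h]
      · refine hCgap _ (hρC s hs) u hu.1 h ?_
        rintro x hx ⟨hx1, hx2⟩
        rcases le_total x s with h3 | h3
        · exact absurd (hρmax s hs x hx h3) (not_le.2 hx1)
        · exact absurd (hum ⟨hx, h3, hx2.le.trans hu.2.2⟩) (not_le.2 hx2)
    · left
      push Not at hcase
      congr 1
      refine le_antisymm (hρmono s hs t ht hst) ?_
      refine hρmax s hs _ (hρC t ht) ?_
      by_contra h
      exact absurd (hρle t ht) (not_le.2 (hcase _ (hρC t ht) (not_le.1 h).le))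
  have hgc : ContinuousOn (fun t => γ (ρ t)) (Icc 0 1) := by
    have hu : UniformContinuousOn γ (Icc 0 1) :=
      isCompact_Icc.uniformContinuousOn_of_continuous hγ.continuousOn
    rw [Metric.uniformContinuousOn_iff] at hu
    have key : UniformContinuousOn (fun t => γ (ρ t)) (Icc 0 1) := by
      rw [Metric.uniformContinuousOn_iff]
      intro ε hε
      obtain ⟨δ, hδ, h⟩ := hu ε hε
      have aux : ∀ s ∈ Icc (0:ℝ) 1, ∀ t ∈ Icc (0:ℝ) 1, s ≤ t → dist s t < δ →
          dist (γ (ρ s)) (γ (ρ t)) < ε := by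
        intro s hs t ht hst hd
        rcases hmod s hs t ht hst with h1 | ⟨u, hu, v, hv, h1, h2⟩
        · rw [h1, dist_self]; exact hε
        · rw [h1, h2]
          refine h u ⟨hs.1.trans hu.1, hu.2.trans ht.2⟩ v ⟨hs.1.trans hv.1, hv.2.trans ht.2⟩ ?_
          rw [Real.dist_eq, abs_lt] at hd ⊢
          constructor <;> linarith [hu.1, hu.2, hv.1, hv.2]
      refine ⟨δ, hδ, fun s hs t ht hd => ?_⟩
      rcases le_total s t with h | h
      · exact aux s hs t ht h hd
      · rw [dist_comm] at hd ⊢; exact aux t ht s hs h hd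
    exact key.continuousOn
  let g : ℝ → ℂ := fun t => γ (ρ (projIcc (0:ℝ) 1 zero_le_one t))
  have hm01 : ∀ t : ℝ, (projIcc (0:ℝ) 1 zero_le_one t : ℝ) ∈ Icc (0:ℝ) 1 := fun t => Subtype.coe_prop _
  have hg : Continuous g := by
    have := hgc.comp (s := univ) (f := fun t : ℝ => (projIcc (0:ℝ) 1 zero_le_one t : ℝ))
      (continuous_subtype_val.comp continuous_projIcc).continuousOn (fun t _ => hm01 t)
    exact continuousOn_univ.1 this
  have hgv : ∀ t ∈ Icc (0:ℝ) 1, g t = γ (ρ t) := fun t ht => by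
    simp only [g]; rw [projIcc_of_mem _ ht]
  have hρ0 : ρ 0 = 0 := le_antisymm (hρle 0 (by simp)) (hC01 (hρC 0 (by simp))).1
  have hρ1 : ρ 1 = 1 := le_antisymm (hρle 1 (by simp)) (hρmax 1 (by simp) 1 hC1 le_rfl)
  have hg0 : g 0 = γ 0 := by rw [hgv 0 (by simp), hρ0]
  have hg1 : g 1 = γ 1 := by rw [hgv 1 (by simp), hρ1]
  refine ⟨g '' Icc 0 1, ?_, ?_⟩
  · rintro _ ⟨t, ht, rfl⟩
    exact ⟨ρ t, hC01 (hρC t ht), (hgv t ht).symm⟩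
  · rw [← hg0, ← hg1]
    refine isArc_of_monotone hg (by rw [hg0, hg1]; exact h01) ?_
    intro s hs t ht hst hgst u hu
    have hu01 : u ∈ Icc (0:ℝ) 1 := ⟨hs.1.trans hu.1, hu.2.trans ht.2⟩
    rw [hgv s hs, hgv t ht] at hgst
    rw [hgv s hs, hgv u hu01]
    have h1 := hρmono s hs u hu01 hu.1
    have h2 := hρmono u hu01 t ht hu.2
    rcases h1.eq_or_lt with h | h
    · rw [h]
    · rcases h2.eq_or_lt with h' | h'
      · rw [h', hgst]
      · exact absurd ⟨h, h'⟩ (hinj _ (hρC s hs) _ (hρC t ht) (h.trans h') hgst _ (hρC u hu01))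

theorem JoinedIn.exists_arc {S : Set ℂ} {p q : ℂ} (h : JoinedIn S p q) (hne : p ≠ q) :
    ∃ A ⊆ S, IsArc A p q := by
  obtain ⟨γ, hγ⟩ := h
  obtain ⟨A, hA, hA'⟩ := exists_arc_of_path (γ := γ.extend) γ.continuous_extend (by simpa using hne)
  refine ⟨A, ?_, by simpa using hA'⟩
  intro z hz
  obtain ⟨t, ht, rfl⟩ := hA hz
  rw [Path.extend_apply _ ht]
  exact hγ _

end OP

namespace OP

/-- Two arcs with common end points form a Jordan curve. -/
theorem jordan {A B : Set ℂ} {a b : ℂ} (hA : IsArc A a b) (hB : IsArc B a b)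
    (hAB : A ∩ B = {a, b}) :
    ∃ R₁ R₂, Face (A ∪ B) R₁ ∧ Face (A ∪ B) R₂ ∧ R₁ ≠ R₂ ∧
      (∀ F, Face (A ∪ B) F → F = R₁ ∨ F = R₂) ∧ A ∪ B ⊆ closure R₁ ∧ A ∪ B ⊆ closure R₂ := by
  obtain ⟨G, R₁, R₂, hG, -, h1, h2, h12, -, c1, c2, hall, -⟩ := chord hA.isCompact hA.preconn hB hAB
  have hall' : ∀ F, Face (A ∪ B) F → F = R₁ ∨ F = R₂ := by
    intro F hF
    rcases hall F hF with h | h | ⟨h, hne⟩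
    · exact Or.inl h
    · exact Or.inr h
    · exact absurd (arc_face_unique hA h hG) hne
  have hBA : B ∩ A = {a, b} := by rw [inter_comm]; exact hAB
  obtain ⟨G', R₁', R₂', -, -, h1', h2', h12', -, c1', c2', -, -⟩ :=
    chord hB.isCompact hB.preconn hA hBA
  rw [union_comm] at h1' h2'
  have : A ⊆ closure R₁ ∧ A ⊆ closure R₂ := by
    rcases hall' _ h1' with rfl | rfl <;> rcases hall' _ h2' with rfl | rfl
    · exact absurd rfl h12'
    · exact ⟨c1', c2'⟩
    · exact ⟨c2', c1'⟩
    · exact absurd rfl h12'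
  exact ⟨R₁, R₂, h1, h2, h12, hall', union_subset this.1 c1, union_subset this.2 c2⟩

/-- In a theta graph, there is a face whose closure misses the third path, and contains the two
others. -/
lemma theta_aux {A B C : Set ℂ} {a b : ℂ} (hA : IsArc A a b) (hB : IsArc B a b) (hC : IsArc C a b)
    (hAB : A ∩ B = {a, b}) (hAC : A ∩ C = {a, b}) (hBC : B ∩ C = {a, b}) :
    ∃ H, Face (A ∪ B ∪ C) H ∧ A ∪ B ⊆ closure H ∧ Disjoint (closure H) (C \ {a, b}) ∧
      ∃ R₁ R₂, ∀ F, Face (A ∪ B ∪ C) F → F = H ∨ F = R₁ ∨ F = R₂ := by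
  obtain ⟨Q₁, Q₂, q1, q2, q12, qall, k1, k2⟩ := jordan hA hB hAB
  have hK : IsCompact (A ∪ B) := hA.isCompact.union hB.isCompact
  have hKc : IsPreconnected (A ∪ B) := hA.preconn.union a hA.left_mem hB.left_mem hB.preconn
  have hKC : (A ∪ B) ∩ C = {a, b} := by rw [union_inter_distrib_right, hAC, hBC, union_self]
  obtain ⟨G, R₁, R₂, hG, hCG, h1, h2, h12, -, -, -, hall, hall2⟩ := chord hK hKc hC hKC
  have key : ∀ H, Face (A ∪ B) H → H ≠ G → A ∪ B ⊆ closure H →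
      (∀ F, Face (A ∪ B) F → F = H ∨ F = G) →
      ∃ H, Face (A ∪ B ∪ C) H ∧ A ∪ B ⊆ closure H ∧ Disjoint (closure H) (C \ {a, b}) ∧
      ∃ R₁ R₂, ∀ F, Face (A ∪ B ∪ C) F → F = H ∨ F = R₁ ∨ F = R₂ := by
    intro H hH hne hcl hH2
    refine ⟨H, (hall2 H hH hne).1, hcl, ?_, R₁, R₂, ?_⟩
    · refine Disjoint.mono_right hCG ?_
      refine Disjoint.closure_left ?_ (hG.isOpen hK.isClosed)
      rw [disjoint_iff_inter_eq_empty, ← not_nonempty_iff_eq_empty]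
      exact fun h => hne (hH.eq_of hG h)
    · intro F hF
      rcases hall F hF with h | h | ⟨h, hne⟩
      · exact Or.inr (Or.inl h)
      · exact Or.inr (Or.inr h)
      · rcases hH2 F h with h | h
        · exact Or.inl h
        · exact absurd h hne
  rcases qall G hG with rfl | rfl
  · exact key Q₂ q2 (Ne.symm q12) k2 (fun F hF => (qall F hF).symm)
  · exact key Q₁ q1 q12 k1 qall

/-- Theta lemma: a connected set off a theta graph cannot touch all three paths. -/
theorem theta {A B C S : Set ℂ} {a b : ℂ} (hA : IsArc A a b) (hB : IsArc B a b) (hC : IsArc C a b)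
    (hAB : A ∩ B = {a, b}) (hAC : A ∩ C = {a, b}) (hBC : B ∩ C = {a, b})
    (hS : IsPreconnected S) (hSA : Disjoint S A) (hSB : Disjoint S B) (hSC : Disjoint S C)
    (h1 : (closure S ∩ (A \ {a, b})).Nonempty) (h2 : (closure S ∩ (B \ {a, b})).Nonempty)
    (h3 : (closure S ∩ (C \ {a, b})).Nonempty) : False := by
  have hBA : B ∩ A = {a, b} := by rw [inter_comm]; exact hAB
  have hCA : C ∩ A = {a, b} := by rw [inter_comm]; exact hAC
  have hCB : C ∩ B = {a, b} := by rw [inter_comm]; exact hBC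
  obtain ⟨H, hH, c, d, R₁, R₂, hall⟩ := theta_aux hA hB hC hAB hAC hBC
  obtain ⟨H', hH', c', d', -⟩ := theta_aux hA hC hB hAC hAB hCB
  obtain ⟨H'', hH'', c'', d'', -⟩ := theta_aux hB hC hA hBC hBA hCA
  have e1 : A ∪ C ∪ B = A ∪ B ∪ C := by rw [union_assoc, union_comm C, ← union_assoc]
  have e2 : B ∪ C ∪ A = A ∪ B ∪ C := by rw [union_comm, union_assoc]
  rw [e1] at hH'
  rw [e2] at hH''
  have hSne : S.Nonempty := by
    obtain ⟨z, hz, -⟩ := h1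
    exact closure_nonempty_iff.1 ⟨z, hz⟩
  obtain ⟨s, hs⟩ := hSne
  have hSd : Disjoint S (A ∪ B ∪ C) := (hSA.union_right hSB).union_right hSC
  obtain ⟨F, hF, hsF⟩ := face_of_notMem (disjoint_left.1 hSd hs)
  have hSF := hF.subset_of hS hSd ⟨s, hs, hsF⟩
  have hcl := closure_mono hSF
  have n1 : F ≠ H := by
    rintro rfl
    obtain ⟨z, hz, hz'⟩ := h3
    exact disjoint_left.1 d (hcl hz) hz'
  have n2 : F ≠ H' := by
    rintro rfl
    obtain ⟨z, hz, hz'⟩ := h2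
    exact disjoint_left.1 d' (hcl hz) hz'
  have n3 : F ≠ H'' := by
    rintro rfl
    obtain ⟨z, hz, hz'⟩ := h1
    exact disjoint_left.1 d'' (hcl hz) hz'
  have m1 : H ≠ H' := by
    rintro rfl
    obtain ⟨z, hz⟩ := hB.int_nonempty
    exact disjoint_left.1 d' (c (Or.inr hz.1)) hz
  have m2 : H ≠ H'' := by
    rintro rfl
    obtain ⟨z, hz⟩ := hA.int_nonempty
    exact disjoint_left.1 d'' (c (Or.inl hz.1)) hz
  have m3 : H' ≠ H'' := by
    rintro rfl
    obtain ⟨z, hz⟩ := hA.int_nonempty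
    exact disjoint_left.1 d'' (c' (Or.inl hz.1)) hz
  have a1 := hall F hF
  have a2 := hall H' hH'
  have a3 := hall H'' hH''
  grind

/-- Removing finitely many points from the complement of an arc keeps it connected. -/
lemma arc_points_unique {A N : Set ℂ} {a b : ℂ} (hA : IsArc A a b) (hN : N.Finite) :
    ∀ F F', Face (A ∪ N) F → Face (A ∪ N) F' → F = F' := by
  induction N, hN using Set.Finite.induction_on with
  | empty => intro F F' hF hF'; rw [union_empty] at hF hF'; exact arc_face_unique hA hF hF'
  | @insert z N hz hN ih =>
    intro F F' hF hF'
    have e : A ∪ insert z N = (A ∪ N) ∪ {z} := by rw [← union_singleton, union_assoc]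
    rw [e] at hF hF'
    have hK : IsCompact (A ∪ N) := hA.isCompact.union hN.isCompact
    obtain ⟨G, hG, h1⟩ := exists_bigger subset_union_left hF
    obtain ⟨G', hG', h2⟩ := exists_bigger subset_union_left hF'
    obtain rfl := ih _ _ hG hG'
    have hu : ∀ H H', Face {z} H → Face {z} H' → H = H' := by
      intro H H' hH hH'
      have hc : IsPreconnected ({z}ᶜ : Set ℂ) :=
        ((countable_singleton z).isConnected_compl_of_one_lt_rank (by simp)).isPreconnected
      have s1 := hH.subset_of hc disjoint_compl_left (by
        obtain ⟨p, hp⟩ := hH.nonempty; exact ⟨p, hH.subset_compl hp, hp⟩)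
      obtain ⟨p, hp⟩ := hH'.nonempty
      exact hH.eq_of_mem hH' (s1 (hH'.subset_compl hp)) hp
    obtain ⟨H, hH, h3⟩ := exists_bigger subset_union_right hF
    obtain ⟨H', hH', h4⟩ := exists_bigger subset_union_right hF'
    obtain rfl := hu _ _ hH hH'
    exact janiszewski hK isCompact_singleton
      ((subsingleton_singleton.anti inter_subset_right).isPreconnected) hG hH hF hF' h1 h2 h3 h4

lemma point_faces (z : ℂ) : {F | Face {z} F}.Subsingleton := by
  intro H hH H' hH'
  have hc : IsPreconnected ({z}ᶜ : Set ℂ) :=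
    ((countable_singleton z).isConnected_compl_of_one_lt_rank (by simp)).isPreconnected
  have s1 := Face.subset_of hH hc disjoint_compl_left (by
    obtain ⟨p, hp⟩ := Face.nonempty hH; exact ⟨p, Face.subset_compl hH hp, hp⟩)
  obtain ⟨p, hp⟩ := Face.nonempty hH'
  exact Face.eq_of_mem hH hH' (s1 (Face.subset_compl hH' hp)) hp

/-- Number of faces when adding a pendant arc. -/
lemma faces_pendant {K A : Set ℂ} {a b : ℂ} (hK : IsCompact K) (hA : IsArc A a b)
    (hAK : (K ∩ A).Subsingleton) (hf : {F | Face K F}.Finite) :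
    {F | Face (K ∪ A) F}.Finite ∧ {F | Face (K ∪ A) F}.ncard ≤ {F | Face K F}.ncard := by
  have : ∀ F : Set ℂ, ∃ G, Face (K ∪ A) F → Face K G ∧ F ⊆ G := by
    intro F
    by_cases hF : Face (K ∪ A) F
    · obtain ⟨G, hG⟩ := exists_bigger subset_union_left hF
      exact ⟨G, fun _ => hG⟩
    · exact ⟨∅, fun h => absurd h hF⟩
  choose g hg using this
  have hm : MapsTo g {F | Face (K ∪ A) F} {F | Face K F} := fun F hF => (hg F hF).1
  have hi : InjOn g {F | Face (K ∪ A) F} := by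
    intro F hF F' hF' h
    exact pendant hK hA hAK (hg F hF).1 hF hF' (hg F hF).2 (by rw [h]; exact (hg F' hF').2)
  exact ⟨Finite.of_injOn hm hi hf, ncard_le_ncard_of_injOn g hm hi hf⟩

lemma faces_chord {K A : Set ℂ} {a b : ℂ} (hK : IsCompact K) (hKc : IsPreconnected K)
    (hA : IsArc A a b) (hAK : K ∩ A = {a, b}) (hf : {F | Face K F}.Finite) :
    {F | Face (K ∪ A) F}.Finite ∧ {F | Face (K ∪ A) F}.ncard ≤ {F | Face K F}.ncard + 1 := by
  obtain ⟨G, R₁, R₂, hG, -, -, -, -, -, -, -, hall, -⟩ := chord hK hKc hA hAK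
  have hsub : {F | Face (K ∪ A) F} ⊆ insert R₁ (insert R₂ ({F | Face K F} \ {G})) := by
    intro F hF
    rcases hall F hF with h | h | ⟨h, h'⟩
    · exact Or.inl h
    · exact Or.inr (Or.inl h)
    · exact Or.inr (Or.inr ⟨h, h'⟩)
  have hfin : (insert R₁ (insert R₂ ({F | Face K F} \ {G}))).Finite := ((hf.subset sdiff_subset).insert _).insert _
  refine ⟨hfin.subset hsub, (ncard_le_ncard hsub hfin).trans ?_⟩
  have h1 := ncard_insert_le R₁ (insert R₂ ({F | Face K F} \ {G}))
  have h2 := ncard_insert_le R₂ ({F | Face K F} \ {G})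
  have h3 := ncard_sdiff_singleton_add_one (s := {F | Face K F}) (a := G) hG hf
  omega

end OP

namespace OP

/-- A finite system of arcs with end points in `N`, meeting only in end points. -/
structure ArcSys (N : Set ℂ) (S : Set (Set ℂ)) : Prop where
  finN : N.Finite
  finS : S.Finite
  arc : ∀ s ∈ S, ∃ a b, IsArc s a b ∧ s ∩ N = {a, b}
  disj : ∀ s ∈ S, ∀ t ∈ S, s ≠ t → s ∩ t ⊆ N

namespace ArcSys

variable {N : Set ℂ} {S : Set (Set ℂ)}

lemma subsys (h : ArcSys N S) {E : Set (Set ℂ)} (hE : E ⊆ S) : ArcSys N E :=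
  ⟨h.finN, h.finS.subset hE, fun s hs => h.arc s (hE hs), fun s hs t ht => h.disj s (hE hs) t (hE ht)⟩

lemma isCompact_sUnion (h : ArcSys N S) : IsCompact (⋃₀ S) := by
  refine h.finS.isCompact_sUnion (fun s hs => ?_)
  obtain ⟨a, b, hs, -⟩ := h.arc s hs
  exact hs.isCompact

lemma isCompact (h : ArcSys N S) {M : Set ℂ} (hM : M ⊆ N) {E : Set (Set ℂ)} (hE : E ⊆ S) :
    IsCompact (M ∪ ⋃₀ E) :=
  (h.finN.subset hM).isCompact.union (h.subsys hE).isCompact_sUnion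

lemma inter_eq (h : ArcSys N S) {M : Set ℂ} (hM : M ⊆ N) {E : Set (Set ℂ)} (hE : E ⊆ S)
    (hEM : ∀ s ∈ E, s ∩ N ⊆ M) {s : Set ℂ} (hs : s ∈ S) (hsE : s ∉ E) :
    (M ∪ ⋃₀ E) ∩ s = M ∩ s := by
  ext z; constructor
  · rintro ⟨hz | ⟨t, ht, hz⟩, hzs⟩
    · exact ⟨hz, hzs⟩
    · have : z ∈ N := h.disj t (hE ht) s hs (fun e => hsE (e ▸ ht)) ⟨hz, hzs⟩
      exact ⟨hEM t ht ⟨hz, this⟩, hzs⟩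
  · rintro ⟨hz, hzs⟩
    exact ⟨Or.inl hz, hzs⟩

lemma euler_aux (h : ArcSys N S) (hc : IsPreconnected (N ∪ ⋃₀ S)) :
    ∀ (k : ℕ) (M : Set ℂ) (E : Set (Set ℂ)), M ⊆ N → E ⊆ S → M.Nonempty →
      (∀ s ∈ E, s ∩ N ⊆ M) → IsPreconnected (M ∪ ⋃₀ E) → {F | Face (M ∪ ⋃₀ E) F}.Finite →
      {F | Face (M ∪ ⋃₀ E) F}.ncard + M.ncard ≤ E.ncard + 2 →
      (N \ M).ncard + (S \ E).ncard = k →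
      {F | Face (N ∪ ⋃₀ S) F}.Finite ∧
        {F | Face (N ∪ ⋃₀ S) F}.ncard + N.ncard ≤ S.ncard + 2 := by
  intro k
  induction k using Nat.strong_induction_on with
  | _ k ih =>
  intro M E hM hE hMne hEM hpre hfin hle hk
  have hcompE : ∀ s ∈ S, s ∉ E → (S \ insert s E).ncard < (S \ E).ncard := by
    intro s hs hsE
    refine ncard_lt_ncard ⟨sdiff_subset_sdiff_right (subset_insert _ _), fun hsub => ?_⟩ (h.finS.subset sdiff_subset)
    exact (hsub ⟨hs, hsE⟩).2 (mem_insert _ _)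
  have hEfin : E.Finite := h.finS.subset hE
  have hMfin : M.Finite := h.finN.subset hM
  have hK := h.isCompact hM hE
  by_cases h1 : ∃ s ∈ S, s ∉ E ∧ (M ∩ s).Nonempty
  · obtain ⟨s, hs, hsE, hne⟩ := h1
    obtain ⟨a, b, hab, hsN⟩ := h.arc s hs
    have hinter := h.inter_eq hM hE hEM hs hsE
    have hEi : insert s E ⊆ S := insert_subset hs hE
    have hcE := ncard_insert_of_notMem hsE hEfin
    by_cases h2 : s ∩ N ⊆ M
    · -- chord
      have hMs : M ∩ s = {a, b} := by
        rw [← hsN]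
        exact Subset.antisymm (fun z hz => ⟨hz.2, hM hz.1⟩) (fun z hz => ⟨h2 hz, hz.1⟩)
      have e : M ∪ ⋃₀ insert s E = (M ∪ ⋃₀ E) ∪ s := by
        rw [sUnion_insert, union_comm s, union_assoc]
      obtain ⟨f1, f2⟩ := faces_chord hK hpre hab (hinter.trans hMs) hfin
      have hE' : ∀ t ∈ insert s E, t ∩ N ⊆ M := by
        rintro t (rfl | ht)
        · exact h2
        · exact hEM t ht
      refine ih _ ?_ M (insert s E) hM hEi hMne hE' ?_ ?_ ?_ rfl
      · have := hcompE s hs hsE; omega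
      · rw [e]
        obtain ⟨z, hz⟩ := hne
        exact hpre.union z (Or.inl hz.1) hz.2 hab.preconn
      · rw [e]; exact f1
      · rw [e]; omega
    · -- pendant
      have hMs : (M ∩ s).Subsingleton := by
        obtain ⟨w, hw, hwM⟩ := not_subset.1 h2
        have hw' : w ∈ s ∩ N := hw
        rw [hsN] at hw
        have : ∀ z ∈ M ∩ s, (z = a ∨ z = b) ∧ z ≠ w := fun z hz => by
          refine ⟨?_, fun e => hwM (e ▸ hz.1)⟩
          have : z ∈ s ∩ N := ⟨hz.2, hM hz.1⟩
          rwa [hsN] at this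
        intro z hz z' hz'
        have q1 := this z hz
        have q2 := this z' hz'
        have q3 : w = a ∨ w = b := hw
        grind
      obtain ⟨w, hw, hwM⟩ := not_subset.1 h2
      have hMsN : s ∩ N ⊆ insert w M := by
        obtain ⟨m, hm⟩ := hne
        have q1 : m = a ∨ m = b := by
          have : m ∈ s ∩ N := ⟨hm.2, hM hm.1⟩
          rwa [hsN] at this
        have q3 : w = a ∨ w = b := by rwa [hsN] at hw
        intro z hz
        have q2 : z = a ∨ z = b := by rwa [hsN] at hz
        have : m ≠ w := fun e => hwM (e ▸ hm.1)
        have : z = w ∨ z = m := by grind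
        rcases this with rfl | rfl
        · exact Or.inl rfl
        · exact Or.inr hm.1
      have e : insert w M ∪ ⋃₀ insert s E = (M ∪ ⋃₀ E) ∪ s := by
        rw [sUnion_insert, insert_union, union_comm s, ← union_assoc]
        exact insert_eq_of_mem (Or.inr hw.1)
      obtain ⟨f1, f2⟩ := faces_pendant hK hab (by rw [hinter]; exact hMs) hfin
      have hE' : ∀ t ∈ insert s E, t ∩ N ⊆ insert w M := by
        rintro t (rfl | ht)
        · exact hMsN
        · exact (hEM t ht).trans (subset_insert _ _)
      have hcM := ncard_insert_of_notMem hwM hMfin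
      refine ih _ ?_ (insert w M) (insert s E) (insert_subset hw.2 hM) hEi (insert_nonempty _ _) hE' ?_ ?_ ?_ rfl
      · have := hcompE s hs hsE
        have : (N \ insert w M).ncard ≤ (N \ M).ncard :=
          ncard_le_ncard (sdiff_subset_sdiff_right (subset_insert _ _)) (h.finN.subset sdiff_subset)
        omega
      · rw [e]
        obtain ⟨z, hz⟩ := hne
        exact hpre.union z (Or.inl hz.1) hz.2 hab.preconn
      · rw [e]; exact f1
      · rw [e]; omega
  · push Not at h1
    have hrest : IsClosed ((N \ M) ∪ ⋃₀ (S \ E)) := (h.isCompact sdiff_subset sdiff_subset).isClosed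
    have hdis : Disjoint (M ∪ ⋃₀ E) ((N \ M) ∪ ⋃₀ (S \ E)) := by
      rw [disjoint_left]
      rintro z hz (hz' | ⟨t, ht, hz'⟩)
      · rcases hz with hz | ⟨s, hs, hz⟩
        · exact hz'.2 hz
        · exact hz'.2 (hEM s hs ⟨hz, hz'.1⟩)
      · have hm : z ∈ (M ∪ ⋃₀ E) ∩ t := ⟨hz, hz'⟩
        rw [h.inter_eq hM hE hEM ht.1 ht.2, h1 t ht.1 ht.2] at hm
        exact hm
    have hcov : N ∪ ⋃₀ S ⊆ (M ∪ ⋃₀ E) ∪ ((N \ M) ∪ ⋃₀ (S \ E)) := by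
      rintro z (hz | ⟨t, ht, hz⟩)
      · by_cases hzM : z ∈ M
        · exact Or.inl (Or.inl hzM)
        · exact Or.inr (Or.inl ⟨hz, hzM⟩)
      · by_cases htE : t ∈ E
        · exact Or.inl (Or.inr ⟨t, htE, hz⟩)
        · exact Or.inr (Or.inr ⟨t, ⟨ht, htE⟩, hz⟩)
    have hempty : ¬ ((N \ M) ∪ ⋃₀ (S \ E)).Nonempty := by
      rintro ⟨z, hz⟩
      obtain ⟨m, hm⟩ := hMne
      obtain ⟨y, -, hy1, hy2⟩ := isPreconnected_closed_iff.1 hc _ _ hK.isClosed hrest hcov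
        ⟨m, Or.inl (hM hm), Or.inl hm⟩ ⟨z, by
          rcases hz with hz | ⟨t, ht, hz⟩
          · exact Or.inl hz.1
          · exact Or.inr ⟨t, ht.1, hz⟩, hz⟩
      exact disjoint_left.1 hdis hy1 hy2
    rw [not_nonempty_iff_eq_empty, union_empty_iff] at hempty
    have hMN : M = N := Subset.antisymm hM (sdiff_eq_empty.1 hempty.1)
    have hES : E = S := by
      refine Subset.antisymm hE (fun t ht => ?_)
      by_contra htE
      obtain ⟨a, b, hab, -⟩ := h.arc t ht
      have : a ∈ ⋃₀ (S \ E) := ⟨t, ⟨ht, htE⟩, hab.left_mem⟩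
      rw [hempty.2] at this
      exact this
    subst hMN hES
    exact ⟨hfin, hle⟩

theorem euler (h : ArcSys N S) (hne : N.Nonempty) (hc : IsPreconnected (N ∪ ⋃₀ S)) :
    {F | Face (N ∪ ⋃₀ S) F}.Finite ∧
        {F | Face (N ∪ ⋃₀ S) F}.ncard + N.ncard ≤ S.ncard + 2 := by
  obtain ⟨p, hp⟩ := hne
  have e : ({p} : Set ℂ) ∪ ⋃₀ ∅ = {p} := by simp
  refine h.euler_aux hc _ {p} ∅ (singleton_subset_iff.2 hp) (empty_subset _) (singleton_nonempty p)
    (by simp) ?_ ?_ ?_ rfl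
  · rw [e]; exact isPreconnected_singleton
  · rw [e]; exact (point_faces p).finite
  · rw [e, ncard_singleton, ncard_empty]
    have : {F | Face {p} F}.ncard ≤ 1 :=
      haveI := (point_faces p).finite.to_subtype
      ncard_le_one_iff_subsingleton.2 (point_faces p)
    omega

/-- The removal of any open segment keeps everything connected. -/
structure Tame (N : Set ℂ) (S : Set (Set ℂ)) : Prop extends ArcSys N S where
  ne : N.Nonempty
  conn : IsPreconnected (N ∪ ⋃₀ S)
  conn2 : ∀ s ∈ S, IsPreconnected (N ∪ ⋃₀ (S \ {s}))

lemma Tame.two_faces (h : Tame N S) {s : Set ℂ} (hs : s ∈ S) :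
    ∃ F₁ F₂, Face (N ∪ ⋃₀ S) F₁ ∧ Face (N ∪ ⋃₀ S) F₂ ∧ F₁ ≠ F₂ ∧ s ⊆ closure F₁ ∧ s ⊆ closure F₂ ∧
      ∀ F, Face (N ∪ ⋃₀ S) F → (closure F ∩ (s \ N)).Nonempty → F = F₁ ∨ F = F₂ := by
  obtain ⟨a, b, hab, hsN⟩ := h.arc s hs
  have hK := h.isCompact (subset_refl N) (sdiff_subset : S \ {s} ⊆ S)
  have hinter : (N ∪ ⋃₀ (S \ {s})) ∩ s = {a, b} := by
    rw [h.inter_eq (subset_refl N) (sdiff_subset : S \ {s} ⊆ S) (fun t _ => inter_subset_right) hs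
      (by simp), inter_comm, hsN]
  obtain ⟨G, R₁, R₂, hG, hAG, h1, h2, h12, -, c1, c2, hall, -⟩ := chord hK (h.conn2 s hs) hab hinter
  have e : N ∪ ⋃₀ (S \ {s}) ∪ s = N ∪ ⋃₀ S := by
    rw [union_assoc, union_comm _ s, ← sUnion_insert, insert_sdiff_singleton, insert_eq_of_mem hs]
  rw [e] at h1 h2 hall
  refine ⟨R₁, R₂, h1, h2, h12, c1, c2, fun F hF hne => ?_⟩
  rcases hall F hF with h | h | ⟨h, hne'⟩
  · exact Or.inl h
  · exact Or.inr h
  · exfalso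
    obtain ⟨z, hz, hzs, hzN⟩ := hne
    have hzG : z ∈ G := hAG ⟨hzs, fun hz' => hzN (by rw [← hsN] at hz'; exact hz'.2)⟩
    obtain ⟨y, hy1, hy2⟩ := mem_closure_iff.1 hz G (hG.isOpen hK.isClosed) hzG
    exact hne' (h.eq_of_mem hG hy2 hy1)

/-- All or nothing. -/
lemma Tame.inc_iff (h : Tame N S) {s F : Set ℂ} (hs : s ∈ S) (hF : Face (N ∪ ⋃₀ S) F)
    (hne : (closure F ∩ (s \ N)).Nonempty) : s ⊆ closure F := by
  obtain ⟨F₁, F₂, -, -, -, c1, c2, hall⟩ := h.two_faces hs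
  rcases hall F hF hne with rfl | rfl
  · exact c1
  · exact c2

lemma int_nonempty (h : ArcSys N S) {s : Set ℂ} (hs : s ∈ S) : (s \ N).Nonempty := by
  obtain ⟨a, b, hab, hsN⟩ := h.arc s hs
  obtain ⟨z, hz, hz'⟩ := hab.int_nonempty
  exact ⟨z, hz, fun hzN => hz' (by rw [← hsN]; exact ⟨hz, hzN⟩)⟩

lemma Tame.nonempty_of_inc (h : Tame N S) {s F : Set ℂ} (hs : s ∈ S) (hF : s ⊆ closure F) :
    (closure F ∩ (s \ N)).Nonempty := by
  obtain ⟨z, hz⟩ := h.int_nonempty hs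
  exact ⟨z, hF hz.1, hz⟩

/-- Two distinct faces at a segment are the only ones. -/
lemma Tame.only_two (h : Tame N S) {s F F' F'' : Set ℂ} (hs : s ∈ S) (hF : Face (N ∪ ⋃₀ S) F)
    (hF' : Face (N ∪ ⋃₀ S) F') (hF'' : Face (N ∪ ⋃₀ S) F'') (h1 : s ⊆ closure F)
    (h2 : s ⊆ closure F') (h3 : s ⊆ closure F'') (hne : F ≠ F') : F'' = F ∨ F'' = F' := by
  obtain ⟨F₁, F₂, -, -, -, c1, c2, hall⟩ := h.two_faces hs
  have a1 := hall F hF (h.nonempty_of_inc hs h1)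
  have a2 := hall F' hF' (h.nonempty_of_inc hs h2)
  have a3 := hall F'' hF'' (h.nonempty_of_inc hs h3)
  grind

lemma Tame.other (h : Tame N S) {s F : Set ℂ} (hs : s ∈ S) :
    ∃ F', Face (N ∪ ⋃₀ S) F' ∧ F' ≠ F ∧ s ⊆ closure F' := by
  obtain ⟨F₁, F₂, h1, h2, h12, c1, c2, hall⟩ := h.two_faces hs
  by_cases e : F₁ = F
  · exact ⟨F₂, h2, fun e' => h12 (e.trans e'.symm), c2⟩
  · exact ⟨F₁, h1, e, c1⟩

lemma Tame.finite_faces (h : Tame N S) : {F | Face (N ∪ ⋃₀ S) F}.Finite := (h.euler h.ne h.conn).1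

lemma isClosed (h : ArcSys N S) : IsClosed (N ∪ ⋃₀ S) :=
  (h.isCompact (subset_refl _) (subset_refl _)).isClosed

lemma Tame.dc_open (h : Tame N S) (W : Set (Set ℂ))
    (hcl : ∀ F ∈ W, ∀ s ∈ S, s ⊆ closure F → ∀ F', Face (N ∪ ⋃₀ S) F' → s ⊆ closure F' → F' ∈ W)
    (hWf : ∀ F ∈ W, Face (N ∪ ⋃₀ S) F) :
    IsOpen (⋃₀ W ∪ {z | z ∉ N ∧ ∃ s ∈ S, z ∈ s ∧ ∃ F ∈ W, s ⊆ closure F}) := by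
  rw [isOpen_iff_mem_nhds]
  rintro z (⟨F, hF, hz⟩ | ⟨hzN, s, hs, hzs, F, hF, hsF⟩)
  · exact Filter.mem_of_superset (((hWf F hF).isOpen h.isClosed).mem_nhds hz)
      (fun y hy => Or.inl ⟨F, hF, hy⟩)
  · have u1 : (N ∪ ⋃₀ (S \ {s}))ᶜ ∈ nhds z := by
      refine ((h.isCompact (subset_refl N) (sdiff_subset : S \ {s} ⊆ S)).isClosed.isOpen_compl).mem_nhds ?_
      rintro (hz | ⟨t, ht, hzt⟩)
      · exact hzN hz
      · exact hzN (h.disj t ht.1 s hs ht.2 ⟨hzt, hzs⟩)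
    have hfin : {F | Face (N ∪ ⋃₀ S) F ∧ z ∉ closure F}.Finite :=
      h.finite_faces.subset (fun F hF => hF.1)
    have u2 : (⋃ F ∈ {F | Face (N ∪ ⋃₀ S) F ∧ z ∉ closure F}, closure F)ᶜ ∈ nhds z := by
      refine (hfin.isClosed_biUnion (fun F _ => isClosed_closure)).isOpen_compl.mem_nhds ?_
      simp only [mem_compl_iff, mem_iUnion, not_exists]
      exact fun F hF => hF.2
    filter_upwards [u1, u2] with y hy1 hy2
    by_cases hys : y ∈ s
    · exact Or.inr ⟨fun hyN => hy1 (Or.inl hyN), s, hs, hys, F, hF, hsF⟩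
    · have hyX : y ∉ N ∪ ⋃₀ S := by
        rintro (hy | ⟨t, ht, hyt⟩)
        · exact hy1 (Or.inl hy)
        · exact hy1 (Or.inr ⟨t, ⟨ht, fun e => hys (e ▸ hyt)⟩, hyt⟩)
      obtain ⟨F', hF', hyF'⟩ := face_of_notMem hyX
      have hzF' : z ∈ closure F' := by
        by_contra hcon
        exact hy2 (mem_biUnion (⟨hF', hcon⟩ : F' ∈ {F | Face (N ∪ ⋃₀ S) F ∧ z ∉ closure F})
          (subset_closure hyF'))
      exact Or.inl ⟨F', hcl F hF s hs hsF F' hF' (h.inc_iff hs hF' ⟨z, hzF', hzs, hzN⟩), hyF'⟩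

/-- Dual connectivity. -/
theorem Tame.dual_conn (h : Tame N S) (W : Set (Set ℂ)) (hne : W.Nonempty)
    (hWf : ∀ F ∈ W, Face (N ∪ ⋃₀ S) F)
    (hcl : ∀ F ∈ W, ∀ s ∈ S, s ⊆ closure F → ∀ F', Face (N ∪ ⋃₀ S) F' → s ⊆ closure F' → F' ∈ W) :
    ∀ F, Face (N ∪ ⋃₀ S) F → F ∈ W := by
  intro F hF
  by_contra hFW
  have o1 := h.dc_open W hcl hWf
  have o2 := h.dc_open {F | Face (N ∪ ⋃₀ S) F ∧ F ∉ W} (fun F hF s hs hsF F' hF' hsF' =>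
    ⟨hF', fun hW => hF.2 (hcl F' hW s hs hsF' F hF.1 hsF)⟩) (fun F hF => hF.1)
  have hc : IsPreconnected (Nᶜ : Set ℂ) :=
    (h.finN.countable.isConnected_compl_of_one_lt_rank (by simp)).isPreconnected
  have hFN : ∀ F, Face (N ∪ ⋃₀ S) F → ∀ p ∈ F, p ∈ Nᶜ := fun F hF p hp hpN =>
    disjoint_left.1 hF.disj hp (Or.inl hpN)
  obtain ⟨y, hyN, hy1, hy2⟩ := hc _ _ o1 o2 (by
    intro z hz
    by_cases hzS : ∃ s ∈ S, z ∈ s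
    · obtain ⟨s, hs, hzs⟩ := hzS
      obtain ⟨F₁, -, h1, -, -, c1, -, -⟩ := h.two_faces hs
      by_cases h1W : F₁ ∈ W
      · exact Or.inl (Or.inr ⟨hz, s, hs, hzs, F₁, h1W, c1⟩)
      · exact Or.inr (Or.inr ⟨hz, s, hs, hzs, F₁, ⟨h1, h1W⟩, c1⟩)
    · obtain ⟨F₁, h1, hz1⟩ := face_of_notMem (show z ∉ N ∪ ⋃₀ S from by
        rintro (h | ⟨s, hs, h⟩)
        · exact hz h
        · exact hzS ⟨s, hs, h⟩)
      by_cases h1W : F₁ ∈ W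
      · exact Or.inl (Or.inl ⟨F₁, h1W, hz1⟩)
      · exact Or.inr (Or.inl ⟨F₁, ⟨h1, h1W⟩, hz1⟩)) (by
    obtain ⟨F₀, h0⟩ := hne
    obtain ⟨p, hp⟩ := (hWf _ h0).nonempty
    exact ⟨p, hFN _ (hWf _ h0) p hp, Or.inl ⟨F₀, h0, hp⟩⟩) (by
    obtain ⟨p, hp⟩ := hF.nonempty
    exact ⟨p, hFN _ hF p hp, Or.inl ⟨F, ⟨hF, hFW⟩, hp⟩⟩)
  rcases hy1 with ⟨F₁, h1, hy1⟩ | ⟨-, s, hs, hys, F₁, h1, hs1⟩ <;>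
    rcases hy2 with ⟨F₂, h2, hy2⟩ | ⟨-, t, ht, hyt, F₂, h2, ht2⟩
  · exact h2.2 ((hWf _ h1).eq_of_mem h2.1 hy1 hy2 ▸ h1)
  · exact disjoint_left.1 (hWf _ h1).disj hy1 (Or.inr ⟨t, ht, hyt⟩)
  · exact disjoint_left.1 h2.1.disj hy2 (Or.inr ⟨s, hs, hys⟩)
  · by_cases e : s = t
    · subst e
      exact h2.2 (hcl F₁ h1 s hs hs1 F₂ h2.1 ht2)
    · exact hyN (h.disj s hs t ht e ⟨hys, hyt⟩)

/-- A face is incident with at least two segments. -/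
theorem Tame.two_segs (h : Tame N S) {s F : Set ℂ} (hs : s ∈ S) (hF : Face (N ∪ ⋃₀ S) F)
    (hsF : ∀ t ∈ S, t ⊆ closure F → t = s) : False := by
  obtain ⟨a, b, hab, hsN⟩ := h.arc s hs
  obtain ⟨F₁, hF₁, hne, -⟩ := h.other (F := F) hs
  have hcl : closure F ⊆ F ∪ (s ∪ N) := by
    intro z hz
    rcases hF.closure_subset h.isClosed hz with hz' | hz' | ⟨t, ht, hzt⟩
    · exact Or.inl hz'
    · exact Or.inr (Or.inr hz')
    · by_cases hzN : z ∈ N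
      · exact Or.inr (Or.inr hzN)
      · obtain rfl := hsF t ht (h.inc_iff ht hF ⟨z, hz, hzt, hzN⟩)
        exact Or.inr (Or.inl hzt)
  have hsub : s ∪ N ⊆ N ∪ ⋃₀ S := by
    rintro z (hz | hz)
    · exact Or.inr ⟨s, hs, hz⟩
    · exact Or.inl hz
  have f1 : Face (s ∪ N) F := face_of (hF.isOpen h.isClosed) hF.preconn hF.nonempty
    (hF.disj.mono_right hsub) hcl
  obtain ⟨G, hG, hG1⟩ := exists_bigger hsub hF₁
  obtain rfl := arc_points_unique hab h.finN _ _ hG f1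
  obtain ⟨p, hp⟩ := hF₁.nonempty
  exact hne (hF₁.eq_of_mem hF hp (hG1 hp))

end ArcSys

end OP

namespace OP

lemma inf_concat {p : ℕ → ℂ} {y : ℂ} {C : ℕ → Set ℂ} {T : Set ℂ} {ε : ℕ → ℝ}
    (hj : ∀ k, JoinedIn (C k) (p k) (p (k + 1))) (hT : ∀ k, C k ⊆ T)
    (hb : ∀ k, C k ⊆ Metric.ball y (ε k)) (hanti : Antitone ε)
    (hε : ∀ η > 0, ∃ k, ε k < η) : JoinedIn (T ∪ {y}) (p 0) y := by
  let γ : ℕ → ℝ → ℂ := fun k => (hj k).somePath.extend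
  have hγc : ∀ k, Continuous (γ k) := fun k => (hj k).somePath.continuous_extend
  have hγ0 : ∀ k t, t ≤ 0 → γ k t = p k := fun k t ht => Path.extend_of_le_zero _ ht
  have hγ1 : ∀ k t, 1 ≤ t → γ k t = p (k + 1) := fun k t ht => Path.extend_of_one_le _ ht
  have hγm : ∀ k t, t ∈ Icc (0:ℝ) 1 → γ k t ∈ C k := by
    intro k t ht
    have : γ k t = (hj k).somePath ⟨t, ht⟩ := Path.extend_apply _ ht
    rw [this]
    exact (hj k).somePath_mem _
  let g : ℕ → ℝ → ℂ := fun n t => p 0 + ∑ k ∈ Finset.range n, (γ k (t - k) - p k)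
  have hgc : ∀ n, Continuous (g n) := by
    intro n
    refine continuous_const.add (continuous_finsetSum _ (fun k _ => ?_))
    exact ((hγc k).comp (by fun_prop)).sub continuous_const
  have hgs : ∀ (n : ℕ) (t : ℝ), t ≤ n → g (n + 1) t = g n t := by
    intro n t ht
    simp only [g]
    rw [Finset.sum_range_succ, hγ0 n _ (by linarith), sub_self, add_zero]
  have hgm : ∀ (n m : ℕ) (t : ℝ), n ≤ m → t ≤ n → g m t = g n t := by
    intro n m t hnm ht
    induction m, hnm using Nat.le_induction with
    | base => rfl
    | succ m hm ih =>
      rw [hgs m t (ht.trans (by exact_mod_cast hm)), ih]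
  have hgp : ∀ (n : ℕ) (t : ℝ), (n : ℝ) ≤ t → g n t = p n := by
    intro n
    induction n with
    | zero => intro t _; simp [g]
    | succ n ih =>
      intro t ht
      push_cast at ht
      have := ih t (by linarith)
      simp only [g] at this ⊢
      rw [Finset.sum_range_succ, ← add_assoc, this, hγ1 n _ (by linarith)]
      ring
  have hgk : ∀ (k : ℕ) (t : ℝ), (k : ℝ) ≤ t → t ≤ k + 1 → g (k + 1) t ∈ C k := by
    intro k t h1 h2
    have := hgp k t h1
    simp only [g] at this ⊢
    rw [Finset.sum_range_succ, ← add_assoc, this, add_sub_cancel]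
    exact hγm k _ ⟨by linarith, by linarith⟩
  let G : ℝ → ℂ := fun t => g ⌈t⌉₊ t
  have hGn : ∀ (n : ℕ) (t : ℝ), t ≤ n → G t = g n t := by
    intro n t ht
    exact (hgm ⌈t⌉₊ n t (Nat.ceil_le.2 ht) (Nat.le_ceil t)).symm
  have hGc : Continuous G := by
    rw [continuous_iff_continuousAt]
    intro t
    obtain ⟨n, hn⟩ := exists_nat_gt t
    refine (hgc n).continuousAt.congr ?_
    filter_upwards [Iio_mem_nhds hn] with s hs
    exact (hGn n s (le_of_lt hs)).symm
  have hGm : ∀ t, 0 ≤ t → G t ∈ C ⌊t⌋₊ := by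
    intro t ht
    rw [hGn (⌊t⌋₊ + 1) t (by push_cast; exact (Nat.lt_floor_add_one t).le)]
    exact hgk _ t (Nat.floor_le ht) (Nat.lt_floor_add_one t).le
  have hG0 : G 0 = p 0 := by
    rw [hGn 0 0 (by simp)]; exact hgp 0 0 (by simp)
  let h : ℝ → ℂ := fun s => if s ≤ 0 then y else G (1 / s - 1)
  have h0 : h 0 = y := by simp [h]
  have h1 : h 1 = p 0 := by simp [h, hG0]
  have hpos : ∀ s, 0 < s → h s = G (1 / s - 1) := fun s hs => by simp [h, hs]
  have hmem : ∀ s, 0 < s → s ≤ 1 → h s ∈ C ⌊1 / s - 1⌋₊ := by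
    intro s hs hs1
    rw [hpos s hs]
    refine hGm _ ?_
    have : 1 ≤ 1 / s := by rw [le_div_iff₀ hs]; linarith
    linarith
  refine JoinedIn.symm ?_
  refine JoinedIn.ofLine (f := h) ?_ h0 h1 ?_
  · intro s hs
    rcases hs.1.eq_or_lt with rfl | hs0
    · rw [Metric.continuousWithinAt_iff]
      intro η hη
      obtain ⟨k, hk⟩ := hε η hη
      refine ⟨1 / (k + 1), by positivity, ?_⟩
      intro s hs hd
      rw [h0]
      rcases hs.1.eq_or_lt with rfl | hs0
      · rw [h0, dist_self]; exact hη
      · rw [Real.dist_eq, sub_zero, abs_of_pos hs0] at hd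
        have hk' : k ≤ ⌊1 / s - 1⌋₊ := by
          refine Nat.le_floor ?_
          have : (k + 1 : ℝ) < 1 / s := by
            rw [lt_div_iff₀ hs0]
            rw [lt_div_iff₀ (by positivity)] at hd
            linarith
          linarith
        exact (hb _ (hmem s hs0 hs.2)).trans_le ((hanti hk').trans hk.le)
    · have : ContinuousAt h s := by
        have hc : ContinuousAt (fun s : ℝ => G (1 / s - 1)) s :=
          hGc.continuousAt.comp (f := fun s : ℝ => 1 / s - 1)
            ((continuousAt_const.div continuousAt_id hs0.ne').sub continuousAt_const)
        refine hc.congr ?_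
        filter_upwards [Ioi_mem_nhds hs0] with t ht
        exact (hpos t ht).symm
      exact this.continuousWithinAt
  · rintro _ ⟨s, hs, rfl⟩
    rcases hs.1.eq_or_lt with rfl | hs0
    · exact Or.inr h0
    · exact Or.inl (hT _ (hmem s hs0 hs.2))

/-- Split an arc at the first hit of a closed set. -/
lemma IsArc.first_split {A : Set ℂ} {a b : ℂ} (h : IsArc A a b) {K : Set ℂ} (hK : IsClosed K)
    (ha : a ∉ K) (hb : b ∉ K) (hne : (A ∩ K).Nonempty) :
    ∃ k A' B', k ∈ K ∧ IsArc A' a k ∧ IsArc B' k b ∧ A' ∪ B' = A ∧ A' ∩ B' = {k} ∧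
      A' ∩ K = {k} := by
  obtain ⟨γ, hc, hi, rfl, rfl, rfl⟩ := h
  have hcl : IsClosed (Icc (0:ℝ) 1 ∩ γ ⁻¹' K) := hc.preimage_isClosed_of_isClosed isClosed_Icc hK
  have hcp : IsCompact (Icc (0:ℝ) 1 ∩ γ ⁻¹' K) := isCompact_Icc.of_isClosed_subset hcl inter_subset_left
  obtain ⟨z, ⟨t, ht, rfl⟩, hz⟩ := hne
  obtain ⟨s, hs, hmin⟩ := hcp.exists_isLeast ⟨t, ht, hz⟩
  have hs0 : 0 < s := lt_of_le_of_ne hs.1.1 (fun h => ha (by rw [h]; exact hs.2))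
  have hs1 : s < 1 := lt_of_le_of_ne hs.1.2 (fun h => hb (by rw [← h]; exact hs.2))
  have s1 : Icc 0 s ⊆ Icc (0:ℝ) 1 := Icc_subset_Icc_right hs.1.2
  have s2 : Icc s 1 ⊆ Icc (0:ℝ) 1 := Icc_subset_Icc_left hs.1.1
  refine ⟨γ s, γ '' Icc 0 s, γ '' Icc s 1, hs.2, isArc_of_Icc hs0 (hc.mono s1) (hi.mono s1),
    isArc_of_Icc hs1 (hc.mono s2) (hi.mono s2), ?_, ?_, ?_⟩
  · rw [← image_union, Icc_union_Icc_eq_Icc hs0.le hs1.le]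
  · rw [← hi.image_inter s1 s2, Icc_inter_Icc_eq_singleton hs0.le hs1.le, image_singleton]
  · ext z; constructor
    · rintro ⟨⟨u, hu, rfl⟩, hzK⟩
      have := hmin ⟨s1 hu, hzK⟩
      rw [le_antisymm hu.2 this]; rfl
    · rintro rfl
      exact ⟨⟨s, ⟨hs0.le, le_rfl⟩, rfl⟩, hs.2⟩

lemma preconn_exterior (y : ℂ) {ε : ℝ} (hε : 0 < ε) : IsPreconnected {z : ℂ | ε < dist z y} := by
  have := (preconn_ext hε).image (fun z => z + y) (by fun_prop)
  convert this using 1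
  ext z; constructor
  · intro hz
    have hz' : ε < dist z y := hz
    refine ⟨z - y, ?_, by simp⟩
    rw [dist_eq_norm] at hz'
    exact hz'
  · rintro ⟨w, hw, rfl⟩
    change ε < dist (w + y) y
    rw [dist_eq_norm, add_sub_cancel_right]
    exact hw

lemma sphere_faces (y : ℂ) {ε : ℝ} (hε : 0 < ε) : {F | Face (Metric.sphere y ε) F}.Finite := by
  have n1 : y ∉ Metric.sphere y ε := by simp [hε.ne]
  have n2 : y + (2 * ε : ℝ) ∉ Metric.sphere y ε := by
    rw [Metric.mem_sphere, dist_eq_norm, add_sub_cancel_left, Complex.norm_real, Real.norm_eq_abs,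
      abs_of_pos (by linarith)]
    intro h; linarith
  obtain ⟨G₁, h1, y1⟩ := face_of_notMem n1
  obtain ⟨G₂, h2, y2⟩ := face_of_notMem n2
  refine (toFinite {G₁, G₂}).subset (fun F hF => ?_)
  obtain ⟨q, hq⟩ := Face.nonempty hF
  have hqs : dist q y ≠ ε := fun h => disjoint_left.1 (Face.disj hF) hq h
  rcases lt_or_gt_of_ne hqs with h | h
  · left
    have := h1.subset_of (Metric.isPreconnected_ball : IsPreconnected (Metric.ball y ε)) (by
      rw [disjoint_left]; intro z hz hz'; exact (ne_of_lt (Metric.mem_ball.1 hz)) hz')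
      ⟨y, Metric.mem_ball_self hε, y1⟩
    exact Face.eq_of_mem hF h1 hq (this h)
  · right
    have := h2.subset_of (preconn_exterior y hε) (by
      rw [disjoint_left]; intro z hz hz'; exact (ne_of_gt (show ε < dist z y from hz)) hz')
      ⟨_, by
        show ε < dist _ y
        rw [dist_eq_norm, add_sub_cancel_left, Complex.norm_real, Real.norm_eq_abs,
          abs_of_pos (by linarith)]
        linarith, y2⟩
    exact Face.eq_of_mem hF h2 hq (this h)

variable {ι : Type*} [Finite ι] {y : ℂ}

/-- Finitely many faces of a wheel. -/
lemma wheel_faces {A : ι → Set ℂ} {x : ι → ℂ} {ε : ℝ} (hε : 0 < ε)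
    (hA : ∀ i, IsArc (A i) y (x i)) (hs : ∀ i, A i ∩ Metric.sphere y ε = {x i})
    (hd : ∀ i j, i ≠ j → A i ∩ A j ⊆ {y}) :
    {F | Face (Metric.sphere y ε ∪ ⋃ i, A i) F}.Finite := by
  classical
  have hne : ∀ i, x i ≠ y := fun i => (hA i).ne.symm
  have key : ∀ s : Set ι, s.Finite → {F | Face (Metric.sphere y ε ∪ ⋃ i ∈ s, A i) F}.Finite ∧
      IsPreconnected (Metric.sphere y ε ∪ ⋃ i ∈ s, A i) ∧
      IsCompact (Metric.sphere y ε ∪ ⋃ i ∈ s, A i) := by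
    intro s hsf
    induction s, hsf using Set.Finite.induction_on with
    | empty =>
      simp only [biUnion_empty, union_empty]
      refine ⟨sphere_faces y hε, isPreconnected_sphere (by simp) _ _, isCompact_sphere _ _⟩
    | @insert i s hi hsf ih =>
      obtain ⟨f, c, k⟩ := ih
      have e : Metric.sphere y ε ∪ ⋃ j ∈ insert i s, A j =
          (Metric.sphere y ε ∪ ⋃ j ∈ s, A j) ∪ A i := by
        rw [biUnion_insert, union_comm (A i), union_assoc]
      have hx : x i ∈ A i ∩ Metric.sphere y ε := by rw [hs]; rfl
      rw [e]
      refine ⟨?_, c.union (x i) (Or.inl hx.2) hx.1 (hA i).preconn, k.union (hA i).isCompact⟩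
      have hsub : (Metric.sphere y ε ∪ ⋃ j ∈ s, A j) ∩ A i ⊆ {y, x i} := by
        rintro z ⟨hz | hz, hzi⟩
        · right
          have : z ∈ A i ∩ Metric.sphere y ε := ⟨hzi, hz⟩
          rwa [hs] at this
        · left
          simp only [mem_iUnion] at hz
          obtain ⟨j, hj, hz⟩ := hz
          exact hd j i (fun e => hi (e ▸ hj)) ⟨hz, hzi⟩
      by_cases hse : s.Nonempty
      · obtain ⟨j, hj⟩ := hse
        refine (faces_chord k c (hA i) (Subset.antisymm hsub ?_) f).1
        rintro z (rfl | rfl)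
        · exact ⟨Or.inr (mem_biUnion hj (hA j).left_mem), (hA i).left_mem⟩
        · exact ⟨Or.inl hx.2, hx.1⟩
      · rw [not_nonempty_iff_eq_empty] at hse
        subst hse
        refine (faces_pendant k (hA i) ?_ f).1
        rw [biUnion_empty, union_empty, inter_comm, hs]
        exact subsingleton_singleton
  have := (key univ finite_univ).1
  simpa using this

lemma local_finite {S : ι → Set ℂ} {e : ι → ℂ} {R : Set ℂ} {ρ : ℝ}
    (hS : ∀ i, IsArc (S i) y (e i))
    (hSS : ∀ i j, i ≠ j → S i ∩ S j ∩ Metric.ball y ρ ⊆ {y}) (hR : IsCompact R)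
    (hRρ : Disjoint R (Metric.ball y ρ)) {ε : ℝ} (hε : 0 < ε) (hερ : ε < ρ)
    (hεe : ∀ i, ε < dist (e i) y) :
    ∃ δ > 0, {C | Face (Metric.sphere y ε ∪ ((⋃ i, S i) ∪ R)) C ∧
      (C ∩ Metric.ball y δ).Nonempty}.Finite := by
  have hy : y ∉ Metric.sphere y ε := by simp [hε.ne]
  have he : ∀ i, e i ∉ Metric.sphere y ε := fun i h => (hεe i).ne' h
  have hne : ∀ i, (S i ∩ Metric.sphere y ε).Nonempty := by
    intro i
    have := (hS i).preconn.intermediate_value (hS i).left_mem (hS i).right_mem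
      (f := fun z => dist z y) (by fun_prop)
    obtain ⟨z, hz, hz'⟩ := this (⟨by simp [hε.le], (hεe i).le⟩ : ε ∈ Icc (dist y y) (dist (e i) y))
    exact ⟨z, hz, hz'⟩
  choose x A B hxs hA hB hABu hABi hAs using fun i =>
    (hS i).first_split Metric.isClosed_sphere hy (he i) (hne i)
  have hAball : ∀ i, A i ⊆ Metric.closedBall y ε := by
    intro i z hz
    by_cases hzx : z = x i
    · rw [hzx]; exact Metric.sphere_subset_closedBall (hxs i)
    · by_contra hcon
      rw [Metric.mem_closedBall, not_le] at hcon
      have := (hA i).diff_right_preconn.intermediate_value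
        (⟨(hA i).left_mem, (hA i).ne⟩ : y ∈ A i \ {x i}) ⟨hz, hzx⟩ (f := fun z => dist z y) (by fun_prop)
      obtain ⟨w, hw, hw'⟩ := this (⟨by simp [hε.le], hcon.le⟩ : ε ∈ Icc (dist y y) (dist z y))
      have : w ∈ A i ∩ Metric.sphere y ε := ⟨hw.1, hw'⟩
      rw [hAs] at this
      exact hw.2 this
  have hAρ : ∀ i, A i ⊆ Metric.ball y ρ := fun i =>
    (hAball i).trans (Metric.closedBall_subset_ball hερ)
  have hAS : ∀ i, A i ⊆ S i := fun i => by rw [← hABu]; exact subset_union_left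
  have hBS : ∀ i, B i ⊆ S i := fun i => by rw [← hABu]; exact subset_union_right
  have hyB : ∀ i, y ∉ B i := by
    intro i h
    have : y ∈ A i ∩ B i := ⟨(hA i).left_mem, h⟩
    rw [hABi] at this
    exact (hA i).ne this
  set L := Metric.sphere y ε ∪ ⋃ i, A i with hL
  set M := Metric.sphere y ε ∪ (R ∪ ⋃ i, B i) with hM
  have hLc : IsCompact L := (isCompact_sphere _ _).union (isCompact_iUnion (fun i => (hA i).isCompact))
  have hMc : IsCompact M :=
    (isCompact_sphere _ _).union (hR.union (isCompact_iUnion (fun i => (hB i).isCompact)))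
  have hLM : L ∪ M = Metric.sphere y ε ∪ ((⋃ i, S i) ∪ R) := by
    have : (⋃ i, S i) = (⋃ i, A i) ∪ ⋃ i, B i := by rw [← iUnion_union_distrib]; simp [hABu]
    rw [hL, hM, this]
    ext z; simp only [mem_union]; tauto
  have hyM : y ∉ M := by
    rintro (h | h | h)
    · exact hy h
    · exact disjoint_left.1 hRρ h (Metric.mem_ball_self (hε.trans hερ))
    · obtain ⟨i, hi⟩ := mem_iUnion.1 h
      exact hyB i hi
  obtain ⟨δ, hδ, hδM⟩ := Metric.mem_nhds_iff.1 (hMc.isClosed.isOpen_compl.mem_nhds hyM)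
  have hinter : L ∩ M = Metric.sphere y ε := by
    refine Subset.antisymm ?_ (fun z hz => ⟨Or.inl hz, Or.inl hz⟩)
    rintro z ⟨hz | hz, hz'⟩
    · exact hz
    · obtain ⟨i, hi⟩ := mem_iUnion.1 hz
      rcases hz' with h | h | h
      · exact h
      · exact absurd (hAρ i hi) (disjoint_left.1 hRρ h)
      · obtain ⟨j, hj⟩ := mem_iUnion.1 h
        by_cases e : i = j
        · subst e
          have : z ∈ A i ∩ B i := ⟨hi, hj⟩
          rw [hABi] at this
          rw [show z = x i from this]; exact hxs i
        · have : z = y := hSS i j e ⟨⟨hAS i hi, hBS j hj⟩, hAρ i hi⟩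
          exact absurd (this ▸ hj) (hyB j)
  have hfin : {F | Face L F}.Finite := wheel_faces hε hA hAs (fun i j hij z hz =>
    hSS i j hij ⟨⟨hAS i hz.1, hAS j hz.2⟩, hAρ i hz.1⟩)
  refine ⟨δ, hδ, ?_⟩
  rw [← hLM]
  have : ∀ F : Set ℂ, ∃ G, Face (L ∪ M) F → Face L G ∧ F ⊆ G := by
    intro F
    by_cases hF : Face (L ∪ M) F
    · obtain ⟨G, hG⟩ := exists_bigger subset_union_left hF
      exact ⟨G, fun _ => hG⟩
    · exact ⟨∅, fun h => absurd h hF⟩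
  choose g hg using this
  refine Finite.of_injOn (f := g) (fun F hF => (hg F hF.1).1) ?_ hfin
  rintro F ⟨hF, p, hpF, hp⟩ F' ⟨hF', p', hpF', hp'⟩ h
  obtain ⟨H, hH, hyH⟩ := face_of_notMem hyM
  have hbH : Metric.ball y δ ⊆ H := hH.subset_of Metric.isPreconnected_ball
    (disjoint_left.2 (fun z hz => hδM hz)) ⟨y, Metric.mem_ball_self hδ, hyH⟩
  refine janiszewski hLc hMc (by rw [hinter]; exact isPreconnected_sphere (by simp) _ _) (hg F hF).1 hH
    hF hF' (hg F hF).2 (by rw [h]; exact (hg F' hF').2) ?_ ?_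
  · exact hF.subset_of_subset subset_union_right hH ⟨p, hpF, hbH hp⟩
  · exact hF'.subset_of_subset subset_union_right hH ⟨p', hpF', hbH hp'⟩

theorem accessible {S : ι → Set ℂ} {e : ι → ℂ} {R : Set ℂ} {ρ : ℝ} (hρ : 0 < ρ)
    (hS : ∀ i, IsArc (S i) y (e i))
    (hSS : ∀ i j, i ≠ j → S i ∩ S j ∩ Metric.ball y ρ ⊆ {y}) (hR : IsCompact R)
    (hRρ : Disjoint R (Metric.ball y ρ)) {F : Set ℂ} (hF : Face ((⋃ i, S i) ∪ R) F)
    (hyF : y ∈ closure F) {o : ℂ} (ho : o ∈ F) : JoinedIn (F ∪ {y}) o y := by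
  set X := (⋃ i, S i) ∪ R with hX
  have hXc : IsClosed X := ((isCompact_iUnion (fun i => (hS i).isCompact)).union hR).isClosed
  -- base radius
  obtain ⟨ε₀, hε₀, hε₀ρ, hε₀e⟩ : ∃ ε₀ > 0, ε₀ < ρ ∧ ∀ i, ε₀ < dist (e i) y := by
    have hev : ∀ᶠ ε in nhdsWithin (0:ℝ) (Ioi 0), ∀ i, ε < dist (e i) y := by
      rw [Filter.eventually_all]
      intro i
      exact nhdsWithin_le_nhds (Iio_mem_nhds (dist_pos.2 (hS i).ne.symm))
    have hev2 : ∀ᶠ ε in nhdsWithin (0:ℝ) (Ioi 0), ε < ρ := nhdsWithin_le_nhds (Iio_mem_nhds hρ)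
    have hev3 : ∀ᶠ ε in nhdsWithin (0:ℝ) (Ioi 0), 0 < ε := self_mem_nhdsWithin
    obtain ⟨ε, h1, h2, h3⟩ := (hev3.and (hev2.and hev)).exists
    exact ⟨ε, h1, h2, h3⟩
  let ε : ℕ → ℝ := fun k => ε₀ / (k + 1)
  have hεpos : ∀ k, 0 < ε k := fun k => by positivity
  have hanti : Antitone ε := by
    intro k l hkl
    have : (k:ℝ) ≤ l := by exact_mod_cast hkl
    simp only [ε]
    gcongr
  have hstrict : ∀ k, ε (k + 1) < ε k := by
    intro k
    simp only [ε]
    push_cast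
    apply div_lt_div_of_pos_left hε₀ (by positivity) (by linarith)
  have hεle : ∀ k, ε k ≤ ε₀ := fun k => by
    have := hanti (Nat.zero_le k)
    simpa [ε] using this
  have hε0 : ∀ η > 0, ∃ k, ε k < η := by
    intro η hη
    obtain ⟨k, hk⟩ := exists_nat_gt (ε₀ / η)
    refine ⟨k, ?_⟩
    simp only [ε]
    rw [div_lt_iff₀ hη] at hk
    rw [div_lt_iff₀ (by positivity)]
    nlinarith
  -- step
  have step : ∀ k, ∀ K Z : Set ℂ, X ⊆ K → K ∩ Metric.ball y (ε k) ⊆ X → Face K Z → y ∈ closure Z →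
      ∃ C, Face (Metric.sphere y (ε k) ∪ X) C ∧ C ⊆ Z ∧ C ⊆ Metric.ball y (ε k) ∧ y ∈ closure C := by
    intro k K Z hXK hK hZ hyZ
    obtain ⟨δ', hδ', hfin'⟩ := local_finite hS hSS hR hRρ (hεpos k) ((hεle k).trans_lt hε₀ρ)
      (fun i => (hεle k).trans_lt (hε₀e i))
    rw [← hX] at hfin'
    set δ := min δ' (ε k) with hδdef
    have hδ : 0 < δ := lt_min hδ' (hεpos k)
    have hfin : {C | Face (Metric.sphere y (ε k) ∪ X) C ∧ (C ∩ Metric.ball y δ).Nonempty}.Finite := by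
      refine hfin'.subset (fun C hC => ⟨hC.1, hC.2.mono (inter_subset_inter_right _ ?_)⟩)
      exact Metric.ball_subset_ball (min_le_left _ _)
    have hy2 : y ∈ closure (⋃ C ∈ {C | Face (Metric.sphere y (ε k) ∪ X) C ∧
        (C ∩ Metric.ball y δ).Nonempty}, C ∩ Z) := by
      rw [mem_closure_iff]
      intro U hU hyU
      obtain ⟨z, ⟨hzU, hzb⟩, hzZ⟩ := mem_closure_iff.1 hyZ (U ∩ Metric.ball y δ)
        (hU.inter Metric.isOpen_ball) ⟨hyU, Metric.mem_ball_self hδ⟩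
      have hzX : z ∉ Metric.sphere y (ε k) ∪ X := by
        rintro (h | h)
        · have h1 : dist z y = ε k := h
          have h2 : dist z y < ε k := lt_of_lt_of_le hzb (min_le_right _ _)
          linarith
        · exact disjoint_left.1 hZ.disj hzZ (hXK h)
      obtain ⟨C, hC, hzC⟩ := face_of_notMem hzX
      exact ⟨z, hzU, mem_biUnion (show C ∈ {C | Face (Metric.sphere y (ε k) ∪ X) C ∧
        (C ∩ Metric.ball y δ).Nonempty} from ⟨hC, z, hzC, hzb⟩) ⟨hzC, hzZ⟩⟩
    rw [hfin.closure_biUnion] at hy2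
    simp only [mem_iUnion] at hy2
    obtain ⟨C, ⟨hC, w, hwC, hwb⟩, hyC⟩ := hy2
    have hCb : C ⊆ Metric.ball y (ε k) := by
      intro z hz
      by_contra hcon
      rw [Metric.mem_ball, not_lt] at hcon
      have := hC.preconn.intermediate_value hwC hz (f := fun z => dist z y) (by fun_prop)
      obtain ⟨v, hv, hv'⟩ := this (⟨(lt_of_lt_of_le hwb (min_le_right _ _)).le, hcon⟩ :
        ε k ∈ Icc (dist w y) (dist z y))
      exact disjoint_left.1 hC.disj hv (Or.inl hv')
    refine ⟨C, hC, ?_, hCb, closure_mono inter_subset_left hyC⟩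
    refine hZ.subset_of hC.preconn ?_ ?_
    · rw [disjoint_left]
      intro z hz hzK
      exact disjoint_left.1 hC.disj hz (Or.inr (hK ⟨hzK, hCb hz⟩))
    · exact closure_nonempty_iff.1 ⟨y, hyC⟩
  obtain ⟨C₀, h01, h02, h03, h04⟩ := step 0 X F (subset_refl _) inter_subset_left hF hyF
  have step' : ∀ k, ∀ Z : {Z // Face (Metric.sphere y (ε k) ∪ X) Z ∧ y ∈ closure Z},
      ∃ C : {Z // Face (Metric.sphere y (ε (k+1)) ∪ X) Z ∧ y ∈ closure Z}, C.1 ⊆ Z.1 ∧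
        C.1 ⊆ Metric.ball y (ε (k+1)) := by
    rintro k ⟨Z, hZ, hyZ⟩
    obtain ⟨C, h1, h2, h3, h4⟩ := step (k+1) (Metric.sphere y (ε k) ∪ X) Z subset_union_right (by
      rintro z ⟨h | h, hz⟩
      · have h1 : dist z y = ε k := h
        have h2 : dist z y < ε (k+1) := hz
        have := hstrict k
        linarith
      · exact h) hZ hyZ
    exact ⟨⟨C, h1, h4⟩, h2, h3⟩
  choose nx hnx using step'
  let sq : (k : ℕ) → {Z // Face (Metric.sphere y (ε k) ∪ X) Z ∧ y ∈ closure Z} :=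
    fun k => Nat.rec ⟨C₀, h01, h04⟩ (fun k Z => nx k Z) k
  have hsq : ∀ k, (sq (k+1)).1 ⊆ (sq k).1 := fun k => (hnx k (sq k)).1
  have hsqb : ∀ k, (sq k).1 ⊆ Metric.ball y (ε k) := by
    intro k
    cases k with
    | zero => exact h03
    | succ k => exact (hnx k (sq k)).2
  have hsqF : ∀ k, (sq k).1 ⊆ F := by
    intro k
    induction k with
    | zero => exact h02
    | succ k ih => exact (hsq k).trans ih
  have hcl : ∀ k, IsClosed (Metric.sphere y (ε k) ∪ X) := fun k => Metric.isClosed_sphere.union hXc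
  choose p hp using fun k => (sq k).2.1.nonempty
  have hpc : ∀ {K Z : Set ℂ}, IsClosed K → Face K Z → ∀ u ∈ Z, ∀ v ∈ Z, JoinedIn Z u v := by
    intro K Z hK hZ u hu v hv
    have : IsPathConnected Z := (hZ.isOpen hK).isConnected_iff_isPathConnected.1 ⟨hZ.nonempty, hZ.preconn⟩
    exact this.joinedIn u hu v hv
  have hj : ∀ k, JoinedIn (sq k).1 (p k) (p (k+1)) := fun k =>
    hpc (hcl k) (sq k).2.1 _ (hp k) _ (hsq k (hp (k+1)))
  have h1 := inf_concat hj hsqF hsqb hanti hε0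
  exact ((hpc hXc hF o ho (p 0) (hsqF 0 (hp 0))).mono subset_union_left).trans h1

end OP

namespace OP

/-- Connectivity of a drawing of a connected graph. -/
lemma conn_graph {W : Type*} {Γ : SimpleGraph W} (hΓ : Γ.Preconnected) (p : W → ℂ)
    (A : W → W → Set ℂ) (hA : ∀ a b, Γ.Adj a b → IsPreconnected (A a b) ∧ p a ∈ A a b ∧ p b ∈ A a b) :
    IsPreconnected (range p ∪ ⋃ (a) (b) (_ : Γ.Adj a b), A a b) := by
  rcases isEmpty_or_nonempty W with hW | ⟨⟨w⟩⟩
  · have : (range p ∪ ⋃ (a) (b) (_ : Γ.Adj a b), A a b) = ∅ := by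
      simpa using hW
    rw [this]; exact isPreconnected_empty
  set X := range p ∪ ⋃ (a) (b) (_ : Γ.Adj a b), A a b with hX
  have hAX : ∀ a b, Γ.Adj a b → A a b ⊆ X := fun a b h z hz =>
    Or.inr (by simp only [mem_iUnion]; exact ⟨a, b, h, hz⟩)
  have hpX : ∀ a, p a ∈ X := fun a => Or.inl ⟨a, rfl⟩
  have key : ∀ a b, Γ.Adj a b → ∀ z ∈ A a b, z ∈ connectedComponentIn X (p a) := fun a b h z hz =>
    (hA a b h).1.subset_connectedComponentIn (hA a b h).2.1 (hAX a b h) hz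
  have hreach : ∀ a, p a ∈ connectedComponentIn X (p w) := by
    intro a
    obtain ⟨q⟩ := hΓ w a
    induction q with
    | nil => exact mem_connectedComponentIn (hpX _)
    | @cons u v t h q ih =>
      have := key u v h (p v) (hA u v h).2.2
      rw [connectedComponentIn_eq this]
      exact ih
  have : X = connectedComponentIn X (p w) := by
    refine Subset.antisymm ?_ (connectedComponentIn_subset _ _)
    rintro z (⟨a, rfl⟩ | hz)
    · exact hreach a
    · simp only [mem_iUnion] at hz
      obtain ⟨a, b, h, hz⟩ := hz
      rw [connectedComponentIn_eq (hreach a)]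
      exact key a b h z hz
  rw [this]
  exact isPreconnected_connectedComponentIn

section Graph

variable {V : Type} [Fintype V] {G : SimpleGraph V}

lemma exists_nbr (hk : KConnected G 3) (hn : 5 ≤ Fintype.card V) {a p q : V} (hp : a ≠ p)
    (hq : a ≠ q) : ∃ w, G.Adj a w ∧ w ≠ p ∧ w ≠ q := by
  classical
  have hS : ({p, q} : Set V).ncard < 3 := by
    have := ncard_insert_le p {q}
    rw [ncard_singleton] at this
    omega
  have hc := hk {p, q} hS
  obtain ⟨z, hz⟩ : ∃ z, z ∉ ({a, p, q} : Finset V) := by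
    by_contra hcon
    push Not at hcon
    have h1 : Finset.univ ⊆ ({a, p, q} : Finset V) := fun z _ => hcon z
    have h2 := Finset.card_le_card h1
    have h3 : ({a, p, q} : Finset V).card ≤ 3 := Finset.card_le_three
    rw [Finset.card_univ] at h2
    omega
  simp only [Finset.mem_insert, Finset.mem_singleton, not_or] at hz
  have ha : a ∈ ({p, q} : Set V)ᶜ := by simp [hp, hq]
  have hz' : z ∈ ({p, q} : Set V)ᶜ := by simp [hz]
  obtain ⟨w⟩ := hc.preconnected ⟨a, ha⟩ ⟨z, hz'⟩
  cases w with
  | nil => exact absurd rfl hz.1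
  | @cons _ v _ h _ =>
    refine ⟨v.1, h, ?_, ?_⟩
    · rintro e; exact v.2 (by simp [e])
    · rintro e; exact v.2 (by simp [e])

lemma del_conn (hk : KConnected G 3) {S : Set V} (hS : S.ncard < 3) {T : Set (Sym2 V)}
    (hT : ∀ a b, s(a, b) ∈ T → a ∈ S ∨ b ∈ S)
    (hw : ∀ s ∈ S, ∃ w, w ∉ S ∧ G.Adj s w ∧ s(s, w) ∉ T) : (G.deleteEdges T).Preconnected := by
  have hc := (hk S hS).preconnected
  have h1 : ∀ u v, u ∉ S → v ∉ S → (G.deleteEdges T).Reachable u v := by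
    intro u v hu hv
    let φ : (G.induce Sᶜ) →g (G.deleteEdges T) := ⟨Subtype.val, by
      rintro ⟨a, ha⟩ ⟨b, hb⟩ hab
      rw [SimpleGraph.deleteEdges_adj]
      refine ⟨hab, fun h => ?_⟩
      rcases hT _ _ h with h | h
      · exact ha h
      · exact hb h⟩
    exact (hc ⟨u, hu⟩ ⟨v, hv⟩).map φ
  have h2 : ∀ u, ∃ w, w ∉ S ∧ (G.deleteEdges T).Reachable u w := by
    intro u
    by_cases hu : u ∈ S
    · obtain ⟨w, h, h', h''⟩ := hw u hu
      exact ⟨w, h, SimpleGraph.Adj.reachable (by rw [SimpleGraph.deleteEdges_adj]; exact ⟨h', h''⟩)⟩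
    · exact ⟨u, hu, SimpleGraph.Reachable.refl _⟩
  intro u v
  obtain ⟨u', hu', h3⟩ := h2 u
  obtain ⟨v', hv', h4⟩ := h2 v
  exact h3.trans ((h1 _ _ hu' hv').trans h4.symm)

lemma del_one (hk : KConnected G 3) (hn : 5 ≤ Fintype.card V) {a b : V} (hab : a ≠ b) :
    (G.deleteEdges {s(a, b)}).Preconnected := by
  refine del_conn hk (S := {a}) (by simp) ?_ ?_
  · intro u v h
    have h : s(u, v) = s(a, b) := h
    rw [Sym2.eq_iff] at h
    rcases h with ⟨h, -⟩ | ⟨-, h⟩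
    · exact Or.inl h
    · exact Or.inr h
  · rintro s rfl
    obtain ⟨w, h1, h2, -⟩ := exists_nbr hk hn hab hab
    refine ⟨w, h1.ne', h1, fun h => ?_⟩
    have h : s(s, w) = s(s, b) := h
    rw [Sym2.eq_iff] at h
    grind

lemma del_two (hk : KConnected G 3) (hn : 5 ≤ Fintype.card V) {a b c d : V} (hab : a ≠ b)
    (hcd : c ≠ d) (hac : a ≠ c) (had : a ≠ d) (hbc : b ≠ c) :
    (G.deleteEdges {s(a, b), s(c, d)}).Preconnected := by
  have hS : ({a, c} : Set V).ncard < 3 := by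
    have := ncard_insert_le a {c}
    rw [ncard_singleton] at this
    omega
  refine del_conn hk hS ?_ ?_
  · intro u v h
    have h : s(u, v) = s(a, b) ∨ s(u, v) = s(c, d) := h
    rw [Sym2.eq_iff, Sym2.eq_iff] at h
    simp only [mem_insert_iff, mem_singleton_iff]
    tauto
  · have key : ∀ {a b c d : V}, a ≠ b → a ≠ c → a ≠ d → ∃ w, w ∉ ({a, c} : Set V) ∧ G.Adj a w ∧
        s(a, w) ∉ ({s(a, b), s(c, d)} : Set (Sym2 V)) := by
      intro a b c d hab hac had
      obtain ⟨w, h1, h2, h3⟩ := exists_nbr hk hn hab hac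
      refine ⟨w, ?_, h1, ?_⟩
      · rintro (h | h)
        · exact h1.ne' h
        · exact h3 h
      · intro h
        have h : s(a, w) = s(a, b) ∨ s(a, w) = s(c, d) := h
        rw [Sym2.eq_iff, Sym2.eq_iff] at h
        grind
    rintro s (rfl | rfl)
    · exact key hab hac had
    · obtain ⟨w, h1, h2, h3⟩ := key hcd hac.symm hbc.symm
      refine ⟨w, by rwa [pair_comm], h2, by rwa [pair_comm]⟩

end Graph

end OP

namespace OP

/-- An abstract drawing in `ℂ`, indexed by `Sym2 V`. -/
structure Sys {V : Type} (G : SimpleGraph V) where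
  P : V → ℂ
  Ar : Sym2 V → Set ℂ
  inj : Function.Injective P
  arc : ∀ u v, G.Adj u v → IsArc (Ar s(u, v)) (P u) (P v)
  emp : ∀ e, e ∉ G.edgeSet → Ar e = ∅
  vert : ∀ w e, P w ∈ Ar e → w ∈ e
  good : ∀ e f, e ≠ f → ((Ar e ∩ Ar f) \ range P).Subsingleton
  adj : ∀ u v w, v ≠ w → (Ar s(u, v) ∩ Ar s(u, w)) \ range P = ∅
  one : ∀ e f f', e ≠ f → e ≠ f' → ((Ar e ∩ Ar f) \ range P).Nonempty →
    ((Ar e ∩ Ar f') \ range P).Nonempty → f = f'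

namespace Sys

variable {V : Type} {G : SimpleGraph V} (D : Sys G)

def Cr (e f : Sym2 V) : Prop := e ≠ f ∧ ((D.Ar e ∩ D.Ar f) \ range D.P).Nonempty

def C : Set (Sym2 V) := {e | ∃ f, D.Cr e f}

def U : Set (Sym2 V) := {e | e ∈ G.edgeSet ∧ e ∉ D.C}

def X : Set ℂ := range D.P ∪ ⋃ e, D.Ar e

variable {D}

lemma Cr.symm {e f : Sym2 V} (h : D.Cr e f) : D.Cr f e :=
  ⟨h.1.symm, by rw [inter_comm]; exact h.2⟩

lemma Cr.mem {e f : Sym2 V} (h : D.Cr e f) : e ∈ G.edgeSet := by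
  by_contra h'
  obtain ⟨z, hz⟩ := h.2
  have := hz.1.1
  rw [D.emp e h'] at this
  exact this

lemma C_sub : D.C ⊆ G.edgeSet := fun _ ⟨_, h⟩ => h.mem

lemma Cr.uniq {e f f' : Sym2 V} (h : D.Cr e f) (h' : D.Cr e f') : f = f' :=
  D.one e f f' h.1 h'.1 h.2 h'.2

lemma mem_of_mem {e : Sym2 V} {z : ℂ} (h : z ∈ D.Ar e) : e ∈ G.edgeSet := by
  by_contra h'
  rw [D.emp e h'] at h
  exact h

lemma left_mem {u v : V} (h : G.Adj u v) : D.P u ∈ D.Ar s(u, v) := (D.arc u v h).left_mem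
lemma right_mem {u v : V} (h : G.Adj u v) : D.P v ∈ D.Ar s(u, v) := (D.arc u v h).right_mem

lemma P_mem_iff {u : V} {e : Sym2 V} (he : e ∈ G.edgeSet) : D.P u ∈ D.Ar e ↔ u ∈ e := by
  refine ⟨D.vert u e, fun h => ?_⟩
  induction e with | _ a b =>
  rw [Sym2.mem_iff] at h
  rcases h with rfl | rfl
  · exact left_mem he
  · exact right_mem he

lemma range_inter {u v : V} (h : G.Adj u v) : D.Ar s(u, v) ∩ range D.P = {D.P u, D.P v} := by
  ext z; constructor
  · rintro ⟨hz, w, rfl⟩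
    have := D.vert w _ hz
    rw [Sym2.mem_iff] at this
    rcases this with rfl | rfl <;> simp
  · rintro (rfl | rfl)
    · exact ⟨left_mem h, u, rfl⟩
    · exact ⟨right_mem h, v, rfl⟩

variable (D)

lemma half_exists (e : Sym2 V) : ∃ (x : ℂ) (h : V → Set ℂ), e ∈ D.C →
    (x ∉ range D.P ∧ (∀ f, D.Cr e f → x ∈ D.Ar e ∩ D.Ar f) ∧
      ∀ u v, e = s(u, v) → IsArc (h u) (D.P u) x ∧ h u ∪ h v = D.Ar e ∧ h u ∩ h v = {x}) := by
  classical
  by_cases he : e ∈ D.C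
  · obtain ⟨f, hf⟩ := he
    obtain ⟨x, ⟨hxe, hxf⟩, hxP⟩ := hf.2
    have hE := hf.mem
    induction e with | _ a b =>
    have hab : G.Adj a b := hE
    obtain ⟨A₁, A₂, h1, h2, h3, h4⟩ := (D.arc a b hab).split hxe (fun h => hxP ⟨a, h.symm⟩)
      (fun h => hxP ⟨b, h.symm⟩)
    refine ⟨x, fun w => if w = a then A₁ else A₂, fun _ => ⟨hxP, ?_, ?_⟩⟩
    · intro f' hf'
      rw [← hf.uniq hf']
      exact ⟨hxe, hxf⟩
    · intro u v huv
      rw [Sym2.eq_iff] at huv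
      have hba : b ≠ a := hab.ne'
      rcases huv with ⟨rfl, rfl⟩ | ⟨rfl, rfl⟩
      · simp only [if_true, if_neg hba]
        exact ⟨h1, h3, h4⟩
      · simp only [if_true, if_neg hba]
        exact ⟨h2.symm, by rw [union_comm]; exact h3, by rw [inter_comm]; exact h4⟩
  · exact ⟨0, fun _ => ∅, fun h => absurd h he⟩

noncomputable def pt (e : Sym2 V) : ℂ := (D.half_exists e).choose
noncomputable def H (e : Sym2 V) : V → Set ℂ := (D.half_exists e).choose_spec.choose

def N : Set ℂ := range D.P ∪ D.pt '' D.C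
def Hs : Set (Set ℂ) := {s | ∃ e ∈ D.C, ∃ a ∈ e, s = D.H e a}
def S : Set (Set ℂ) := D.Ar '' D.U ∪ D.Hs

variable {D}

lemma H_spec {e : Sym2 V} (he : e ∈ D.C) :
    (D.pt e ∉ range D.P ∧ (∀ f, D.Cr e f → D.pt e ∈ D.Ar e ∩ D.Ar f) ∧
      ∀ u v, e = s(u, v) → IsArc (D.H e u) (D.P u) (D.pt e) ∧ D.H e u ∪ D.H e v = D.Ar e ∧
        D.H e u ∩ D.H e v = {D.pt e}) :=
  (D.half_exists e).choose_spec.choose_spec he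

lemma pt_notMem {e : Sym2 V} (he : e ∈ D.C) : D.pt e ∉ range D.P := (H_spec he).1

lemma pt_mem {e : Sym2 V} (he : e ∈ D.C) : D.pt e ∈ D.Ar e := by
  obtain ⟨f, hf⟩ := id he
  exact ((H_spec he).2.1 f hf).1

lemma inter_eq_pt {e f : Sym2 V} {z : ℂ} (hef : e ≠ f) (hz : z ∈ D.Ar e) (hz' : z ∈ D.Ar f)
    (hP : z ∉ range D.P) : D.Cr e f ∧ z = D.pt e := by
  have hc : D.Cr e f := ⟨hef, z, ⟨hz, hz'⟩, hP⟩
  exact ⟨hc, D.good e f hef ⟨⟨hz, hz'⟩, hP⟩ ⟨(H_spec ⟨f, hc⟩).2.1 f hc, pt_notMem ⟨f, hc⟩⟩⟩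

lemma Cr.pt_eq {e f : Sym2 V} (h : D.Cr e f) : D.pt e = D.pt f := by
  have := (H_spec ⟨f, h⟩).2.1 f h
  exact (inter_eq_pt h.1.symm this.2 this.1 (pt_notMem ⟨f, h⟩)).2

lemma pt_mem_iff {e f : Sym2 V} (he : e ∈ D.C) : D.pt e ∈ D.Ar f ↔ f = e ∨ D.Cr e f := by
  constructor
  · intro h
    by_cases hef : e = f
    · exact Or.inl hef.symm
    · exact Or.inr (inter_eq_pt hef (pt_mem he) h (pt_notMem he)).1
  · rintro (rfl | h)
    · exact pt_mem he
    · exact ((H_spec he).2.1 f h).2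

lemma pt_eq_iff {e f : Sym2 V} (he : e ∈ D.C) (hf : f ∈ D.C) (h : D.pt e = D.pt f) :
    f = e ∨ D.Cr e f := (pt_mem_iff he).1 (h ▸ pt_mem hf)

lemma H_arc {e : Sym2 V} (he : e ∈ D.C) {a : V} (ha : a ∈ e) :
    IsArc (D.H e a) (D.P a) (D.pt e) := by
  obtain ⟨b, rfl⟩ := Sym2.mem_iff_exists.1 ha
  exact ((H_spec he).2.2 a b rfl).1

lemma H_union {a b : V} (he : s(a, b) ∈ D.C) : D.H s(a, b) a ∪ D.H s(a, b) b = D.Ar s(a, b) :=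
  ((H_spec he).2.2 a b rfl).2.1

lemma H_inter {a b : V} (he : s(a, b) ∈ D.C) :
    D.H s(a, b) a ∩ D.H s(a, b) b = {D.pt s(a, b)} := ((H_spec he).2.2 a b rfl).2.2

lemma H_sub {e : Sym2 V} (he : e ∈ D.C) {a : V} (ha : a ∈ e) : D.H e a ⊆ D.Ar e := by
  obtain ⟨b, rfl⟩ := Sym2.mem_iff_exists.1 ha
  rw [← H_union he]
  exact subset_union_left

lemma Ar_sub_X (e : Sym2 V) : D.Ar e ⊆ D.X := fun _ hz => Or.inr (mem_iUnion.2 ⟨e, hz⟩)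

lemma P_mem_X (u : V) : D.P u ∈ D.X := Or.inl ⟨u, rfl⟩

lemma U_ends {u v : V} (h : s(u, v) ∈ D.U) : D.Ar s(u, v) ∩ D.N = {D.P u, D.P v} := by
  rw [N, inter_union_distrib_left, range_inter h.1]
  refine union_eq_left.2 ?_
  rintro z ⟨hz, e, he, rfl⟩
  rcases (pt_mem_iff he).1 hz with h' | h'
  · exact absurd (h' ▸ he) h.2
  · exact absurd ⟨e, h'.symm⟩ h.2

lemma H_range {e : Sym2 V} (he : e ∈ D.C) {a u : V} (ha : a ∈ e) (h : D.P u ∈ D.H e a) : u = a := by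
  obtain ⟨b, rfl⟩ := Sym2.mem_iff_exists.1 ha
  have h2 := D.vert _ _ (H_sub he ha h)
  rw [Sym2.mem_iff] at h2
  rcases h2 with rfl | rfl
  · rfl
  · have h3 : D.P u ∈ D.H s(a, u) a ∩ D.H s(a, u) u := ⟨h, (H_arc he (Sym2.mem_mk_right a u)).left_mem⟩
    rw [H_inter he] at h3
    exact absurd ⟨u, h3⟩ (pt_notMem he)

lemma H_ends {e : Sym2 V} (he : e ∈ D.C) {a : V} (ha : a ∈ e) :
    D.H e a ∩ D.N = {D.P a, D.pt e} := by
  ext z; constructor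
  · rintro ⟨hz, ⟨u, rfl⟩ | ⟨f, hf, rfl⟩⟩
    · rw [H_range he ha hz]; simp
    · rcases (pt_mem_iff hf).1 (H_sub he ha hz) with h | h
      · rw [h]; simp
      · rw [h.pt_eq]; simp
  · rintro (rfl | rfl)
    · exact ⟨(H_arc he ha).left_mem, Or.inl ⟨a, rfl⟩⟩
    · exact ⟨(H_arc he ha).right_mem, Or.inr ⟨e, he, rfl⟩⟩

lemma diff_edges {e f : Sym2 V} (hef : e ≠ f) {z : ℂ} (hz : z ∈ D.Ar e) (hz' : z ∈ D.Ar f) :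
    z ∈ D.N := by
  by_cases hP : z ∈ range D.P
  · exact Or.inl hP
  · obtain ⟨h1, rfl⟩ := inter_eq_pt hef hz hz' hP
    exact Or.inr ⟨e, ⟨f, h1⟩, rfl⟩

lemma S_edge {s : Set ℂ} (hs : s ∈ D.S) : ∃ e ∈ G.edgeSet, s ⊆ D.Ar e ∧
    ((e ∈ D.U ∧ s = D.Ar e) ∨ (e ∈ D.C ∧ ∃ a ∈ e, s = D.H e a)) := by
  rcases hs with ⟨e, he, rfl⟩ | ⟨e, he, a, ha, rfl⟩
  · exact ⟨e, he.1, subset_rfl, Or.inl ⟨he, rfl⟩⟩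
  · exact ⟨e, C_sub he, H_sub he ha, Or.inr ⟨he, a, ha, rfl⟩⟩

variable [Fintype V]

lemma arcSys : ArcSys D.N D.S where
  finN := (finite_range _).union ((toFinite _).image _)
  finS := by
    refine ((toFinite _).image _).union (((finite_range (fun p : Sym2 V × V => D.H p.1 p.2))).subset ?_)
    rintro s ⟨e, he, a, ha, rfl⟩
    exact ⟨(e, a), rfl⟩
  arc := by
    rintro s (⟨e, he, rfl⟩ | ⟨e, he, a, ha, rfl⟩)
    · induction e with | _ a b =>
      exact ⟨_, _, D.arc a b he.1, U_ends he⟩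
    · exact ⟨_, _, H_arc he ha, H_ends he ha⟩
  disj := by
    intro s hs t ht hst
    obtain ⟨e, he, hse, h1⟩ := S_edge hs
    obtain ⟨f, hf, htf, h2⟩ := S_edge ht
    rintro z ⟨hz, hz'⟩
    by_cases hef : e = f
    · subst hef
      rcases h1 with ⟨h1, rfl⟩ | ⟨h1, a, ha, rfl⟩
      · rcases h2 with ⟨h2, rfl⟩ | ⟨h2, b, hb, rfl⟩
        · exact absurd rfl hst
        · exact absurd h2 h1.2
      · rcases h2 with ⟨h2, rfl⟩ | ⟨h2, b, hb, rfl⟩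
        · exact absurd h1 h2.2
        · have hab : a ≠ b := fun h => hst (by rw [h])
          have := (Sym2.mem_and_mem_iff hab).1 ⟨ha, hb⟩
          subst this
          have h3 : z ∈ D.H s(a, b) a ∩ D.H s(a, b) b := ⟨hz, hz'⟩
          rw [H_inter h1] at h3
          exact Or.inr ⟨_, h1, h3.symm⟩
    · exact diff_edges hef (hse hz) (htf hz')

lemma seg_of_mem {e : Sym2 V} {z : ℂ} (hz : z ∈ D.Ar e) : ∃ s ∈ D.S, z ∈ s ∧ s ⊆ D.Ar e := by
  by_cases he : e ∈ D.C
  · induction e with | _ a b =>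
    rw [← H_union he] at hz
    rcases hz with hz | hz
    · exact ⟨_, Or.inr ⟨_, he, a, Sym2.mem_mk_left _ _, rfl⟩, hz, H_sub he (Sym2.mem_mk_left _ _)⟩
    · exact ⟨_, Or.inr ⟨_, he, b, Sym2.mem_mk_right _ _, rfl⟩, hz, H_sub he (Sym2.mem_mk_right _ _)⟩
  · exact ⟨_, Or.inl ⟨e, ⟨mem_of_mem hz, he⟩, rfl⟩, hz, subset_rfl⟩

lemma S_sub_X {s : Set ℂ} (hs : s ∈ D.S) : s ⊆ D.X := by
  obtain ⟨e, -, h, -⟩ := S_edge hs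
  exact h.trans (Ar_sub_X e)

lemma N_sub_X : D.N ⊆ D.X := by
  rintro z (⟨u, rfl⟩ | ⟨e, he, rfl⟩)
  · exact P_mem_X u
  · exact Ar_sub_X e (pt_mem he)

lemma X_eq : D.N ∪ ⋃₀ D.S = D.X := by
  apply Subset.antisymm
  · rintro z (hz | ⟨s, hs, hz⟩)
    · exact N_sub_X hz
    · exact S_sub_X hs hz
  · rintro z (hz | hz)
    · exact Or.inl (Or.inl hz)
    · obtain ⟨e, he⟩ := mem_iUnion.1 hz
      obtain ⟨s, hs, h, -⟩ := seg_of_mem he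
      exact Or.inr ⟨s, hs, h⟩

lemma Ar_compact (e : Sym2 V) : IsCompact (D.Ar e) := by
  by_cases he : e ∈ G.edgeSet
  · induction e with | _ a b => exact (D.arc a b he).isCompact
  · rw [D.emp e he]; exact isCompact_empty

lemma conn_T {T : Set (Sym2 V)} (hT : (G.deleteEdges T).Preconnected) :
    IsPreconnected (range D.P ∪ ⋃ e ∈ Tᶜ, D.Ar e) := by
  have := conn_graph hT D.P (fun a b => D.Ar s(a, b)) (by
    intro a b h
    rw [SimpleGraph.deleteEdges_adj] at h
    exact ⟨(D.arc a b h.1).preconn, left_mem h.1, right_mem h.1⟩)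
  convert this using 2
  ext z
  simp only [mem_iUnion]
  constructor
  · rintro ⟨e, he, hz⟩
    have := mem_of_mem hz
    induction e with | _ a b =>
    exact ⟨a, b, by rw [SimpleGraph.deleteEdges_adj]; exact ⟨this, he⟩, hz⟩
  · rintro ⟨a, b, h, hz⟩
    rw [SimpleGraph.deleteEdges_adj] at h
    exact ⟨_, h.2, hz⟩

lemma compact_T (T : Set (Sym2 V)) : IsCompact (range D.P ∪ ⋃ e ∈ T, D.Ar e) :=
  (finite_range _).isCompact.union ((toFinite T).isCompact_biUnion fun e _ => Ar_compact e)

lemma tame (hk : KConnected G 3) (hn : 5 ≤ Fintype.card V) : ArcSys.Tame D.N D.S where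
  toArcSys := arcSys
  ne := by
    have : Nonempty V := Fintype.card_pos_iff.1 (by omega)
    exact ⟨_, Or.inl ⟨this.some, rfl⟩⟩
  conn := by
    have h0 : (G.deleteEdges ∅).Preconnected :=
      del_conn hk (S := ∅) (by simp) (by simp) (by simp)
    have := conn_T (D := D) h0
    rw [X_eq]
    simpa [X] using this
  conn2 := by
    intro s hs
    obtain ⟨e, he, hse, h1⟩ := S_edge hs
    have hc : IsPreconnected (range D.P ∪ ⋃ f ∈ ({e} : Set (Sym2 V))ᶜ, D.Ar f) := by
      induction e with | _ a b =>
      exact conn_T (del_one hk hn (SimpleGraph.Adj.ne he))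
    have hother : ∀ f, f ≠ e → D.Ar f ⊆ D.N ∪ ⋃₀ (D.S \ {s}) := by
      intro f hf z hz
      obtain ⟨t, ht, hzt, htf⟩ := seg_of_mem hz
      by_cases hst : t = s
      · subst hst
        exact Or.inl (diff_edges hf hz (hse hzt))
      · exact Or.inr ⟨t, ⟨ht, hst⟩, hzt⟩
    have hmem : ∀ t ∈ D.S \ {s}, ∀ z ∈ t, (∃ f, f ≠ e ∧ z ∈ D.Ar f) ∨ (e ∈ D.C ∧ ∃ b ∈ e, t = D.H e b) := by
      rintro t ⟨ht, hts⟩ z hz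
      obtain ⟨f, hf, htf, h2⟩ := S_edge ht
      by_cases hef : f = e
      · subst hef
        rcases h2 with ⟨h2, rfl⟩ | ⟨h2, b, hb, rfl⟩
        · rcases h1 with ⟨h1, rfl⟩ | ⟨h1, a, ha, rfl⟩
          · exact absurd rfl hts
          · exact absurd h1 h2.2
        · exact Or.inr ⟨h2, b, hb, rfl⟩
      · exact Or.inl ⟨f, hef, htf hz⟩
    rcases h1 with ⟨h1, rfl⟩ | ⟨h1, a, ha, rfl⟩
    · convert hc using 1
      apply Subset.antisymm
      · rintro z ((hz | ⟨f, hf, rfl⟩) | ⟨t, ht, hz⟩)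
        · exact Or.inl hz
        · right
          simp only [mem_iUnion]
          exact ⟨f, fun h => h1.2 (h ▸ hf), pt_mem hf⟩
        · rcases hmem t ht z hz with ⟨f, hf, hz⟩ | ⟨h, -⟩
          · right
            simp only [mem_iUnion]
            exact ⟨f, hf, hz⟩
          · exact absurd h h1.2
      · rintro z (hz | hz)
        · exact Or.inl (Or.inl hz)
        · simp only [mem_iUnion] at hz
          obtain ⟨f, hf, hz⟩ := hz
          exact hother f hf hz
    · obtain ⟨b, rfl⟩ := Sym2.mem_iff_exists.1 ha
      have hb : b ∈ s(a, b) := Sym2.mem_mk_right _ _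
      have hab : a ≠ b := SimpleGraph.Adj.ne he
      have hu := hc.union (D.P b) (Or.inl ⟨b, rfl⟩) (H_arc h1 hb).left_mem (H_arc h1 hb).preconn
      convert hu using 1
      apply Subset.antisymm
      · rintro z ((hz | ⟨f, hf, rfl⟩) | ⟨t, ht, hz⟩)
        · exact Or.inl (Or.inl hz)
        · by_cases hfe : f = s(a, b)
          · subst hfe
            exact Or.inr (H_arc h1 hb).right_mem
          · left; right
            simp only [mem_iUnion]
            exact ⟨f, hfe, pt_mem hf⟩
        · rcases hmem t ht z hz with ⟨f, hf, hz⟩ | ⟨h, c, hc, rfl⟩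
          · left; right
            simp only [mem_iUnion]
            exact ⟨f, hf, hz⟩
          · rw [Sym2.mem_iff] at hc
            rcases hc with rfl | rfl
            · exact absurd rfl ht.2
            · exact Or.inr hz
      · rintro z ((hz | hz) | hz)
        · exact Or.inl (Or.inl hz)
        · simp only [mem_iUnion] at hz
          obtain ⟨f, hf, hz⟩ := hz
          exact hother f hf hz
        · refine Or.inr ⟨_, ⟨Or.inr ⟨_, h1, b, hb, rfl⟩, fun h => ?_⟩, hz⟩
          have h3 : D.P b ∈ D.H s(a, b) a := by
            rw [← (h : D.H s(a, b) b = D.H s(a, b) a)]; exact (H_arc h1 hb).left_mem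
          exact hab (H_range h1 ha h3).symm

end Sys
end OP

namespace OP

lemma access_gen {y : ℂ} {T : Set (Set ℂ)} {M R F : Set ℂ} {o : ℂ} (hT : T.Finite)
    (hTa : ∀ s ∈ T, ∃ e, IsArc s y e) (hM : M.Finite)
    (hd : ∀ s ∈ T, ∀ t ∈ T, s ≠ t → s ∩ t ⊆ M) (hR : IsCompact R) (hy : y ∉ R)
    (hF : Face (⋃₀ T ∪ R) F) (hyF : y ∈ closure F) (ho : o ∈ F) : JoinedIn (F ∪ {y}) o y := by
  have : Finite T := hT
  choose! e he using hTa
  have hcl : IsClosed (R ∪ (M \ {y})) := hR.isClosed.union (hM.subset sdiff_subset).isClosed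
  have hyn : y ∈ (R ∪ (M \ {y}))ᶜ := by
    rintro (h | h)
    · exact hy h
    · exact h.2 rfl
  obtain ⟨ρ, hρ, hb⟩ := Metric.isOpen_iff.1 hcl.isOpen_compl y hyn
  refine accessible (S := fun i : T => i.1) (e := fun i : T => e i.1) (R := R) hρ
    (fun i => he i.1 i.2) ?_ hR ?_ ?_ hyF ho
  · rintro ⟨s, hs⟩ ⟨t, ht⟩ hst z ⟨hz, hzb⟩
    have hzM := hd s hs t ht (fun h => hst (Subtype.ext h)) hz
    by_contra hzy
    exact hb hzb (Or.inr ⟨hzM, hzy⟩)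
  · rw [Set.disjoint_left]
    intro z hz hzb
    exact hb hzb (Or.inl hz)
  · rwa [sUnion_eq_iUnion] at hF

lemma arc_in_face {F : Set ℂ} {o y z : ℂ} (hy : JoinedIn (F ∪ {y}) o y)
    (hz : JoinedIn (F ∪ {z}) o z) (hne : y ≠ z) : ∃ α ⊆ F ∪ {y, z}, IsArc α y z := by
  have h1 : JoinedIn (F ∪ {y, z}) o y := hy.mono (union_subset_union_right _ (by simp))
  have h2 : JoinedIn (F ∪ {y, z}) o z := hz.mono (union_subset_union_right _ (by simp))
  exact OP.JoinedIn.exists_arc (h1.symm.trans h2) hne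

namespace Sys

variable {V : Type} [Fintype V] {G : SimpleGraph V} {D : Sys G}

structure Env (D : Sys G) : Prop where
  k : KConnected G 3
  n : 5 ≤ Fintype.card V
  max1 : ∀ u v α, u ≠ v → IsArc α (D.P u) (D.P v) → α ∩ D.X ⊆ {D.P u, D.P v} → s(u, v) ∈ D.U
  max2 : ∀ u v α e y, u ≠ v → IsArc α (D.P u) (D.P v) → e ∈ D.U → u ∉ e → v ∉ e → y ∈ D.Ar e →
    y ∉ range D.P → α ∩ D.X ⊆ {D.P u, D.P v, y} → G.Adj u v

variable {F F' F'' : Set ℂ} {u v w a b c d : V}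

lemma Env.tame (E : D.Env) : ArcSys.Tame D.N D.S := Sys.tame E.k E.n

lemma closedX : IsClosed D.X := by rw [← X_eq]; exact arcSys.isClosed

lemma Env.inc (E : D.Env) {s : Set ℂ} (hs : s ∈ D.S) (hF : Face D.X F)
    (hne : (closure F ∩ (s \ D.N)).Nonempty) : s ⊆ closure F :=
  E.tame.inc_iff hs (by rw [X_eq]; exact hF) hne

lemma Env.exists_seg (E : D.Env) (u : V) : ∃ s ∈ D.S, D.P u ∈ s := by
  have : Nontrivial V := Fintype.one_lt_card_iff_nontrivial.1 (by have := E.n; omega)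
  obtain ⟨p, hp⟩ := exists_ne u
  obtain ⟨w, hw, -⟩ := exists_nbr E.k E.n hp.symm hp.symm
  obtain ⟨s, hs, h, -⟩ := seg_of_mem (D := D) (left_mem hw)
  exact ⟨s, hs, h⟩

lemma Env.access_vert (E : D.Env) (hF : Face D.X F) (hu : D.P u ∈ closure F) {o : ℂ} (ho : o ∈ F) :
    JoinedIn (F ∪ {D.P u}) o (D.P u) := by
  have hA : ArcSys D.N D.S := arcSys
  refine access_gen (T := {s ∈ D.S | D.P u ∈ s}) (M := D.N)
    (R := (D.N \ {D.P u}) ∪ ⋃₀ {s ∈ D.S | D.P u ∉ s})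
    (hA.finS.subset (sep_subset _ _)) ?_ hA.finN ?_ (hA.isCompact sdiff_subset (sep_subset _ _)) ?_ ?_ hu ho
  · rintro s ⟨hs, hus⟩
    obtain ⟨x, y, h1, h2⟩ := hA.arc s hs
    have : D.P u ∈ ({x, y} : Set ℂ) := by rw [← h2]; exact ⟨hus, Or.inl ⟨u, rfl⟩⟩
    rcases this with h | h
    · exact ⟨y, h ▸ h1⟩
    · exact ⟨x, h ▸ h1.symm⟩
  · intro s hs t ht hst
    exact hA.disj s hs.1 t ht.1 hst
  · rintro (h | ⟨s, hs, h⟩)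
    · exact h.2 rfl
    · exact hs.2 h
  · convert hF using 1
    rw [← X_eq]
    apply Subset.antisymm
    · rintro z (⟨s, hs, hz⟩ | (hz | ⟨s, hs, hz⟩))
      · exact Or.inr ⟨s, hs.1, hz⟩
      · exact Or.inl hz.1
      · exact Or.inr ⟨s, hs.1, hz⟩
    · rintro z (hz | ⟨s, hs, hz⟩)
      · by_cases hzu : z = D.P u
        · subst hzu
          obtain ⟨s, hs, h⟩ := E.exists_seg u
          exact Or.inl ⟨s, ⟨hs, h⟩, h⟩
        · exact Or.inr (Or.inl ⟨hz, hzu⟩)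
      · by_cases h : D.P u ∈ s
        · exact Or.inl ⟨s, ⟨hs, h⟩, hz⟩
        · exact Or.inr (Or.inr ⟨s, ⟨hs, h⟩, hz⟩)

lemma access_mid (hF : Face D.X F) {e : Sym2 V} (he : e ∈ D.U) {y : ℂ} (hy : y ∈ D.Ar e)
    (hyP : y ∉ range D.P) (hyF : y ∈ closure F) {o : ℂ} (ho : o ∈ F) :
    JoinedIn (F ∪ {y}) o y := by
  have hA : ArcSys D.N D.S := arcSys
  induction e with | _ a b =>
  obtain ⟨A₁, A₂, h1, h2, h3, h4⟩ := (D.arc a b he.1).split hy (fun h => hyP ⟨a, h.symm⟩)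
      (fun h => hyP ⟨b, h.symm⟩)
  have hyN : y ∉ D.N := by
    intro h
    have : y ∈ D.Ar s(a, b) ∩ D.N := ⟨hy, h⟩
    rw [U_ends he] at this
    rcases this with h | h
    · exact hyP ⟨a, h.symm⟩
    · exact hyP ⟨b, h.symm⟩
  have heS : D.Ar s(a, b) ∈ D.S := Or.inl ⟨_, he, rfl⟩
  refine access_gen (T := {A₁, A₂}) (M := {y}) (R := D.N ∪ ⋃₀ (D.S \ {D.Ar s(a, b)}))
    (toFinite _) ?_ (toFinite _) ?_ (hA.isCompact subset_rfl sdiff_subset) ?_ ?_ hyF ho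
  · rintro s (rfl | rfl)
    · exact ⟨_, h1.symm⟩
    · exact ⟨_, h2⟩
  · rintro s (rfl | rfl) t (rfl | rfl) hst
    · exact absurd rfl hst
    · rw [h4]
    · rw [inter_comm, h4]
    · exact absurd rfl hst
  · rintro (h | ⟨s, hs, h⟩)
    · exact hyN h
    · exact hyN (hA.disj s hs.1 _ heS hs.2 ⟨h, hy⟩)
  · convert hF using 1
    rw [← X_eq, sUnion_pair, h3]
    apply Subset.antisymm
    · rintro z (hz | (hz | ⟨s, hs, hz⟩))
      · exact Or.inr ⟨_, heS, hz⟩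
      · exact Or.inl hz
      · exact Or.inr ⟨s, hs.1, hz⟩
    · rintro z (hz | ⟨s, hs, hz⟩)
      · exact Or.inr (Or.inl hz)
      · by_cases h : s = D.Ar s(a, b)
        · exact Or.inl (h ▸ hz)
        · exact Or.inr (Or.inr ⟨s, ⟨hs, h⟩, hz⟩)

lemma Env.chord_arc (E : D.Env) (hF : Face D.X F) (huv : u ≠ v) (hu : D.P u ∈ closure F)
    (hv : D.P v ∈ closure F) : ∃ α ⊆ F ∪ {D.P u, D.P v}, IsArc α (D.P u) (D.P v) := by
  obtain ⟨o, ho⟩ := hF.nonempty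
  exact arc_in_face (E.access_vert hF hu ho) (E.access_vert hF hv ho) (fun h => huv (D.inj h))

lemma Env.fact2 (E : D.Env) (hF : Face D.X F) (huv : u ≠ v) (hu : D.P u ∈ closure F)
    (hv : D.P v ∈ closure F) : s(u, v) ∈ D.U := by
  obtain ⟨α, h1, h2⟩ := E.chord_arc hF huv hu hv
  refine E.max1 u v α huv h2 ?_
  rintro z ⟨hz, hzX⟩
  rcases h1 hz with h | h
  · exact absurd hzX (Set.disjoint_left.1 hF.disj h)
  · exact h

lemma Env.fact2' (E : D.Env) (hF : Face D.X F) (hF' : Face D.X F') (hne : F ≠ F') {e : Sym2 V}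
    (he : e ∈ D.U) (heF : D.Ar e ⊆ closure F) (heF' : D.Ar e ⊆ closure F') (huv : u ≠ v)
    (hu : D.P u ∈ closure F) (hv : D.P v ∈ closure F') (hue : u ∉ e) (hve : v ∉ e) : G.Adj u v := by
  obtain ⟨o, ho⟩ := hF.nonempty
  obtain ⟨o', ho'⟩ := hF'.nonempty
  obtain ⟨y, hy, hyP⟩ : ∃ y ∈ D.Ar e, y ∉ range D.P := by
    induction e with | _ a b =>
    obtain ⟨y, hy⟩ := (D.arc a b he.1).int_nonempty
    refine ⟨y, hy.1, fun h => hy.2 ?_⟩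
    rw [← range_inter he.1]
    exact ⟨hy.1, h⟩
  have hyne : ∀ u, y ≠ D.P u := fun u h => hyP ⟨u, h.symm⟩
  obtain ⟨α, h1, h2⟩ := arc_in_face (E.access_vert hF hu ho) (access_mid hF he hy hyP (heF hy) ho)
    (hyne u).symm
  obtain ⟨β, h3, h4⟩ := arc_in_face (access_mid hF' he hy hyP (heF' hy) ho') (E.access_vert hF' hv ho')
    (hyne v)
  have hX : ∀ z ∈ F, z ∉ D.X := fun z h => Set.disjoint_left.1 hF.disj h
  have hX' : ∀ z ∈ F', z ∉ D.X := fun z h => Set.disjoint_left.1 hF'.disj h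
  have hyX : y ∈ D.X := Ar_sub_X e hy
  have hd : α ∩ β ⊆ {y} := by
    rintro z ⟨hz, hz'⟩
    by_contra hzy
    rcases h1 hz with h | h | h
    · rcases h3 hz' with h' | h' | h'
      · exact hne (hF.eq_of_mem hF' h h')
      · exact hzy h'
      · exact hX z h (h' ▸ P_mem_X v)
    · rcases h3 hz' with h' | h' | h'
      · exact hX' z h' (h ▸ P_mem_X u)
      · exact hzy h'
      · exact huv (D.inj (h.symm.trans h'))
    · exact hzy h
  refine E.max2 u v (α ∪ β) e y huv (h2.concat h4 hd) he hue hve hy hyP ?_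
  rintro z ⟨hz | hz, hzX⟩
  · rcases h1 hz with h | h | h
    · exact absurd hzX (hX z h)
    · simp [h]
    · have h : z = y := h
      simp [h]
  · rcases h3 hz with h | h | h
    · exact absurd hzX (hX' z h)
    · simp [h]
    · have h : z = D.P v := h
      simp [h]

lemma Env.fact3 (E : D.Env) (hF : Face D.X F) (huv : u ≠ v) (hu : D.P u ∈ closure F)
    (hv : D.P v ∈ closure F) : D.Ar s(u, v) ⊆ closure F := by
  obtain ⟨α, hα, hαa⟩ := E.chord_arc hF huv hu hv
  have hU := E.fact2 hF huv hu hv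
  have hX : ∀ z ∈ F, z ∉ D.X := fun z h => Set.disjoint_left.1 hF.disj h
  have hAa := D.arc u v hU.1
  have hinter : α ∩ D.Ar s(u, v) = {D.P u, D.P v} := by
    apply Subset.antisymm
    · rintro z ⟨hz, hz'⟩
      rcases hα hz with h | h
      · exact absurd (Ar_sub_X _ hz') (hX z h)
      · exact h
    · rintro z (rfl | rfl)
      · exact ⟨hαa.left_mem, hAa.left_mem⟩
      · exact ⟨hαa.right_mem, hAa.right_mem⟩
  set J := α ∪ D.Ar s(u, v) with hJ
  have hJc : IsClosed J := hαa.isClosed.union hAa.isClosed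
  -- points of other edges in `J` are endpoints
  have hJe : ∀ f, f ≠ s(u, v) → ∀ z ∈ D.Ar f, z ∈ J → z = D.P u ∨ z = D.P v := by
    rintro f hf z hz (h | h)
    · rcases hα h with h | h
      · exact absurd (Ar_sub_X _ hz) (hX z h)
      · exact h
    · have h1 := diff_edges hf hz h
      have h2 : z ∈ D.Ar s(u, v) ∩ D.N := ⟨h, h1⟩
      rw [U_ends hU] at h2
      exact h2
  have hJv : ∀ w, D.P w ∈ J → w = u ∨ w = v := by
    rintro w (h | h)
    · rcases hα h with h | h | h
      · exact absurd (P_mem_X w) (hX _ h)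
      · exact Or.inl (D.inj h)
      · exact Or.inr (D.inj h)
    · have := D.vert _ _ h
      rwa [Sym2.mem_iff] at this
  have hS : ({u, v} : Set V).ncard < 3 := by
    have := ncard_insert_le u {v}
    rw [ncard_singleton] at this
    omega
  have hcon := E.k {u, v} hS
  have hW := conn_graph hcon.preconnected (fun w => D.P w.1) (fun a b => D.Ar s(a.1, b.1))
    (fun a b h => ⟨(D.arc a.1 b.1 h).preconn, left_mem h, right_mem h⟩)
  set W := (range fun w : ↑({u, v} : Set V)ᶜ => D.P w.1) ∪
    ⋃ (a : ↑({u, v} : Set V)ᶜ) (b : ↑({u, v} : Set V)ᶜ) (_ : (G.induce ({u, v} : Set V)ᶜ).Adj a b),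
      D.Ar s(a.1, b.1) with hWdef
  have hvW : ∀ w, w ≠ u → w ≠ v → D.P w ∈ W := fun w h1 h2 =>
    Or.inl ⟨⟨w, by simp [h1, h2]⟩, rfl⟩
  have heW : ∀ a b, G.Adj a b → a ≠ u → a ≠ v → b ≠ u → b ≠ v → D.Ar s(a, b) ⊆ W := by
    intro a b h h1 h2 h3 h4 z hz
    right
    simp only [mem_iUnion]
    exact ⟨⟨a, by simp [h1, h2]⟩, ⟨b, by simp [h3, h4]⟩, h, hz⟩
  have hWJ : Disjoint W J := by
    rw [Set.disjoint_left]
    rintro z (⟨⟨w, hw⟩, rfl⟩ | hz) hzJ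
    · have := hJv w hzJ
      simp only [mem_compl_iff, mem_insert_iff, mem_singleton_iff] at hw
      exact hw this
    · simp only [mem_iUnion] at hz
      obtain ⟨⟨a, ha⟩, ⟨b, hb⟩, hab, hz⟩ := hz
      simp only [mem_compl_iff, mem_insert_iff, mem_singleton_iff, not_or] at ha hb
      have hne : s(a, b) ≠ s(u, v) := by
        intro h
        rw [Sym2.eq_iff] at h
        grind
      rcases hJe _ hne z hz hzJ with rfl | rfl
      · have := D.vert _ _ hz
        rw [Sym2.mem_iff] at this
        grind
      · have := D.vert _ _ hz
        rw [Sym2.mem_iff] at this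
        grind
  obtain ⟨w₀⟩ := hcon.nonempty
  have hw0 : D.P w₀.1 ∈ W := Or.inl ⟨w₀, rfl⟩
  obtain ⟨I, hI, hw0I⟩ := face_of_notMem (Set.disjoint_left.1 hWJ hw0)
  have hWI : W ⊆ I := hI.subset_of hW hWJ ⟨_, hw0, hw0I⟩
  have heI : ∀ a b, G.Adj a b → s(a, b) ≠ s(u, v) → D.Ar s(a, b) \ {D.P u, D.P v} ⊆ I := by
    have main : ∀ a b, G.Adj a b → a ≠ u → a ≠ v → D.Ar s(a, b) \ {D.P u, D.P v} ⊆ I := by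
      intro a b hab h1 h2
      have hpa : D.P a ∈ I := hWI (hvW a h1 h2)
      have hne : s(a, b) ≠ s(u, v) := by
        intro h
        rw [Sym2.eq_iff] at h
        grind
      by_cases hb : b = u ∨ b = v
      · have : D.Ar s(a, b) \ {D.P u, D.P v} ⊆ D.Ar s(a, b) \ {D.P b} := by
          rintro z ⟨hz, hz'⟩
          refine ⟨hz, fun h => hz' ?_⟩
          rcases hb with rfl | rfl
          · exact Or.inl h
          · exact Or.inr h
        refine this.trans ?_
        refine hI.subset_of (D.arc a b hab).diff_right_preconn ?_ ⟨D.P a, ⟨left_mem hab, ?_⟩, hpa⟩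
        · rw [Set.disjoint_left]
          rintro z ⟨hz, hzb⟩ hzJ
          have hv' : ∀ x, z = D.P x → (x = u ∨ x = v) → False := by
            rintro x rfl hx
            have := D.vert _ _ hz
            rw [Sym2.mem_iff] at this
            rcases this with rfl | rfl
            · grind
            · exact hzb rfl
          rcases hJe _ hne z hz hzJ with h | h
          · exact hv' u h (Or.inl rfl)
          · exact hv' v h (Or.inr rfl)
        · intro h
          exact hab.ne (D.inj h)
      · push Not at hb
        exact sdiff_subset.trans ((heW a b hab h1 h2 hb.1 hb.2).trans hWI)
    intro a b hab hne
    by_cases ha : a = u ∨ a = v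
    · by_cases hb : b = u ∨ b = v
      · exfalso
        apply hne
        have := hab.ne
        rw [Sym2.eq_iff]
        grind
      · push Not at hb
        rw [Sym2.eq_swap]
        exact main b a hab.symm hb.1 hb.2
    · push Not at ha
      exact main a b hab ha.1 ha.2
  obtain ⟨R₁, R₂, hR1, hR2, hR12, hRall, hc1, hc2⟩ := jordan hαa hAa hinter
  obtain ⟨O, hO, hOI, hOc⟩ : ∃ O, Face J O ∧ O ≠ I ∧ J ⊆ closure O := by
    rcases hRall I hI with h | h
    · exact ⟨R₂, hR2, fun h' => hR12 (h.symm.trans h'.symm), hc2⟩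
    · exact ⟨R₁, hR1, fun h' => hR12 (h'.trans h), hc1⟩
  have hOX : Disjoint O D.X := by
    rw [Set.disjoint_left]
    have hnI : ∀ z ∈ O, z ∉ I := fun z h h' => hOI (hO.eq_of_mem hI h h')
    have hnJ : ∀ z ∈ O, z ∉ J := fun z h => Set.disjoint_left.1 hO.disj h
    rintro z hz (⟨w, rfl⟩ | h)
    · by_cases hw : w = u ∨ w = v
      · apply hnJ _ hz
        rcases hw with rfl | rfl
        · exact Or.inl hαa.left_mem
        · exact Or.inl hαa.right_mem
      · push Not at hw
        exact hnI _ hz (hWI (hvW w hw.1 hw.2))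
    · obtain ⟨e, he⟩ := mem_iUnion.1 h
      have heE := mem_of_mem he
      induction e with | _ a b =>
      by_cases hne : s(a, b) = s(u, v)
      · rw [hne] at he
        exact hnJ z hz (Or.inr he)
      · refine hnI z hz (heI a b heE hne ⟨he, ?_⟩)
        rintro (rfl | rfl)
        · exact hnJ _ hz (Or.inl hαa.left_mem)
        · exact hnJ _ hz (Or.inl hαa.right_mem)
  obtain ⟨p, hp, hpne⟩ := hαa.int_nonempty
  have hpF : p ∈ F := (hα hp).resolve_right hpne
  have hOF : O ⊆ F := by
    have : (F ∩ O).Nonempty := by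
      have hpO : p ∈ closure O := hOc (Or.inl hp)
      exact mem_closure_iff.1 hpO F (hF.isOpen closedX) hpF
    exact hF.subset_of hO.preconn hOX (by rwa [inter_comm])
  exact (subset_union_right.trans hOc).trans (closure_mono hOF)

end Sys
end OP

namespace OP

lemma theta_seg {N : Set ℂ} {S : Set (Set ℂ)} (hA : ArcSys N S) {s₀ s₁ s₂ t₁ t₂ T : Set ℂ}
    {p q x y : ℂ} (h0 : s₀ ∈ S) (h1 : s₁ ∈ S) (h2 : s₂ ∈ S) (k1 : t₁ ∈ S) (k2 : t₂ ∈ S)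
    (a0 : IsArc s₀ p q ∧ s₀ ∩ N = {p, q}) (a1 : IsArc s₁ p x ∧ s₁ ∩ N = {p, x})
    (a2 : IsArc s₂ x q ∧ s₂ ∩ N = {x, q}) (b1 : IsArc t₁ p y ∧ t₁ ∩ N = {p, y})
    (b2 : IsArc t₂ y q ∧ t₂ ∩ N = {y, q}) (hxy : x ≠ y) (hT : IsPreconnected T)
    (d0 : Disjoint T s₀) (d1 : Disjoint T s₁) (d2 : Disjoint T s₂) (e1 : Disjoint T t₁)
    (e2 : Disjoint T t₂) (c0 : s₀ ⊆ closure T) (cx : x ∈ closure T) (cy : y ∈ closure T) : False := by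
  have hpq := a0.1.ne
  have hpx := a1.1.ne
  have hxq := a2.1.ne
  have hpy := b1.1.ne
  have hyq := b2.1.ne
  have key : ∀ {s t : Set ℂ} {i j k l : ℂ}, s ∈ S → t ∈ S → s ∩ N = {i, j} → t ∩ N = {k, l} →
      ¬ ((i = k ∨ i = l) ∧ (j = k ∨ j = l)) → ∀ z, z ∈ s → z ∈ t → (z = i ∨ z = j) ∧ (z = k ∨ z = l) := by
    intro s t i j k l hs ht hi hk hne z hz hz'
    have hst : s ≠ t := by
      rintro rfl
      apply hne
      have hi' : i ∈ ({k, l} : Set ℂ) := by rw [← hk, hi]; simp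
      have hj' : j ∈ ({k, l} : Set ℂ) := by rw [← hk, hi]; simp
      exact ⟨hi', hj'⟩
    have hzN := hA.disj s hs t ht hst ⟨hz, hz'⟩
    have h1 : z ∈ s ∩ N := ⟨hz, hzN⟩
    have h2 : z ∈ t ∩ N := ⟨hz', hzN⟩
    rw [hi] at h1
    rw [hk] at h2
    exact ⟨h1, h2⟩
  have q01 := key h0 h1 a0.2 a1.2 (by grind)
  have q02 := key h0 h2 a0.2 a2.2 (by grind)
  have q03 := key h0 k1 a0.2 b1.2 (by grind)
  have q04 := key h0 k2 a0.2 b2.2 (by grind)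
  have q12 := key h1 h2 a1.2 a2.2 (by grind)
  have q34 := key k1 k2 b1.2 b2.2 (by grind)
  have q13 := key h1 k1 a1.2 b1.2 (by grind)
  have q14 := key h1 k2 a1.2 b2.2 (by grind)
  have q23 := key h2 k1 a2.2 b1.2 (by grind)
  have q24 := key h2 k2 a2.2 b2.2 (by grind)
  have hB : IsArc (s₁ ∪ s₂) p q := a1.1.concat a2.1 (by
    rintro z ⟨hz, hz'⟩
    have := q12 z hz hz'
    show z = x
    grind)
  have hC : IsArc (t₁ ∪ t₂) p q := b1.1.concat b2.1 (by
    rintro z ⟨hz, hz'⟩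
    have := q34 z hz hz'
    show z = y
    grind)
  refine theta (S := T) a0.1 hB hC ?_ ?_ ?_ hT d0 (disjoint_union_right.2 ⟨d1, d2⟩)
    (disjoint_union_right.2 ⟨e1, e2⟩) ?_ ?_ ?_
  · apply Subset.antisymm
    · rintro z ⟨hz, hz' | hz'⟩
      · exact (q01 z hz hz').1
      · exact (q02 z hz hz').1
    · rintro z (rfl | rfl)
      · exact ⟨a0.1.left_mem, hB.left_mem⟩
      · exact ⟨a0.1.right_mem, hB.right_mem⟩
  · apply Subset.antisymm
    · rintro z ⟨hz, hz' | hz'⟩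
      · exact (q03 z hz hz').1
      · exact (q04 z hz hz').1
    · rintro z (rfl | rfl)
      · exact ⟨a0.1.left_mem, hC.left_mem⟩
      · exact ⟨a0.1.right_mem, hC.right_mem⟩
  · apply Subset.antisymm
    · rintro z ⟨hz | hz, hz' | hz'⟩
      · have := q13 z hz hz'
        simp only [mem_insert_iff, mem_singleton_iff]; grind
      · have := q14 z hz hz'
        simp only [mem_insert_iff, mem_singleton_iff]; grind
      · have := q23 z hz hz'
        simp only [mem_insert_iff, mem_singleton_iff]; grind
      · have := q24 z hz hz'
        simp only [mem_insert_iff, mem_singleton_iff]; grind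
    · rintro z (rfl | rfl)
      · exact ⟨hB.left_mem, hC.left_mem⟩
      · exact ⟨hB.right_mem, hC.right_mem⟩
  · obtain ⟨z, hz⟩ := a0.1.int_nonempty
    exact ⟨z, c0 hz.1, hz⟩
  · refine ⟨x, cx, Or.inl a1.1.right_mem, ?_⟩
    rintro (h | h)
    · exact hpx h.symm
    · exact hxq h
  · refine ⟨y, cy, Or.inl b1.1.right_mem, ?_⟩
    rintro (h | h)
    · exact hpy h.symm
    · exact hyq h

namespace Sys

variable {V : Type} [Fintype V] {G : SimpleGraph V} {D : Sys G}
variable {F F' F'' : Set ℂ} {u v w z a b c d : V}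

lemma Cr.disj {e f : Sym2 V} (h : D.Cr e f) {u : V} (hu : u ∈ e) (hu' : u ∈ f) : False := by
  obtain ⟨v, rfl⟩ := Sym2.mem_iff_exists.1 hu
  obtain ⟨w, rfl⟩ := Sym2.mem_iff_exists.1 hu'
  have hvw : v ≠ w := fun h' => h.1 (by rw [h'])
  obtain ⟨z, hz⟩ := h.2
  rw [D.adj u v w hvw] at hz
  exact hz

lemma U_seg (h : s(u, v) ∈ D.U) : IsArc (D.Ar s(u, v)) (D.P u) (D.P v) ∧
    D.Ar s(u, v) ∩ D.N = {D.P u, D.P v} := ⟨D.arc u v h.1, U_ends h⟩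

lemma H_seg {e : Sym2 V} (he : e ∈ D.C) (ha : a ∈ e) : IsArc (D.H e a) (D.P a) (D.pt e) ∧
    D.H e a ∩ D.N = {D.P a, D.pt e} := ⟨H_arc he ha, H_ends he ha⟩

lemma H_seg' {e : Sym2 V} (he : e ∈ D.C) (ha : a ∈ e) : IsArc (D.H e a) (D.pt e) (D.P a) ∧
    D.H e a ∩ D.N = {D.pt e, D.P a} := ⟨(H_arc he ha).symm, by rw [pair_comm]; exact H_ends he ha⟩

lemma U_S {e : Sym2 V} (h : e ∈ D.U) : D.Ar e ∈ D.S := Or.inl ⟨e, h, rfl⟩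

lemma H_S {e : Sym2 V} (he : e ∈ D.C) (ha : a ∈ e) : D.H e a ∈ D.S := Or.inr ⟨e, he, a, ha, rfl⟩

lemma face_disj (hF : Face D.X F) {s : Set ℂ} (hs : s ∈ D.S) : Disjoint F s :=
  hF.disj.mono_right (S_sub_X hs)

lemma Env.vert3 (E : D.Env) (hF : Face D.X F) (huv : u ≠ v) (huw : u ≠ w) (huz : u ≠ z)
    (hvw : v ≠ w) (hvz : v ≠ z) (hwz : w ≠ z) (hu : D.P u ∈ closure F) (hv : D.P v ∈ closure F)
    (hw : D.P w ∈ closure F) (hz : D.P z ∈ closure F) : False := by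
  have h0 := E.fact2 hF huv hu hv
  have h1 := E.fact2 hF huw hu hw
  have h2 := E.fact2 hF hvw.symm hw hv
  have h3 := E.fact2 hF huz hu hz
  have h4 := E.fact2 hF hvz.symm hz hv
  exact theta_seg arcSys (U_S h0) (U_S h1) (U_S h2) (U_S h3) (U_S h4) (U_seg h0) (U_seg h1) (U_seg h2)
    (U_seg h3) (U_seg h4) (fun h => hwz (D.inj h)) hF.preconn (face_disj hF (U_S h0))
    (face_disj hF (U_S h1)) (face_disj hF (U_S h2)) (face_disj hF (U_S h3)) (face_disj hF (U_S h4))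
    (E.fact3 hF huv hu hv) hw hz

lemma Env.lemmaK (E : D.Env) (hF : Face D.X F) (h : D.Cr s(a, b) s(c, d))
    (haF : D.H s(a, b) a ⊆ closure F) : D.H s(c, d) c ⊆ closure F ∨ D.H s(c, d) d ⊆ closure F := by
  by_contra hcon
  push Not at hcon
  obtain ⟨hc, hd⟩ := hcon
  have he : s(a, b) ∈ D.C := ⟨_, h⟩
  have hf : s(c, d) ∈ D.C := ⟨_, h.symm⟩
  have ha' : a ∈ s(a, b) := Sym2.mem_mk_left _ _
  have hb' : b ∈ s(a, b) := Sym2.mem_mk_right _ _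
  have hc' : c ∈ s(c, d) := Sym2.mem_mk_left _ _
  have hd' : d ∈ s(c, d) := Sym2.mem_mk_right _ _
  have hab : a ≠ b := SimpleGraph.Adj.ne (C_sub he)
  have hb : ¬ D.H s(a, b) b ⊆ closure F := by
    intro h'
    exact (E.fact2 hF hab (haF (H_arc he ha').left_mem) (h' (H_arc he hb').left_mem)).2 he
  set K₀ := range D.P ∪ ⋃ e ∈ ({s(a, b), s(c, d)} : Set (Sym2 V))ᶜ, D.Ar e with hK0
  have hK0c : IsCompact K₀ := compact_T _
  set K₁ := K₀ ∪ D.H s(a, b) a with hK1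
  have hPK : ∀ u, D.P u ∈ K₀ := fun u => Or.inl ⟨u, rfl⟩
  have hK0X : K₀ ⊆ D.X := by
    rintro z (hz | hz)
    · exact Or.inl hz
    · simp only [mem_iUnion] at hz
      obtain ⟨g, -, hz⟩ := hz
      exact Ar_sub_X g hz
  have hK1X : K₁ ⊆ D.X := union_subset hK0X (S_sub_X (H_S he ha'))
  have hptK : D.pt s(a, b) ∈ K₁ := Or.inr (H_arc he ha').right_mem
  have hbad : ∀ (e : Sym2 V) (x : V) (heC : e ∈ D.C) (hx : x ∈ e), D.pt e = D.pt s(a, b) →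
      ¬ D.H e x ⊆ closure F → ∀ z ∈ closure F, z ∈ D.H e x → z ∈ K₁ := by
    intro e x heC hx hpt hn z hz hz'
    by_cases hzN : z ∈ D.N
    · have : z ∈ D.H e x ∩ D.N := ⟨hz', hzN⟩
      rw [H_ends heC hx] at this
      rcases this with rfl | h
      · exact Or.inl (hPK x)
      · rw [show z = D.pt e from h, hpt]; exact hptK
    · exact absurd (E.inc (H_S heC hx) hF ⟨z, hz, hz', hzN⟩) hn
  have hF1 : Face K₁ F := by
    refine face_of (hF.isOpen closedX) hF.preconn hF.nonempty (hF.disj.mono_right hK1X) ?_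
    intro z hz
    rcases hF.closure_subset closedX hz with h' | h'
    · exact Or.inl h'
    right
    rcases h' with h' | h'
    · exact Or.inl (Or.inl h')
    · obtain ⟨g, hg⟩ := mem_iUnion.1 h'
      by_cases h1 : g = s(a, b)
      · rw [h1, ← H_union he] at hg
        rcases hg with hg | hg
        · exact Or.inr hg
        · exact hbad _ b he hb' rfl hb z hz hg
      · by_cases h2 : g = s(c, d)
        · rw [h2, ← H_union hf] at hg
          rcases hg with hg | hg
          · exact hbad _ c hf hc' h.symm.pt_eq hc z hz hg
          · exact hbad _ d hf hd' h.symm.pt_eq hd z hz hg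
        · left; right
          simp only [mem_iUnion]
          exact ⟨g, by simp [h1, h2], hg⟩
  have hArK : ∀ z ∈ D.Ar s(a, b), z ∈ K₀ → z = D.P a ∨ z = D.P b := by
    rintro z hz (hz' | hz')
    · have : z ∈ D.Ar s(a, b) ∩ range D.P := ⟨hz, hz'⟩
      rwa [range_inter (C_sub he)] at this
    · simp only [mem_iUnion] at hz'
      obtain ⟨g, hg, hz'⟩ := hz'
      simp only [mem_compl_iff, mem_insert_iff, mem_singleton_iff, not_or] at hg
      by_cases hzP : z ∈ range D.P
      · have : z ∈ D.Ar s(a, b) ∩ range D.P := ⟨hz, hzP⟩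
        rwa [range_inter (C_sub he)] at this
      · have := inter_eq_pt (Ne.symm hg.1) hz hz' hzP
        exact absurd (h.uniq this.1).symm hg.2
  obtain ⟨G₀, hG0, hFG⟩ := exists_bigger (K := K₀) subset_union_left hF1
  have hsub : (K₀ ∩ D.H s(a, b) a).Subsingleton := by
    have : ∀ z ∈ K₀ ∩ D.H s(a, b) a, z = D.P a := by
      rintro z ⟨hz, hz'⟩
      rcases hArK z (H_sub he ha' hz') hz with h | h
      · exact h
      · rw [h] at hz' ⊢
        rw [H_range he ha' hz']
    intro x hx y hy
    rw [this x hx, this y hy]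
  have hintG : D.Ar s(a, b) \ {D.P a, D.P b} ⊆ G₀ := by
    obtain ⟨q, hq⟩ := arcSys.int_nonempty (H_S he ha')
    have hqA := H_sub he ha' hq.1
    have hqP : q ≠ D.P a ∧ q ≠ D.P b :=
      ⟨fun h => hq.2 (Or.inl ⟨a, h.symm⟩), fun h => hq.2 (Or.inl ⟨b, h.symm⟩)⟩
    have hqK : q ∉ K₀ := fun h' => (hArK q hqA h').elim hqP.1 hqP.2
    have hqG : q ∈ G₀ :=
      (hG0.closure_subset hK0c.isClosed (closure_mono hFG (haF hq.1))).resolve_right hqK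
    refine hG0.subset_of (D.arc a b (C_sub he)).int_preconn ?_ ⟨q, ⟨hqA, ?_⟩, hqG⟩
    · rw [Set.disjoint_left]
      rintro z ⟨hz, hz'⟩ hzK
      exact hz' (hArK z hz hzK)
    · rintro (h | h)
      · exact hqP.1 h
      · exact hqP.2 h
  obtain ⟨z, hz⟩ := arcSys.int_nonempty (H_S he hb')
  have hzA := H_sub he hb' hz.1
  have hzP : z ≠ D.P a ∧ z ≠ D.P b :=
      ⟨fun h => hz.2 (Or.inl ⟨a, h.symm⟩), fun h => hz.2 (Or.inl ⟨b, h.symm⟩)⟩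
  have hzK1 : z ∉ K₁ := by
    rintro (h' | h')
    · exact (hArK z hzA h').elim hzP.1 hzP.2
    · have : z ∈ D.H s(a, b) a ∩ D.H s(a, b) b := ⟨h', hz.1⟩
      rw [H_inter he] at this
      exact hz.2 (Or.inr ⟨_, he, this.symm⟩)
  obtain ⟨F', hF', hzF'⟩ := face_of_notMem hzK1
  have hzG : z ∈ G₀ := hintG ⟨hzA, by rintro (h | h); exacts [hzP.1 h, hzP.2 h]⟩
  have hF'G : F' ⊆ G₀ := Face.subset_of_subset subset_union_left hF' hG0 ⟨z, hzF', hzG⟩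
  have := pendant hK0c (H_arc he ha') hsub hG0 hF1 hF' hFG hF'G
  rw [← this] at hzF'
  exact Set.disjoint_left.1 hF.disj hzF' (Ar_sub_X _ hzA)

lemma Env.false_struct (E : D.Env) (hF : Face D.X F) {e : Sym2 V} (he : e ∈ D.C) (ha : a ∈ e)
    (haF : D.H e a ⊆ closure F) : ∃ f c, D.Cr e f ∧ c ∈ f ∧ D.H f c ⊆ closure F ∧ a ≠ c ∧
      (∀ w, D.P w ∈ closure F → w = a ∨ w = c) := by
  obtain ⟨f, hef⟩ := id he
  have : ∃ c ∈ f, D.H f c ⊆ closure F := by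
    obtain ⟨b, rfl⟩ := Sym2.mem_iff_exists.1 ha
    induction f with | _ c d =>
    rcases E.lemmaK hF hef haF with h | h
    · exact ⟨c, Sym2.mem_mk_left _ _, h⟩
    · exact ⟨d, Sym2.mem_mk_right _ _, h⟩
  obtain ⟨c, hc, hcF⟩ := this
  have hac : a ≠ c := by rintro rfl; exact hef.disj ha hc
  have hf : f ∈ D.C := ⟨e, hef.symm⟩
  refine ⟨f, c, hef, hc, hcF, hac, ?_⟩
  intro w hw
  by_contra hcon
  push Not at hcon
  have hPa := haF (H_arc he ha).left_mem
  have hPc := hcF (H_arc hf hc).left_mem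
  have h0 := E.fact2 hF hac hPa hPc
  have h1 := E.fact2 hF hcon.1.symm hPa hw
  have h2 := E.fact2 hF hcon.2 hw hPc
  have hs := H_seg' hf hc
  rw [← hef.pt_eq] at hs
  exact theta_seg arcSys (U_S h0) (U_S h1) (U_S h2) (H_S he ha) (H_S hf hc) (U_seg h0) (U_seg h1)
    (U_seg h2) (H_seg he ha) hs (fun h => pt_notMem he ⟨w, h⟩) hF.preconn (face_disj hF (U_S h0))
    (face_disj hF (U_S h1)) (face_disj hF (U_S h2)) (face_disj hF (H_S he ha)) (face_disj hF (H_S hf hc))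
    (E.fact3 hF hac hPa hPc) hw (haF (H_arc he ha).right_mem)

lemma Env.false_segs (E : D.Env) (hF : Face D.X F) {e : Sym2 V} (he : e ∈ D.C) (ha : a ∈ e)
    (haF : D.H e a ⊆ closure F) : ∃ f c, D.Cr e f ∧ c ∈ f ∧ D.H f c ⊆ closure F ∧ a ≠ c ∧
      ∀ s ∈ D.S, s ⊆ closure F → s = D.H e a ∨ s = D.H f c ∨ s = D.Ar s(a, c) := by
  obtain ⟨f, c, hef, hc, hcF, hac, hV⟩ := E.false_struct hF he ha haF
  refine ⟨f, c, hef, hc, hcF, hac, ?_⟩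
  have hf : f ∈ D.C := ⟨e, hef.symm⟩
  rintro s (⟨g, hg, rfl⟩ | ⟨e', he', a', ha', rfl⟩) hsF
  · right; right
    induction g with | _ x y =>
    have h1 := hV x (hsF (left_mem hg.1))
    have h2 := hV y (hsF (right_mem hg.1))
    have h3 : x ≠ y := SimpleGraph.Adj.ne hg.1
    congr 1
    rw [Sym2.eq_iff]
    grind
  · obtain ⟨f', c', hef', hc', hcF', hac', hV'⟩ := E.false_struct hF he' ha' hsF
    have hf' : f' ∈ D.C := ⟨e', hef'.symm⟩
    have hPa := haF (H_arc he ha).left_mem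
    have hPc := hcF (H_arc hf hc).left_mem
    have ha1 := hV a' (hsF (H_arc he' ha').left_mem)
    have hc1 := hV c' (hcF' (H_arc hf' hc').left_mem)
    have hpt : D.pt e' = D.pt e := by
      by_contra hne
      have h0 := E.fact2 hF hac hPa hPc
      have key : ∀ {e' f' : Sym2 V} (he' : e' ∈ D.C) (hf' : f' ∈ D.C) (hx : D.pt f' = D.pt e')
          (hne : D.pt e' ≠ D.pt e) (ha' : a ∈ e') (hc' : c ∈ f') (h1 : D.pt e' ∈ closure F), False := by
        intro e' f' he' hf' hx hne ha' hc' h1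
        have hs := H_seg' hf hc
        rw [← hef.pt_eq] at hs
        have hs' := H_seg' hf' hc'
        rw [hx] at hs'
        exact theta_seg arcSys (U_S h0) (H_S he' ha') (H_S hf' hc') (H_S he ha) (H_S hf hc) (U_seg h0)
          (H_seg he' ha') hs' (H_seg he ha) hs hne hF.preconn (face_disj hF (U_S h0))
          (face_disj hF (H_S he' ha')) (face_disj hF (H_S hf' hc')) (face_disj hF (H_S he ha))
          (face_disj hF (H_S hf hc))
          (E.fact3 hF hac hPa hPc) h1 (haF (H_arc he ha).right_mem)
      have hp := hsF (H_arc he' ha').right_mem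
      rcases ha1 with rfl | rfl
      · rcases hc1 with rfl | rfl
        · exact hac' rfl
        · exact key he' hf' hef'.symm.pt_eq hne ha' hc' hp
      · rcases hc1 with rfl | rfl
        · refine key hf' he' hef'.pt_eq ?_ hc' ha' ?_
          · rw [hef'.symm.pt_eq]; exact hne
          · rw [hef'.symm.pt_eq]; exact hp
        · exact hac' rfl
    rcases pt_eq_iff he he' hpt.symm with rfl | h
    · rcases ha1 with rfl | rfl
      · exact Or.inl rfl
      · exact (hef.disj ha' hc).elim
    · have := hef.uniq h
      subst this
      rcases ha1 with rfl | rfl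
      · exact (hef.disj ha ha').elim
      · exact Or.inr (Or.inl rfl)

lemma Env.has_seg (E : D.Env) (hF : Face D.X F) : ∃ s ∈ D.S, s ⊆ closure F := by
  by_contra hcon
  push Not at hcon
  have T := E.tame
  have hall := T.dual_conn {F} ⟨F, rfl⟩ (by rintro _ rfl; rw [X_eq]; exact hF)
    (by rintro _ rfl s hs h; exact absurd h (hcon s hs))
  have : Nonempty V := Fintype.card_pos_iff.1 (by have := E.n; omega)
  obtain ⟨s, hs, -⟩ := E.exists_seg this.some
  obtain ⟨F₁, F₂, h1, h2, h3, -⟩ := T.two_faces hs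
  exact h3 ((hall F₁ h1).trans (hall F₂ h2).symm)

lemma Env.true_segs (E : D.Env) (hF : Face D.X F) (ht : ∀ s ∈ D.Hs, ¬ s ⊆ closure F) :
    ∃ a b c, a ≠ b ∧ b ≠ c ∧ a ≠ c ∧ D.P a ∈ closure F ∧ D.P b ∈ closure F ∧ D.P c ∈ closure F ∧
      (∀ w, D.P w ∈ closure F → w = a ∨ w = b ∨ w = c) ∧
      ∀ s ∈ D.S, s ⊆ closure F → s = D.Ar s(a, b) ∨ s = D.Ar s(b, c) ∨ s = D.Ar s(a, c) := by
  have hseg : ∀ s ∈ D.S, s ⊆ closure F → ∃ x y, x ≠ y ∧ D.P x ∈ closure F ∧ D.P y ∈ closure F ∧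
      s = D.Ar s(x, y) := by
    rintro s (⟨g, hg, rfl⟩ | hs) hsF
    · induction g with | _ x y =>
      exact ⟨x, y, SimpleGraph.Adj.ne hg.1, hsF (left_mem hg.1), hsF (right_mem hg.1), rfl⟩
    · exact absurd hsF (ht s hs)
  obtain ⟨s, hs, hsF⟩ := E.has_seg hF
  obtain ⟨a, b, hab, ha, hb, rfl⟩ := hseg s hs hsF
  obtain ⟨c, hc, hca, hcb⟩ : ∃ c, D.P c ∈ closure F ∧ c ≠ a ∧ c ≠ b := by
    by_contra hcon
    push Not at hcon
    refine E.tame.two_segs hs (by rw [X_eq]; exact hF) ?_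
    intro t ht' htF
    obtain ⟨x, y, hxy, hx, hy, rfl⟩ := hseg t ht' htF
    have h1 := hcon x hx
    have h2 := hcon y hy
    congr 1
    rw [Sym2.eq_iff]
    grind
  have hV : ∀ w, D.P w ∈ closure F → w = a ∨ w = b ∨ w = c := by
    intro w hw
    by_contra hcon
    push Not at hcon
    exact E.vert3 hF hab hca.symm hcon.1.symm hcb.symm hcon.2.1.symm hcon.2.2.symm ha hb hc hw
  refine ⟨a, b, c, hab, hcb.symm, hca.symm, ha, hb, hc, hV, ?_⟩
  intro t ht' htF
  obtain ⟨x, y, hxy, hx, hy, rfl⟩ := hseg t ht' htF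
  have h1 := hV x hx
  have h2 := hV y hy
  have : s(x, y) = s(a, b) ∨ s(x, y) = s(b, c) ∨ s(x, y) = s(a, c) := by
    simp only [Sym2.eq_iff]
    grind
  rcases this with h | h | h <;> simp [h]

end Sys
end OP

namespace OP
namespace Sys

variable {V : Type} [Fintype V] {G : SimpleGraph V} {D : Sys G}
variable {F F' F'' : Set ℂ} {u v w z a b c d e f : V}

lemma Env.true_third (E : D.Env) (hF : Face D.X F) (ht : ∀ s ∈ D.Hs, ¬ s ⊆ closure F) (hab : a ≠ b)
    (ha : D.P a ∈ closure F) (hb : D.P b ∈ closure F) : ∃ d, d ≠ a ∧ d ≠ b ∧ D.P d ∈ closure F ∧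
      ∀ w, D.P w ∈ closure F → w = a ∨ w = b ∨ w = d := by
  obtain ⟨d, h1, h2, h3⟩ : ∃ d, d ≠ a ∧ d ≠ b ∧ D.P d ∈ closure F := by
    obtain ⟨x, y, z, hxy, hyz, hxz, hx, hy, hz, -⟩ := E.true_segs hF ht
    by_contra hcon
    push Not at hcon
    have h1 : x = a ∨ x = b := by
      by_contra h; push Not at h; exact hcon x h.1 h.2 hx
    have h2 : y = a ∨ y = b := by
      by_contra h; push Not at h; exact hcon y h.1 h.2 hy
    have h3 : z = a ∨ z = b := by
      by_contra h; push Not at h; exact hcon z h.1 h.2 hz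
    grind
  refine ⟨d, h1, h2, h3, ?_⟩
  intro w hw
  by_contra hcon
  push Not at hcon
  exact E.vert3 hF hab h1.symm hcon.1.symm h2.symm hcon.2.1.symm hcon.2.2.symm ha hb h3 hw

lemma true_seg (ht : ∀ s ∈ D.Hs, ¬ s ⊆ closure F) : ∀ s ∈ D.S, s ⊆ closure F → ∃ x y, x ≠ y ∧
    D.P x ∈ closure F ∧ D.P y ∈ closure F ∧ s = D.Ar s(x, y) := by
  rintro s (⟨g, hg, rfl⟩ | hs) hsF
  · induction g with | _ x y =>
    exact ⟨x, y, SimpleGraph.Adj.ne hg.1, hsF (left_mem hg.1), hsF (right_mem hg.1), rfl⟩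
  · exact absurd hsF (ht s hs)

lemma Env.cover (E : D.Env) (W : Set (Set ℂ)) (hne : W.Nonempty) (hW : ∀ F ∈ W, Face D.X F)
    (hcl : ∀ F ∈ W, ∀ s ∈ D.S, s ⊆ closure F → ∃ F₁ ∈ W, ∃ F₂ ∈ W, F₁ ≠ F₂ ∧ s ⊆ closure F₁ ∧
      s ⊆ closure F₂) (w : V) : ∃ F ∈ W, D.P w ∈ closure F := by
  have T := E.tame
  have hW' : ∀ F ∈ W, Face (D.N ∪ ⋃₀ D.S) F := by rw [X_eq]; exact hW
  have hall := T.dual_conn W hne hW' (by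
    intro F hF s hs hsF F'' hF'' hsF''
    obtain ⟨F₁, h1, F₂, h2, h12, h3, h4⟩ := hcl F hF s hs hsF
    rcases T.only_two hs (hW' _ h1) (hW' _ h2) hF'' h3 h4 hsF'' h12 with h | h
    · rw [h]; exact h1
    · rw [h]; exact h2)
  obtain ⟨s, hs, hws⟩ := E.exists_seg w
  obtain ⟨F₁, -, h1, -, -, h2, -⟩ := T.two_faces hs
  exact ⟨F₁, hall F₁ h1, h2 hws⟩

lemma exists_not_mem (hn : 5 ≤ Fintype.card V) (a b c d : V) : ∃ w, w ≠ a ∧ w ≠ b ∧ w ≠ c ∧ w ≠ d := by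
  classical
  obtain ⟨z, hz⟩ : ∃ z, z ∉ ({a, b, c, d} : Finset V) := by
    by_contra hcon
    push Not at hcon
    have h1 : Finset.univ ⊆ ({a, b, c, d} : Finset V) := fun z _ => hcon z
    have h2 := Finset.card_le_card h1
    have h3 : ({a, b, c, d} : Finset V).card ≤ 4 := Finset.card_le_four
    rw [Finset.card_univ] at h2
    omega
  simp only [Finset.mem_insert, Finset.mem_singleton, not_or] at hz
  exact ⟨z, hz⟩

lemma nocross_mem {g h : Sym2 V} (hgh : g ≠ h) (hc : ¬ D.Cr g h) {z : ℂ} (hz : z ∈ D.Ar g)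
    (hz' : z ∈ D.Ar h) : ∃ w, z = D.P w ∧ w ∈ g ∧ w ∈ h := by
  by_cases hP : z ∈ range D.P
  · obtain ⟨w, rfl⟩ := hP
    exact ⟨w, rfl, D.vert _ _ hz, D.vert _ _ hz'⟩
  · exact absurd ⟨hgh, z, ⟨hz, hz'⟩, hP⟩ hc

lemma U_nocross {g h : Sym2 V} (hg : g ∈ D.U) : ¬ D.Cr g h := fun hc => hg.2 ⟨h, hc⟩
lemma U_nocross' {g h : Sym2 V} (hg : g ∈ D.U) : ¬ D.Cr h g := fun hc => hg.2 ⟨h, hc.symm⟩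

lemma arcSys_of (Q : Set (Sym2 V)) (hQ : Q ⊆ G.edgeSet) (hc : ∀ g ∈ Q, ∀ h ∈ Q, ¬ D.Cr g h) :
    ArcSys (range D.P) (D.Ar '' Q) where
  finN := finite_range _
  finS := (toFinite Q).image _
  arc := by
    rintro s ⟨g, hg, rfl⟩
    have := hQ hg
    induction g with | _ x y =>
    exact ⟨_, _, D.arc x y this, range_inter this⟩
  disj := by
    rintro s ⟨g, hg, rfl⟩ t ⟨h, hh, rfl⟩ hst z ⟨hz, hz'⟩
    have hgh : g ≠ h := fun e => hst (by rw [e])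
    obtain ⟨w, rfl, -⟩ := nocross_mem hgh (hc g hg h hh) hz hz'
    exact ⟨w, rfl⟩

lemma Env.cross_of (E : D.Env) (hF : Face D.X F) (hab : a ≠ b) (hbc : b ≠ c) (hac : a ≠ c)
    (ha : D.P a ∈ closure F) (hb : D.P b ∈ closure F) (hc : D.P c ∈ closure F)
    (hda : d ≠ a) (hdb : d ≠ b) (hdc : d ≠ c) (hea : e ≠ a) (heb : e ≠ b) (hec : e ≠ c)
    (had : s(a, d) ∈ D.U) (hdb' : s(d, b) ∈ D.U) (heb' : s(e, b) ∈ D.U) (hce : s(c, e) ∈ D.U)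
    (hcd : G.Adj c d) (hae : G.Adj a e) (hde : d ≠ e) : D.Cr s(c, d) s(a, e) := by
  by_contra hcon
  have habU := E.fact2 hF hab ha hb
  have hX : ∀ z ∈ F, z ∉ D.X := fun z h => Set.disjoint_left.1 hF.disj h
  set Q : Set (Sym2 V) := {s(a, b), s(a, d), s(d, b), s(a, e), s(e, b)} with hQ
  have hA : ArcSys (range D.P) (D.Ar '' Q) := by
    refine arcSys_of Q ?_ ?_
    · rintro g (rfl | rfl | rfl | rfl | rfl)
      exacts [habU.1, had.1, hdb'.1, hae, heb'.1]
    · have hu : ∀ g ∈ Q, g ∈ D.U ∨ g = s(a, e) := by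
        rintro g (rfl | rfl | rfl | rfl | rfl)
        exacts [Or.inl habU, Or.inl had, Or.inl hdb', Or.inr rfl, Or.inl heb']
      intro g hg h hh
      rcases hu g hg with h1 | h1
      · exact U_nocross h1
      · rcases hu h hh with h2 | h2
        · exact U_nocross' h2
        · rw [h1, h2]; exact fun hcr => hcr.1 rfl
  have hend : ∀ {x y : V}, G.Adj x y → IsArc (D.Ar s(x, y)) (D.P x) (D.P y) ∧
      D.Ar s(x, y) ∩ range D.P = {D.P x, D.P y} := fun h => ⟨D.arc _ _ h, range_inter h⟩
  set T : Set ℂ := (F ∪ {D.P c}) ∪ (D.Ar s(c, d) \ {D.P d}) ∪ (D.Ar s(c, e) \ {D.P e}) with hT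
  have hceA : G.Adj c e := hce.1
  have hPcd : D.P c ∈ D.Ar s(c, d) \ {D.P d} := ⟨left_mem hcd, fun h => hdc (D.inj h).symm⟩
  have hPce : D.P c ∈ D.Ar s(c, e) \ {D.P e} := ⟨left_mem hceA, fun h => hec (D.inj h).symm⟩
  have hTp : IsPreconnected T := by
    refine IsPreconnected.union (D.P c) (Or.inl (Or.inr rfl)) hPce ?_ (D.arc c e hceA).diff_right_preconn
    refine IsPreconnected.union (D.P c) (Or.inr rfl) hPcd ?_ (D.arc c d hcd).diff_right_preconn
    refine hF.preconn.subset_closure subset_union_left ?_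
    exact union_subset subset_closure (singleton_subset_iff.2 hc)
  have hTd : ∀ g ∈ Q, Disjoint T (D.Ar g) := by
    intro g hg
    have hcg : c ∉ g := by
      rcases hg with rfl | rfl | rfl | rfl | rfl <;> rw [Sym2.mem_iff] <;> grind
    have hne1 : s(c, d) ≠ g := fun h => hcg (h ▸ Sym2.mem_mk_left _ _)
    have hne2 : s(c, e) ≠ g := fun h => hcg (h ▸ Sym2.mem_mk_left _ _)
    have hn1 : ¬ D.Cr s(c, d) g := by
      rcases hg with rfl | rfl | rfl | rfl | rfl
      exacts [U_nocross' habU, U_nocross' had, U_nocross' hdb', hcon, U_nocross' heb']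
    rw [Set.disjoint_left]
    rintro z (((hz | hz) | ⟨hz, hzd⟩) | ⟨hz, hze⟩) hz'
    · exact hX z hz (Ar_sub_X _ hz')
    · rw [show z = D.P c from hz] at hz'
      exact hcg (D.vert _ _ hz')
    · obtain ⟨w, rfl, hw1, hw2⟩ := nocross_mem hne1 hn1 hz hz'
      rw [Sym2.mem_iff] at hw1
      rcases hw1 with rfl | rfl
      · exact hcg hw2
      · exact hzd rfl
    · obtain ⟨w, rfl, hw1, hw2⟩ := nocross_mem hne2 (U_nocross hce) hz hz'
      rw [Sym2.mem_iff] at hw1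
      rcases hw1 with rfl | rfl
      · exact hcg hw2
      · exact hze rfl
  have hm : ∀ g ∈ Q, D.Ar g ∈ D.Ar '' Q := fun g hg => ⟨g, hg, rfl⟩
  have q0 : s(a, b) ∈ Q := by simp [hQ]
  have q1 : s(a, d) ∈ Q := by simp [hQ]
  have q2 : s(d, b) ∈ Q := by simp [hQ]
  have q3 : s(a, e) ∈ Q := by simp [hQ]
  have q4 : s(e, b) ∈ Q := by simp [hQ]
  refine theta_seg hA (hm _ q0) (hm _ q1) (hm _ q2) (hm _ q3) (hm _ q4) (hend habU.1) (hend had.1)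
    (hend hdb'.1) (hend hae) (hend heb'.1) (fun h => hde (D.inj h)) hTp (hTd _ q0) (hTd _ q1)
    (hTd _ q2) (hTd _ q3) (hTd _ q4) ?_ ?_ ?_
  · refine (E.fact3 hF hab ha hb).trans (closure_mono ?_)
    exact fun z hz => Or.inl (Or.inl (Or.inl hz))
  · have h1 : D.P d ∈ closure (D.Ar s(c, d) \ {D.P c, D.P d}) :=
      (D.arc c d hcd).subset_closure_int (right_mem hcd)
    refine closure_mono ?_ h1
    exact fun z hz => Or.inl (Or.inr ⟨hz.1, fun h => hz.2 (Or.inr h)⟩)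
  · have h1 : D.P e ∈ closure (D.Ar s(c, e) \ {D.P c, D.P e}) :=
      (D.arc c e hceA).subset_closure_int (right_mem hceA)
    refine closure_mono ?_ h1
    exact fun z hz => Or.inr ⟨hz.1, fun h => hz.2 (Or.inr h)⟩

lemma Env.true_nbr (E : D.Env) (hF : Face D.X F) (ht : ∀ s ∈ D.Hs, ¬ s ⊆ closure F) :
    ∃ s ∈ D.S, s ⊆ closure F ∧ ∃ F', Face D.X F' ∧ F' ≠ F ∧ s ⊆ closure F' ∧
      ∃ t ∈ D.Hs, t ⊆ closure F' := by
  by_contra hcon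
  push Not at hcon
  have T := E.tame
  obtain ⟨a, b, c, hab, hbc, hac, ha, hb, hc, hV, -⟩ := E.true_segs hF ht
  have nb : ∀ x y, x ≠ y → D.P x ∈ closure F → D.P y ∈ closure F → ∃ F', Face D.X F' ∧ F' ≠ F ∧
      D.Ar s(x, y) ⊆ closure F' ∧ (∀ s ∈ D.Hs, ¬ s ⊆ closure F') ∧ D.P x ∈ closure F' ∧
      D.P y ∈ closure F' ∧ ∃ d, d ≠ x ∧ d ≠ y ∧ D.P d ∈ closure F' ∧
      ∀ w, D.P w ∈ closure F' → w = x ∨ w = y ∨ w = d := by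
    intro x y hxy hx hy
    have hU := E.fact2 hF hxy hx hy
    obtain ⟨F', h1, h2, h3⟩ := T.other (F := F) (U_S hU)
    rw [X_eq] at h1
    have h4 := hcon _ (U_S hU) (E.fact3 hF hxy hx hy) F' h1 h2 h3
    have hx' := h3 (left_mem hU.1)
    have hy' := h3 (right_mem hU.1)
    exact ⟨F', h1, h2, h3, h4, hx', hy', E.true_third h1 h4 hxy hx' hy'⟩
  -- the third vertex of a neighbour is not in `F`
  have third : ∀ x y z, x ≠ y → x ≠ z → y ≠ z → D.P x ∈ closure F → D.P y ∈ closure F →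
      D.P z ∈ closure F → ∀ F', Face D.X F' → F' ≠ F → (∀ s ∈ D.Hs, ¬ s ⊆ closure F') →
      D.P x ∈ closure F' → D.P y ∈ closure F' → D.P z ∉ closure F' := by
    intro x y z hxy hxz hyz hx hy hz F' hF' hne ht' hx' hy' hz'
    have hbig : ∀ F₀, (F₀ = F ∨ F₀ = F') → ∀ w, D.P w ∈ closure F₀ → w = x ∨ w = y ∨ w = z := by
      rintro F₀ hF₀ w hw
      by_contra hcn
      push Not at hcn
      rcases hF₀ with h | h
      · rw [h] at hw
        exact E.vert3 hF hxy hxz hcn.1.symm hyz hcn.2.1.symm hcn.2.2.symm hx hy hz hw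
      · rw [h] at hw
        exact E.vert3 hF' hxy hxz hcn.1.symm hyz hcn.2.1.symm hcn.2.2.symm hx' hy' hz' hw
    have hin : ∀ F₀, (F₀ = F ∨ F₀ = F') → ∀ w, (w = x ∨ w = y ∨ w = z) → D.P w ∈ closure F₀ := by
      rintro F₀ (rfl | rfl) w (rfl | rfl | rfl) <;> assumption
    obtain ⟨w, w1, w2, w3, -⟩ := exists_not_mem E.n x y z z
    obtain ⟨F₀, h1, h2⟩ := E.cover {F, F'} ⟨F, by simp⟩ (by rintro _ (rfl | rfl) <;> assumption) (by
      intro F₀ hF₀ s hs hsF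
      refine ⟨F, by simp, F', by simp, hne.symm, ?_⟩
      have : ∃ p q, p ≠ q ∧ D.P p ∈ closure F₀ ∧ D.P q ∈ closure F₀ ∧ s = D.Ar s(p, q) := by
        rcases hF₀ with rfl | rfl
        · exact true_seg ht s hs hsF
        · exact true_seg ht' s hs hsF
      obtain ⟨p, q, hpq, hp, hq, rfl⟩ := this
      have h1 := hbig F₀ hF₀ p hp
      have h2 := hbig F₀ hF₀ q hq
      exact ⟨E.fact3 hF hpq (hin F (Or.inl rfl) p h1) (hin F (Or.inl rfl) q h2),
        E.fact3 hF' hpq (hin F' (Or.inr rfl) p h1) (hin F' (Or.inr rfl) q h2)⟩) w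
    have := hbig F₀ h1 w h2
    grind
  obtain ⟨F₁, hF1, hne1, he1, ht1, ha1, hb1, d, hda, hdb, hd1, hV1⟩ := nb a b hab ha hb
  obtain ⟨F₂, hF2, hne2, he2, ht2, hb2, hc2, e, heb, hec, he2', hV2⟩ := nb b c hbc hb hc
  obtain ⟨F₃, hF3, hne3, he3, ht3, ha3, hc3, f, hfa, hfc, hf3, hV3⟩ := nb a c hac ha hc
  have hc1 : D.P c ∉ closure F₁ := third a b c hab hac hbc ha hb hc F₁ hF1 hne1 ht1 ha1 hb1
  have ha2 : D.P a ∉ closure F₂ :=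
    third b c a hbc hab.symm hac.symm hb hc ha F₂ hF2 hne2 ht2 hb2 hc2
  have hb3 : D.P b ∉ closure F₃ := third a c b hac hab hbc.symm ha hc hb F₃ hF3 hne3 ht3 ha3 hc3
  have hdc : d ≠ c := by rintro rfl; exact hc1 hd1
  have hea : e ≠ a := by rintro rfl; exact ha2 he2'
  have hfb : f ≠ b := by rintro rfl; exact hb3 hf3
  have hcd : G.Adj c d := E.fact2' hF hF1 hne1.symm (E.fact2 hF hab ha hb) (E.fact3 hF hab ha hb) he1
    hdc.symm hc hd1 (by rw [Sym2.mem_iff]; grind) (by rw [Sym2.mem_iff]; grind)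
  have hae : G.Adj a e := E.fact2' hF hF2 hne2.symm (E.fact2 hF hbc hb hc) (E.fact3 hF hbc hb hc) he2
    hea.symm ha he2' (by rw [Sym2.mem_iff]; grind) (by rw [Sym2.mem_iff]; grind)
  have hbf : G.Adj b f := E.fact2' hF hF3 hne3.symm (E.fact2 hF hac ha hc) (E.fact3 hF hac ha hc) he3
    hfb.symm hb hf3 (by rw [Sym2.mem_iff]; grind) (by rw [Sym2.mem_iff]; grind)
  have hX1 : d ≠ e → D.Cr s(c, d) s(a, e) := fun hde =>
    E.cross_of hF hab hbc hac ha hb hc hda hdb hdc hea heb hec (E.fact2 hF1 hda.symm ha1 hd1)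
      (E.fact2 hF1 hdb hd1 hb1) (E.fact2 hF2 heb he2' hb2) (E.fact2 hF2 hec.symm hc2 he2') hcd hae hde
  have hX2 : d ≠ f → D.Cr s(c, d) s(b, f) := fun hdf =>
    E.cross_of hF hab.symm hac hbc hb ha hc hdb hda hdc hfb hfa hfc (E.fact2 hF1 hdb.symm hb1 hd1)
      (E.fact2 hF1 hda hd1 ha1) (E.fact2 hF3 hfa hf3 ha3) (E.fact2 hF3 hfc.symm hc3 hf3) hcd hbf hdf
  have hU1 : s(c, e) ∈ D.U := E.fact2 hF2 hec.symm hc2 he2'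
  have hU2 : s(c, f) ∈ D.U := E.fact2 hF3 hfc.symm hc3 hf3
  have hde : d = e := by
    by_contra hde
    have h1 := hX1 hde
    by_cases hdf : d = f
    · rw [← hdf] at hU2
      exact U_nocross hU2 h1
    · have h2 := h1.uniq (hX2 hdf)
      rw [Sym2.eq_iff] at h2
      grind
  have hdf : d = f := by
    by_contra hdf
    rw [← hde] at hU1
    exact U_nocross hU1 (hX2 hdf)
  subst hde
  subst hdf
  have h12 : F₁ ≠ F₂ := fun h => ha2 (h ▸ ha1)
  have h13 : F₁ ≠ F₃ := fun h => hb3 (h ▸ hb1)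
  have h23 : F₂ ≠ F₃ := fun h => hb3 (h ▸ hb2)
  obtain ⟨w, w1, w2, w3, w4⟩ := exists_not_mem E.n a b c d
  have hVall : ∀ F₀ ∈ ({F, F₁, F₂, F₃} : Set (Set ℂ)), ∀ w, D.P w ∈ closure F₀ → w = a ∨ w = b ∨ w = c ∨ w = d := by
    rintro F₀ (rfl | rfl | rfl | rfl) w hw
    · have := hV w hw; grind
    · have := hV1 w hw; grind
    · have := hV2 w hw; grind
    · have := hV3 w hw; grind
  have hpair : ∀ p q, p ≠ q → (p = a ∨ p = b ∨ p = c ∨ p = d) → (q = a ∨ q = b ∨ q = c ∨ q = d) →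
      ∃ A ∈ ({F, F₁, F₂, F₃} : Set (Set ℂ)), ∃ B ∈ ({F, F₁, F₂, F₃} : Set (Set ℂ)), A ≠ B ∧
        D.P p ∈ closure A ∧ D.P q ∈ closure A ∧ D.P p ∈ closure B ∧ D.P q ∈ closure B := by
    have m0 : F ∈ ({F, F₁, F₂, F₃} : Set (Set ℂ)) := by simp
    have m1 : F₁ ∈ ({F, F₁, F₂, F₃} : Set (Set ℂ)) := by simp
    have m2 : F₂ ∈ ({F, F₁, F₂, F₃} : Set (Set ℂ)) := by simp
    have m3 : F₃ ∈ ({F, F₁, F₂, F₃} : Set (Set ℂ)) := by simp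
    rintro p q hpq (rfl | rfl | rfl | rfl) (rfl | rfl | rfl | rfl) <;> first
      | exact absurd rfl hpq
      | exact ⟨F, m0, F₁, m1, hne1.symm, by assumption, by assumption, by assumption, by assumption⟩
      | exact ⟨F, m0, F₂, m2, hne2.symm, by assumption, by assumption, by assumption, by assumption⟩
      | exact ⟨F, m0, F₃, m3, hne3.symm, by assumption, by assumption, by assumption, by assumption⟩
      | exact ⟨F₁, m1, F₂, m2, h12, by assumption, by assumption, by assumption, by assumption⟩
      | exact ⟨F₁, m1, F₃, m3, h13, by assumption, by assumption, by assumption, by assumption⟩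
      | exact ⟨F₂, m2, F₃, m3, h23, by assumption, by assumption, by assumption, by assumption⟩
  have hfaces : ∀ F₀ ∈ ({F, F₁, F₂, F₃} : Set (Set ℂ)), Face D.X F₀ := by
    rintro _ (rfl | rfl | rfl | rfl) <;> assumption
  obtain ⟨F₀, h1, h2⟩ := E.cover {F, F₁, F₂, F₃} ⟨F, by simp⟩ hfaces (by
      intro F₀ hF₀ s hs hsF
      have ht0 : ∀ s ∈ D.Hs, ¬ s ⊆ closure F₀ := by
        rcases hF₀ with rfl | rfl | rfl | rfl <;> assumption
      obtain ⟨p, q, hpq, hp, hq, rfl⟩ := true_seg ht0 s hs hsF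
      obtain ⟨A, hA, B, hB, hAB, g1, g2, g3, g4⟩ := hpair p q hpq (hVall F₀ hF₀ p hp) (hVall F₀ hF₀ q hq)
      exact ⟨A, hA, B, hB, hAB, E.fact3 (hfaces A hA) hpq g1 g2, E.fact3 (hfaces B hB) hpq g3 g4⟩) w
  have := hVall F₀ h1 w h2
  grind

end Sys
end OP

namespace OP

lemma dcount {α β : Type*} {A : Set α} {B : Set β} (hA : A.Finite) (hB : B.Finite) (r : α → β → Prop)
    (m n : ℕ) (h1 : ∀ a ∈ A, m ≤ {b | b ∈ B ∧ r a b}.ncard)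
    (h2 : ∀ b ∈ B, {a | a ∈ A ∧ r a b}.ncard ≤ n) : A.ncard * m ≤ B.ncard * n := by
  classical
  rw [ncard_eq_toFinset_card A hA, ncard_eq_toFinset_card B hB]
  refine Finset.card_mul_le_card_mul r ?_ ?_
  · intro a ha
    have := h1 a (by simpa using ha)
    rw [← ncard_coe_finset]
    convert this using 2
    ext b
    simp [Finset.bipartiteAbove]
  · intro b hb
    have := h2 b (by simpa using hb)
    rw [← ncard_coe_finset]
    convert this using 2
    ext b
    simp [Finset.bipartiteBelow]

lemma pair_le {α : Type*} (a b : α) : ({a, b} : Set α).ncard ≤ 2 := by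
  have := ncard_insert_le a ({b} : Set α)
  rwa [ncard_singleton] at this

lemma ncard_le_two {α : Type*} {s : Set α} (a b : α) (h : ∀ x ∈ s, x = a ∨ x = b) : s.ncard ≤ 2 := by
  have h1 : s ⊆ {a, b} := fun x hx => by simpa using h x hx
  exact (ncard_le_ncard h1 (toFinite _)).trans (pair_le a b)

lemma ncard_le_three {α : Type*} {s : Set α} (a b c : α) (h : ∀ x ∈ s, x = a ∨ x = b ∨ x = c) :
    s.ncard ≤ 3 := by
  have h1 : s ⊆ {a, b, c} := fun x hx => by simpa using h x hx
  refine (ncard_le_ncard h1 (toFinite _)).trans ((ncard_insert_le _ _).trans ?_)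
  have := pair_le b c
  omega

lemma two_le_ncard {α : Type*} {s : Set α} (hs : s.Finite) {a b : α} (ha : a ∈ s) (hb : b ∈ s)
    (h : a ≠ b) : 2 ≤ s.ncard := by
  rw [← ncard_pair h]
  exact ncard_le_ncard (by rintro x (rfl | rfl) <;> assumption) hs

namespace Sys
variable {V : Type} [Fintype V] {G : SimpleGraph V} {D : Sys G}

lemma H_ne {e f : Sym2 V} {a c : V} (hef : D.Cr e f) (ha : a ∈ e) (hc : c ∈ f) (hac : a ≠ c) :
    D.H e a ≠ D.H f c := by
  intro h
  have h1 : D.P a ∈ D.H e a := (H_arc ⟨f, hef⟩ ha).left_mem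
  rw [h] at h1
  exact hac (H_range ⟨e, hef.symm⟩ hc h1)

theorem Env.count (E : D.Env) :
    (10 / 3 : ℝ) * ((Fintype.card V : ℝ) - 2) ≤ (G.edgeSet.ncard : ℝ) := by
  classical
  have T := E.tame
  have hCf : D.C.Finite := toFinite _
  have hUf : D.U.Finite := toFinite _
  have hSf : D.S.Finite := T.finS
  have hHf : D.Hs.Finite := hSf.subset subset_union_right
  have hFf : {F | Face D.X F}.Finite := by
    have := T.finite_faces
    rwa [X_eq] at this
  set Fa : Set (Set ℂ) := {F | Face D.X F ∧ ∃ t ∈ D.Hs, t ⊆ closure F} with hFa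
  set Tr : Set (Set ℂ) := {F | Face D.X F ∧ ∀ t ∈ D.Hs, ¬ t ⊆ closure F} with hTr
  have hFaf : Fa.Finite := hFf.subset fun F h => h.1
  have hTrf : Tr.Finite := hFf.subset fun F h => h.1
  have hfsum : {F | Face D.X F}.ncard ≤ Fa.ncard + Tr.ncard := by
    refine (ncard_le_ncard (t := Fa ∪ Tr) ?_ (hFaf.union hTrf)).trans (ncard_union_le _ _)
    intro F hF
    by_cases h : ∃ t ∈ D.Hs, t ⊆ closure F
    · exact Or.inl ⟨hF, h⟩
    · push Not at h
      exact Or.inr ⟨hF, h⟩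
  have hm : G.edgeSet.ncard = D.U.ncard + D.C.ncard := by
    rw [← ncard_union_eq (disjoint_left.2 fun e h1 h2 => h1.2 h2) hUf hCf]
    congr 1
    ext e
    constructor
    · intro h
      by_cases he : e ∈ D.C
      · exact Or.inr he
      · exact Or.inl ⟨h, he⟩
    · rintro (h | h)
      · exact h.1
      · exact C_sub h
  have hpt : D.C.ncard * 1 ≤ (D.pt '' D.C).ncard * 2 := by
    refine dcount hCf (hCf.image _) (fun e z => D.pt e = z) 1 2 ?_ ?_
    · intro e he
      rw [Nat.one_le_iff_ne_zero, ← Nat.pos_iff_ne_zero, ncard_pos ((hCf.image D.pt).subset fun _ h => h.1)]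
      exact ⟨D.pt e, ⟨e, he, rfl⟩, rfl⟩
    · rintro _ ⟨e, he, rfl⟩
      obtain ⟨f, hf⟩ := he
      refine ncard_le_two e f ?_
      rintro g ⟨hg, hge⟩
      rcases pt_eq_iff ⟨f, hf⟩ hg hge.symm with h | h
      · exact Or.inl h
      · exact Or.inr (h.uniq hf)
  have hN : D.N.ncard = Fintype.card V + (D.pt '' D.C).ncard := by
    have h1 : (range D.P).ncard = Fintype.card V := by
      rw [← image_univ, ncard_image_of_injective _ D.inj, ncard_univ, Nat.card_eq_fintype_card]
    rw [← h1]
    refine ncard_union_eq (disjoint_left.2 ?_) (finite_range _) (hCf.image _)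
    rintro _ h1 ⟨e, he, rfl⟩
    exact pt_notMem he h1
  have hHs : D.Hs.ncard * 1 ≤ D.C.ncard * 2 := by
    refine dcount hHf hCf (fun s e => ∃ a ∈ e, s = D.H e a) 1 2 ?_ ?_
    · rintro s ⟨e, he, a, ha, rfl⟩
      rw [Nat.one_le_iff_ne_zero, ← Nat.pos_iff_ne_zero, ncard_pos (hCf.subset fun _ h => h.1)]
      exact ⟨e, he, a, ha, rfl⟩
    · intro e he
      induction e with | _ u v =>
      refine ncard_le_two (D.H s(u, v) u) (D.H s(u, v) v) ?_
      rintro s ⟨-, a, ha, rfl⟩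
      rw [Sym2.mem_iff] at ha
      rcases ha with rfl | rfl <;> simp
  have hS : D.S.ncard ≤ D.U.ncard + D.Hs.ncard :=
    (ncard_union_le _ _).trans (by have := ncard_image_le (f := D.Ar) hUf; omega)
  have h23 : D.S.ncard * 2 ≤ {F | Face D.X F}.ncard * 3 := by
    refine dcount hSf hFf (fun s F => s ⊆ closure F) 2 3 ?_ ?_
    · intro s hs
      obtain ⟨F₁, F₂, h1, h2, h12, c1, c2, -⟩ := T.two_faces hs
      rw [X_eq] at h1 h2
      exact two_le_ncard (hFf.subset fun _ h => h.1) ⟨h1, c1⟩ ⟨h2, c2⟩ h12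
    · intro F hF
      by_cases h : ∃ t ∈ D.Hs, t ⊆ closure F
      · obtain ⟨_, ⟨e, he, a, ha, rfl⟩, hsF⟩ := h
        obtain ⟨f, c, -, -, -, -, hall⟩ := E.false_segs hF he ha hsF
        exact ncard_le_three _ _ _ fun s hs => hall s hs.1 hs.2
      · push Not at h
        obtain ⟨a, b, c, -, -, -, -, -, -, -, hall⟩ := E.true_segs hF h
        exact ncard_le_three _ _ _ fun s hs => hall s hs.1 hs.2
  have h22 : Fa.ncard * 2 ≤ D.Hs.ncard * 2 := by
    refine dcount hFaf hHf (fun F s => s ⊆ closure F) 2 2 ?_ ?_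
    · rintro F ⟨hF, _, ⟨e, he, a, ha, rfl⟩, hsF⟩
      obtain ⟨f, c, hef, hc, hcF, hac, -⟩ := E.false_segs hF he ha hsF
      exact two_le_ncard (hHf.subset fun _ h => h.1) ⟨⟨e, he, a, ha, rfl⟩, hsF⟩
        ⟨⟨f, ⟨e, hef.symm⟩, c, hc, rfl⟩, hcF⟩ (H_ne hef ha hc hac)
    · intro s hs
      have hs' : s ∈ D.S := Or.inr hs
      obtain ⟨F₁, F₂, h1, h2, h12, c1, c2, hall⟩ := T.two_faces hs'
      refine ncard_le_two F₁ F₂ ?_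
      rintro F ⟨⟨hF, -⟩, hsF⟩
      exact hall F (by rwa [X_eq]) (T.nonempty_of_inc hs' hsF)
  have hTF : Tr.ncard ≤ Fa.ncard := by
    have key : ∀ F : Set ℂ, ∃ F' s, F ∈ Tr → (s ∈ D.S ∧ s ⊆ closure F ∧ F' ∈ Fa ∧ F' ≠ F ∧
        s ⊆ closure F') := by
      intro F
      by_cases hF : F ∈ Tr
      · obtain ⟨s, hs, hsF, F', h1, h2, h3, h4⟩ := E.true_nbr hF.1 hF.2
        exact ⟨F', s, fun _ => ⟨hs, hsF, ⟨h1, h4⟩, h2, h3⟩⟩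
      · exact ⟨∅, ∅, fun h => absurd h hF⟩
    choose φ σ hφ using key
    refine ncard_le_ncard_of_injOn φ (fun F hF => (hφ F hF).2.2.1) ?_ hFaf
    intro F hF F' hF' heq
    obtain ⟨a1, a2, a3, a4, a5⟩ := hφ F hF
    obtain ⟨b1, b2, b3, b4, b5⟩ := hφ F' hF'
    rw [← heq] at b3 b4 b5
    obtain ⟨hK, _, ⟨e, he, a, ha, rfl⟩, hsF⟩ := a3
    obtain ⟨f, c, hef, hc, hcF, hac, hall⟩ := E.false_segs hK he ha hsF
    have hh1 : D.H e a ∈ D.Hs := ⟨e, he, a, ha, rfl⟩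
    have hh2 : D.H f c ∈ D.Hs := ⟨f, ⟨e, hef.symm⟩, c, hc, rfl⟩
    have e1 : σ F = D.Ar s(a, c) := by
      rcases hall _ a1 a5 with h | h | h
      · exact absurd (h ▸ a2) (hF.2 _ hh1)
      · exact absurd (h ▸ a2) (hF.2 _ hh2)
      · exact h
    have e2 : σ F' = D.Ar s(a, c) := by
      rcases hall _ b1 b5 with h | h | h
      · exact absurd (h ▸ b2) (hF'.2 _ hh1)
      · exact absurd (h ▸ b2) (hF'.2 _ hh2)
      · exact h
    have hx := X_eq (D := D)
    have := T.only_two a1 (by rw [hx]; exact hK) (by rw [hx]; exact hF.1) (by rw [hx]; exact hF'.1) a5 a2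
      (by rw [e1, ← e2]; exact b2) a4
    rcases this with h | h
    · exact absurd h.symm b4
    · exact h.symm
  have heu := (T.euler T.ne T.conn).2
  rw [X_eq] at heu
  have n5 := E.n
  have fin : 10 * Fintype.card V ≤ 3 * G.edgeSet.ncard + 20 := by omega
  have : (10 * Fintype.card V : ℝ) ≤ 3 * G.edgeSet.ncard + 20 := by exact_mod_cast fin
  linarith

end Sys
end OP

namespace OP

variable {V : Type} {G : SimpleGraph V}

/-- The arc of an abstract edge. -/
def eArc (D : Drawing G) (e : Sym2 V) : Set (ℝ × ℝ) :=
  {p | ∃ (u v : V) (h : G.Adj u v), e = s(u, v) ∧ p ∈ D.arc h}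

lemma eArc_eq (D : Drawing G) {u v : V} (h : G.Adj u v) : eArc D s(u, v) = D.arc h := by
  ext p
  constructor
  · rintro ⟨x, y, h', he, hp⟩
    rw [Sym2.eq_iff] at he
    rcases he with ⟨rfl, rfl⟩ | ⟨rfl, rfl⟩
    · exact hp
    · rw [← D.arc_symm h]
      exact hp
  · exact fun hp => ⟨u, v, h, rfl, hp⟩

lemma eArc_mem (D : Drawing G) {e : Sym2 V} {p : ℝ × ℝ} (h : p ∈ eArc D e) : e ∈ G.edgeSet := by
  obtain ⟨u, v, h, rfl, -⟩ := h
  exact h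

lemma pos_mem_arc (D : Drawing G) {u v : V} (h : G.Adj u v) : D.pos u ∈ D.arc h := by
  obtain ⟨γ, -, -, h0, -, he⟩ := D.arc_isArc h
  rw [he, ← h0]
  exact ⟨0, by simp, rfl⟩

def Vt (D : Drawing G) : Prop := ∀ (w : V) (e : Sym2 V), D.pos w ∈ eArc D e → w ∈ e

lemma edgeInt_eq (D : Drawing G) (h : Vt D) (e : Sym2 V) : D.edgeInt e = eArc D e \ range D.pos := by
  ext p
  constructor
  · rintro ⟨u, v, h', rfl, hp⟩
    refine ⟨⟨u, v, h', rfl, hp.1⟩, ?_⟩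
    rintro ⟨w, rfl⟩
    have := h w s(u, v) ⟨u, v, h', rfl, hp.1⟩
    rw [Sym2.mem_iff] at this
    rcases this with rfl | rfl
    · exact hp.2 (by simp)
    · exact hp.2 (by simp)
  · rintro ⟨⟨u, v, h', rfl, hp⟩, hn⟩
    refine ⟨u, v, h', rfl, hp, ?_⟩
    rintro (rfl | rfl)
    · exact hn ⟨u, rfl⟩
    · exact hn ⟨v, rfl⟩

lemma int_inter (D : Drawing G) (h : Vt D) (e f : Sym2 V) : D.edgeInt e ∩ D.edgeInt f =
    (eArc D e ∩ eArc D f) \ range D.pos := by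
  rw [edgeInt_eq D h, edgeInt_eq D h]
  ext p
  simp only [mem_inter_iff, mem_sdiff]
  tauto

lemma arcInt_eq (D : Drawing G) {u v : V} (h : G.Adj u v) : D.arcInt h = D.edgeInt s(u, v) := by
  ext p
  constructor
  · exact fun hp => ⟨u, v, h, rfl, hp⟩
  · rintro ⟨x, y, h', he, hp⟩
    rw [Sym2.eq_iff] at he
    rcases he with ⟨rfl, rfl⟩ | ⟨rfl, rfl⟩
    · exact hp
    · refine ⟨?_, fun h => hp.2 ?_⟩
      · rw [← D.arc_symm h]
        exact hp.1
      · rwa [pair_comm]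

lemma Vt_of (D : Drawing G) (h : D.IsGood) : Vt D := by
  rintro w e ⟨u, v, h', rfl, hp⟩
  rw [Sym2.mem_iff]
  exact h.1 w h' hp

lemma good_of (D : Drawing G) (h : Vt D)
    (h2 : ∀ e f, e ≠ f → ((eArc D e ∩ eArc D f) \ range D.pos).Subsingleton)
    (h3 : ∀ u v w, v ≠ w → (eArc D s(u, v) ∩ eArc D s(u, w)) \ range D.pos = ∅) : D.IsGood := by
  refine ⟨?_, ?_, ?_⟩
  · intro w u v h' hp
    have := h w s(u, v) ⟨u, v, h', rfl, hp⟩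
    rwa [Sym2.mem_iff] at this
  · intro e f hef
    rw [int_inter D h]
    exact h2 e f hef
  · intro u v w h₁ h₂ hvw
    rw [arcInt_eq, arcInt_eq, int_inter D h]
    exact h3 u v w hvw

lemma cross_iff (D : Drawing G) (h : Vt D) (e f : Sym2 V) : D.Cross e f ↔
    e ≠ f ∧ ((eArc D e ∩ eArc D f) \ range D.pos).Nonempty := by
  rw [Drawing.Cross, int_inter D h]

/-- The planar arcs in `ℝ × ℝ`. -/
def RArc (A : Set (ℝ × ℝ)) (a b : ℝ × ℝ) : Prop := ∃ γ : ℝ → ℝ × ℝ,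
  ContinuousOn γ (Icc 0 1) ∧ InjOn γ (Icc 0 1) ∧ γ 0 = a ∧ γ 1 = b ∧ A = γ '' Icc (0 : ℝ) 1

lemma RArc.symm {A : Set (ℝ × ℝ)} {a b : ℝ × ℝ} (h : RArc A a b) : RArc A b a := by
  obtain ⟨γ, hc, hi, h0, h1, rfl⟩ := h
  have hm : MapsTo (fun t : ℝ => 1 - t) (Icc 0 1) (Icc 0 1) := fun t ht => by
    simp only [mem_Icc] at ht ⊢
    constructor <;> linarith [ht.1, ht.2]
  refine ⟨fun t => γ (1 - t), hc.comp (by fun_prop) hm, ?_, by simpa using h1, by simpa using h0, ?_⟩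
  · intro x hx y hy h
    have := hi (hm hx) (hm hy) h
    linarith
  · ext p
    constructor
    · rintro ⟨t, ht, rfl⟩
      exact ⟨1 - t, hm ht, by simp⟩
    · rintro ⟨t, ht, rfl⟩
      exact ⟨1 - t, hm ht, rfl⟩

open Classical in
/-- Redraw (or add) the edge `uv` along `α`. -/
noncomputable def redraw (D : Drawing G) (H : SimpleGraph V) (u v : V) (α : Set (ℝ × ℝ))
    (hα : RArc α (D.pos u) (D.pos v)) (hH : ∀ x y, H.Adj x y → s(x, y) ≠ s(u, v) → G.Adj x y) :
    Drawing H where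
  pos := D.pos
  pos_inj := D.pos_inj
  arc := fun x y _ => if s(x, y) = s(u, v) then α else eArc D s(x, y)
  arc_symm := by
    intro x y h
    simp only [Sym2.eq_swap (a := x) (b := y)]
  arc_isArc := by
    intro x y h
    by_cases he : s(x, y) = s(u, v)
    · simp only [if_pos he]
      rw [Sym2.eq_iff] at he
      rcases he with ⟨rfl, rfl⟩ | ⟨rfl, rfl⟩
      · exact hα
      · exact hα.symm
    · simp only [if_neg he]
      rw [eArc_eq D (hH x y h he)]
      exact D.arc_isArc _

section redraw
variable {D : Drawing G} {H : SimpleGraph V} {u v : V} {α : Set (ℝ × ℝ)}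
  {hα : RArc α (D.pos u) (D.pos v)} {hH : ∀ x y, H.Adj x y → s(x, y) ≠ s(u, v) → G.Adj x y}

lemma redraw_sub {e : Sym2 V} (he : e ≠ s(u, v)) : eArc (redraw D H u v α hα hH) e ⊆ eArc D e := by
  rintro p ⟨x, y, h, rfl, hp⟩
  simp only [redraw, if_neg he] at hp
  exact hp

lemma redraw_self : eArc (redraw D H u v α hα hH) s(u, v) ⊆ α := by
  rintro p ⟨x, y, h, he, hp⟩
  simp only [redraw, if_pos he.symm] at hp
  exact hp

lemma redraw_arc {x y : V} (h : H.Adj x y) (h' : G.Adj x y) (he : s(x, y) ≠ s(u, v)) :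
    (redraw D H u v α hα hH).arc h = D.arc h' := by
  simp only [redraw, if_neg he]
  exact eArc_eq D h'

lemma redraw_good (hg : D.IsGood) (ho : D.IsOnePlanar)
    (hr : ∀ w, D.pos w ∈ α → w = u ∨ w = v)
    (hx : ∀ e f p q, e ≠ s(u, v) → f ≠ s(u, v) → p ∈ α → q ∈ α → p ∈ eArc D e → q ∈ eArc D f →
      p ∉ range D.pos → q ∉ range D.pos → e = f ∧ p = q ∧ u ∉ e ∧ v ∉ e ∧ ∀ g, ¬ D.Cross e g) :
    Vt (redraw D H u v α hα hH) ∧ (redraw D H u v α hα hH).IsGood ∧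
      (redraw D H u v α hα hH).IsOnePlanar := by
  have hv := Vt_of D hg
  set D' := redraw D H u v α hα hH with hD'
  have hpos : D'.pos = D.pos := rfl
  have hv' : Vt D' := by
    intro w e hw
    by_cases he : e = s(u, v)
    · subst he
      rw [Sym2.mem_iff]
      exact hr w (redraw_self hw)
    · exact hv w e (redraw_sub he hw)
  have hcr : ∀ e f, e ≠ s(u, v) → f ≠ s(u, v) → D'.Cross e f → D.Cross e f := by
    intro e f he hf h
    rw [cross_iff D' hv'] at h
    rw [cross_iff D hv]
    obtain ⟨h1, p, ⟨h2, h3⟩, h4⟩ := h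
    exact ⟨h1, p, ⟨redraw_sub he h2, redraw_sub hf h3⟩, h4⟩
  have hcr2 : ∀ f, D'.Cross s(u, v) f → f ≠ s(u, v) ∧ ∃ p, p ∈ α ∧ p ∈ eArc D f ∧ p ∉ range D.pos := by
    intro f h
    rw [cross_iff D' hv'] at h
    obtain ⟨h1, p, ⟨h2, h3⟩, h4⟩ := h
    exact ⟨h1.symm, p, redraw_self h2, redraw_sub h1.symm h3, h4⟩
  have hsymm : ∀ e f, D'.Cross e f → D'.Cross f e := by
    rintro e f ⟨h1, h2⟩
    exact ⟨h1.symm, by rwa [inter_comm]⟩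
  refine ⟨hv', good_of D' hv' ?_ ?_, ?_⟩
  · rintro e f hef p ⟨⟨p1, p2⟩, p3⟩ q ⟨⟨q1, q2⟩, q3⟩
    by_cases he : e = s(u, v)
    · subst he
      exact (hx f f p q hef.symm hef.symm (redraw_self p1) (redraw_self q1) (redraw_sub hef.symm p2)
        (redraw_sub hef.symm q2) p3 q3).2.1
    · by_cases hf : f = s(u, v)
      · subst hf
        exact (hx e e p q hef hef (redraw_self p2) (redraw_self q2) (redraw_sub hef p1)
          (redraw_sub hef q1) p3 q3).2.1
      · have := hg.2.1 e f hef
        rw [int_inter D hv] at this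
        exact this ⟨⟨redraw_sub he p1, redraw_sub hf p2⟩, p3⟩ ⟨⟨redraw_sub he q1, redraw_sub hf q2⟩, q3⟩
  · intro x y z hyz
    have hne : s(x, y) ≠ s(x, z) := by
      intro h
      exact hyz (Sym2.congr_right.1 h)
    rw [eq_empty_iff_forall_notMem]
    rintro p ⟨⟨p1, p2⟩, p3⟩
    have aux : ∀ y z, s(x, y) ≠ s(x, z) → p ∈ eArc D' s(x, y) → p ∈ eArc D' s(x, z) →
        s(x, y) = s(u, v) → False := by
      intro y z hne p1 p2 he
      rw [he] at hne p1
      have := hx _ _ p p hne.symm hne.symm (redraw_self p1) (redraw_self p1) (redraw_sub hne.symm p2)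
        (redraw_sub hne.symm p2) p3 p3
      rw [Sym2.eq_iff] at he
      simp only [Sym2.mem_iff] at this
      grind
    by_cases he : s(x, y) = s(u, v)
    · exact aux y z hne p1 p2 he
    · by_cases hf : s(x, z) = s(u, v)
      · exact aux z y hne.symm p2 p1 hf
      · have q1 := redraw_sub he p1
        have q2 := redraw_sub hf p2
        have h1 : G.Adj x y := eArc_mem D q1
        have h2 : G.Adj x z := eArc_mem D q2
        have := hg.2.2 h1 h2 hyz
        rw [arcInt_eq, arcInt_eq, int_inter D hv] at this
        exact (eq_empty_iff_forall_notMem.1 this) p ⟨⟨q1, q2⟩, p3⟩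
  · intro e f hf f' hf'
    simp only [mem_ofPred_eq] at hf hf'
    by_cases he : e = s(u, v)
    · subst he
      obtain ⟨a1, p, a2, a3, a4⟩ := hcr2 f hf
      obtain ⟨b1, q, b2, b3, b4⟩ := hcr2 f' hf'
      exact (hx f f' p q a1 b1 a2 b2 a3 b3 a4 b4).1
    · have aux : ∀ f, D'.Cross e f → f = s(u, v) → ∀ g, ¬ D.Cross e g := by
        rintro f hf rfl
        obtain ⟨a1, p, a2, a3, a4⟩ := hcr2 e (hsymm _ _ hf)
        exact (hx e e p p a1 a1 a2 a2 a3 a3 a4 a4).2.2.2.2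
      by_cases h1 : f = s(u, v)
      · by_cases h2 : f' = s(u, v)
        · rw [h1, h2]
        · exact absurd (hcr _ _ he h2 hf') (aux f hf h1 f')
      · by_cases h2 : f' = s(u, v)
        · exact absurd (hcr _ _ he h1 hf) (aux f' hf' h2 f)
        · exact ho e (hcr _ _ he h1 hf) (hcr _ _ he h2 hf')

end redraw

/-- No arc can be added. -/
lemma no_add {D : Drawing G} (hmax : D.IsMaximalOnePlane) {u v : V} {α : Set (ℝ × ℝ)} (huv : u ≠ v)
    (hα : RArc α (D.pos u) (D.pos v)) (hr : ∀ w, D.pos w ∈ α → w = u ∨ w = v)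
    (hx : ∀ e f p q, e ≠ s(u, v) → f ≠ s(u, v) → p ∈ α → q ∈ α → p ∈ eArc D e → q ∈ eArc D f →
      p ∉ range D.pos → q ∉ range D.pos → e = f ∧ p = q ∧ u ∉ e ∧ v ∉ e ∧ ∀ g, ¬ D.Cross e g) :
    G.Adj u v := by
  by_contra hn
  have hH : ∀ x y, (G ⊔ SimpleGraph.fromEdgeSet {s(u, v)}).Adj x y → s(x, y) ≠ s(u, v) →
      G.Adj x y := by
    intro x y h hne
    rcases h with h | h
    · exact h
    · exact absurd h.1 hne
  obtain ⟨-, h1, h2⟩ := redraw_good (H := G ⊔ SimpleGraph.fromEdgeSet {s(u, v)}) (hα := hα) (hH := hH)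
    hmax.1 hmax.2.1 hr hx
  refine hmax.2.2 u v huv hn (redraw D _ u v α hα hH) rfl ?_ ⟨h1, h2⟩
  intro x y h
  refine redraw_arc _ h fun he => hn ?_
  rw [← SimpleGraph.mem_edgeSet, ← he]
  exact h

lemma no_cross [Fintype V] {D : Drawing G} (hmax : D.IsMaximalOnePlane) (himm : D.Immovable) {u v : V}
    {α : Set (ℝ × ℝ)} (huv : G.Adj u v)
    (hα : RArc α (D.pos u) (D.pos v)) (hr : ∀ w, D.pos w ∈ α → w = u ∨ w = v)
    (hx : ∀ e p, p ∈ α → p ∈ eArc D e → e ≠ s(u, v) → p ∈ range D.pos) (f : Sym2 V) :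
    ¬ D.Cross s(u, v) f := by
  intro hc
  have hH : ∀ x y, G.Adj x y → s(x, y) ≠ s(u, v) → G.Adj x y := fun x y h _ => h
  obtain ⟨hv', h1, h2⟩ := redraw_good (H := G) (hα := hα) (hH := hH) hmax.1 hmax.2.1 hr
    (fun e f p q he hf hp hq hpe _ hpr => absurd (hx e p hp hpe he) hpr)
  have hv := Vt_of D hmax.1
  have hle := himm (redraw D G u v α hα hH) h1 h2 rfl
    ⟨u, v, huv, fun x y h' hne => redraw_arc h' h' hne⟩
  have hno : ∀ g, ¬ (redraw D G u v α hα hH).Cross s(u, v) g := by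
    intro g hg
    rw [cross_iff _ hv'] at hg
    obtain ⟨a1, p, ⟨a2, a3⟩, a4⟩ := hg
    exact a4 (hx g p (redraw_self a2) (redraw_sub a1.symm a3) a1.symm)
  have hno2 : ∀ g, ¬ (redraw D G u v α hα hH).Cross g s(u, v) := fun g hg =>
    hno g ⟨hg.1.symm, by have := hg.2; rwa [inter_comm]⟩
  have hsub : {p : Sym2 V × Sym2 V | (redraw D G u v α hα hH).Cross p.1 p.2} ⊆
      {p : Sym2 V × Sym2 V | D.Cross p.1 p.2} \ {(s(u, v), f), (f, s(u, v))} := by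
    rintro ⟨e, g⟩ h
    simp only [mem_ofPred_eq] at h
    have he : e ≠ s(u, v) := by
      rintro rfl
      exact hno g h
    have hg : g ≠ s(u, v) := by
      rintro rfl
      exact hno2 e h
    refine ⟨?_, ?_⟩
    · simp only [mem_ofPred_eq]
      rw [cross_iff _ hv'] at h
      rw [cross_iff D hv]
      obtain ⟨a1, p, ⟨a2, a3⟩, a4⟩ := h
      exact ⟨a1, p, ⟨redraw_sub he a2, redraw_sub hg a3⟩, a4⟩
    · rintro (h' | h')
      · exact he (Prod.ext_iff.1 h').1
      · exact hg (Prod.ext_iff.1 h').2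
  have hsub2 : ({(s(u, v), f), (f, s(u, v))} : Set (Sym2 V × Sym2 V)) ⊆
      {p : Sym2 V × Sym2 V | D.Cross p.1 p.2} := by
    rintro _ (rfl | rfl)
    · exact hc
    · exact ⟨hc.1.symm, by have := hc.2; rwa [inter_comm]⟩
  have hpair : ({(s(u, v), f), (f, s(u, v))} : Set (Sym2 V × Sym2 V)).ncard = 2 :=
    ncard_pair fun h => hc.1 (Prod.ext_iff.1 h).1
  have c1 := ncard_le_ncard hsub (toFinite _)
  have c2 := ncard_sdiff_add_ncard_of_subset hsub2 (toFinite _)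
  rw [hpair] at c2
  unfold Drawing.crNum at hle
  omega

end OP

namespace OP

variable {V : Type} {G : SimpleGraph V}

/-- The identification of the plane with `ℂ`. -/
noncomputable def toC : ℝ × ℝ ≃ₜ ℂ := Complex.equivRealProdCLM.symm.toHomeomorph

lemma RArc.toC {A : Set (ℝ × ℝ)} {a b : ℝ × ℝ} (h : RArc A a b) : IsArc (toC '' A) (toC a) (toC b) := by
  obtain ⟨γ, hc, hi, h0, h1, rfl⟩ := h
  exact ⟨fun t => OP.toC (γ t), OP.toC.continuous.comp_continuousOn hc,
    fun x hx y hy h => hi hx hy (OP.toC.injective h), congrArg OP.toC h0, congrArg OP.toC h1, by rw [image_image]⟩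

lemma IsArc.ofC {A : Set ℂ} {a b : ℝ × ℝ} (h : IsArc A (toC a) (toC b)) : RArc (toC ⁻¹' A) a b := by
  obtain ⟨γ, hc, hi, h0, h1, rfl⟩ := h
  refine ⟨fun t => OP.toC.symm (γ t), OP.toC.symm.continuous.comp_continuousOn hc,
    fun x hx y hy h => hi hx hy (OP.toC.symm.injective h), by simp [h0], by simp [h1], ?_⟩
  rw [← Homeomorph.image_symm, image_image]

lemma toC_inter (D : Drawing G) (e f : Sym2 V) :
    ((toC '' eArc D e) ∩ (toC '' eArc D f)) \ range (toC ∘ D.pos) =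
      toC '' ((eArc D e ∩ eArc D f) \ range D.pos) := by
  rw [image_sdiff toC.injective, image_inter toC.injective, range_comp]

noncomputable def mkSys (D : Drawing G) (hg : D.IsGood) (ho : D.IsOnePlanar) : Sys G where
  P := toC ∘ D.pos
  Ar := fun e => toC '' eArc D e
  inj := toC.injective.comp D.pos_inj
  arc := by
    intro u v h
    rw [eArc_eq D h]
    exact RArc.toC (D.arc_isArc h)
  emp := by
    intro e he
    rw [image_eq_empty, eq_empty_iff_forall_notMem]
    exact fun p hp => he (eArc_mem D hp)
  vert := by
    rintro w e ⟨p, hp, h⟩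
    have := toC.injective h
    subst this
    exact Vt_of D hg w e hp
  good := by
    intro e f hef
    rw [toC_inter]
    have := hg.2.1 e f hef
    rw [int_inter D (Vt_of D hg)] at this
    exact this.image _
  adj := by
    intro u v w hvw
    rw [toC_inter, image_eq_empty, eq_empty_iff_forall_notMem]
    rintro p hp
    have h1 : G.Adj u v := eArc_mem D hp.1.1
    have h2 : G.Adj u w := eArc_mem D hp.1.2
    have := hg.2.2 h1 h2 hvw
    rw [arcInt_eq, arcInt_eq, int_inter D (Vt_of D hg)] at this
    exact (eq_empty_iff_forall_notMem.1 this) p hp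
  one := by
    intro e f f' hf hf' h h'
    rw [toC_inter, image_nonempty] at h h'
    exact ho e ((cross_iff D (Vt_of D hg) _ _).2 ⟨hf, h⟩) ((cross_iff D (Vt_of D hg) _ _).2 ⟨hf', h'⟩)

lemma mkSys_Cr (D : Drawing G) (hg : D.IsGood) (ho : D.IsOnePlanar) (e f : Sym2 V) :
    (mkSys D hg ho).Cr e f ↔ D.Cross e f := by
  rw [cross_iff D (Vt_of D hg)]
  change e ≠ f ∧ (((toC '' eArc D e) ∩ (toC '' eArc D f)) \ range (toC ∘ D.pos)).Nonempty ↔ _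
  rw [toC_inter, image_nonempty]

theorem mkEnv [Fintype V] (D : Drawing G) (hmax : D.IsMaximalOnePlane) (hconn : KConnected G 3)
    (himm : D.Immovable) (hn : 5 ≤ Fintype.card V) : (mkSys D hmax.1 hmax.2.1).Env := by
  have hXe : ∀ e p, p ∈ eArc D e → toC p ∈ (mkSys D hmax.1 hmax.2.1).X := fun e p hp =>
    Or.inr (mem_iUnion.2 ⟨e, p, hp, rfl⟩)
  have hXv : ∀ w, toC (D.pos w) ∈ (mkSys D hmax.1 hmax.2.1).X := fun w => Or.inl ⟨w, rfl⟩
  refine ⟨hconn, hn, ?_, ?_⟩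
  · intro u v α huv hα hX
    have hα' : RArc (toC ⁻¹' α) (D.pos u) (D.pos v) := IsArc.ofC hα
    have hr : ∀ w, D.pos w ∈ toC ⁻¹' α → w = u ∨ w = v := by
      intro w hw
      rcases hX ⟨hw, hXv w⟩ with h | h
      · exact Or.inl (D.pos_inj (toC.injective h))
      · exact Or.inr (D.pos_inj (toC.injective h))
    have hx : ∀ e p, p ∈ toC ⁻¹' α → p ∈ eArc D e → p ∈ range D.pos := by
      intro e p hp hpe
      rcases hX ⟨hp, hXe e p hpe⟩ with h | h
      · exact ⟨u, (toC.injective h).symm⟩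
      · exact ⟨v, (toC.injective h).symm⟩
    have hadj : G.Adj u v := no_add hmax huv hα' hr fun e f p q _ _ hp _ hpe _ hpr =>
      absurd (hx e p hp hpe) hpr
    refine ⟨hadj, ?_⟩
    rintro ⟨f, hf⟩
    rw [mkSys_Cr] at hf
    exact no_cross hmax himm hadj hα' hr (fun e p hp hpe _ => hx e p hp hpe) f hf
  · intro u v α e y huv hα he hu hv hy hyr hX
    have hα' : RArc (toC ⁻¹' α) (D.pos u) (D.pos v) := IsArc.ofC hα
    have hr : ∀ w, D.pos w ∈ toC ⁻¹' α → w = u ∨ w = v := by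
      intro w hw
      rcases hX ⟨hw, hXv w⟩ with h | h | h
      · exact Or.inl (D.pos_inj (toC.injective h))
      · exact Or.inr (D.pos_inj (toC.injective h))
      · exact absurd ⟨w, h⟩ hyr
    have hx : ∀ f p, p ∈ toC ⁻¹' α → p ∈ eArc D f → p ∉ range D.pos → toC p = y ∧ f = e := by
      intro f p hp hpf hpr
      rcases hX ⟨hp, hXe f p hpf⟩ with h | h | h
      · exact absurd ⟨u, (toC.injective h).symm⟩ hpr
      · exact absurd ⟨v, (toC.injective h).symm⟩ hpr
      · refine ⟨h, ?_⟩
        by_contra hfe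
        refine he.2 ⟨f, fun h' => hfe h'.symm, y, ⟨hy, p, hpf, h⟩, hyr⟩
    refine no_add hmax huv hα' hr ?_
    intro f f' p q _ _ hp hq hpf hqf hpr hqr
    obtain ⟨h1, rfl⟩ := hx f p hp hpf hpr
    obtain ⟨h2, rfl⟩ := hx f' q hq hqf hqr
    refine ⟨rfl, toC.injective (h1.trans h2.symm), hu, hv, fun g hg => he.2 ⟨g, ?_⟩⟩
    rw [mkSys_Cr]
    exact hg

end OP

/-- Every 3-connected immovable maximal 1-plane graph on `n ≥ 5` vertices
satisfies `|E(G)| ≥ (10/3)(n - 2)`. -/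
theorem stmt_4 {V : Type} [Fintype V] {G : SimpleGraph V} (D : Drawing G)
    (hmax : D.IsMaximalOnePlane) (hconn : KConnected G 3) (himm : D.Immovable)
    (hn : 5 ≤ Fintype.card V) :
    (10 / 3 : ℝ) * ((Fintype.card V : ℝ) - 2) ≤ (G.edgeSet.ncard : ℝ) := by
  exact (OP.mkEnv D hmax hconn himm hn).count
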